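/- There exist constants c > 0 and C > 0 depending only on μ such that for every n ≥ 1 and M ~ M_n(μ), the probability that M has at least one simple complex eigenvalue (i.e. the characteristic polynomial of M has at least one complex root of multiplicity one) is at least 1 − C e^{−cn}. -/

import Mathlib

/- STATEMENT 9: There are constants c, C > 0 depending only on μ such that for every
n ≥ 1, M ~ M_n(μ) has at least one simple complex eigenvalue (a root of multiplicity
one of the characteristic polynomial) with probability at least 1 − C e^{−cn}. -/

open scoped Classical

noncomputable section

/-- The probability of an event `E` for a random `n × n` integer matrix with
independent entries of law `μ`. -/
def matrixProbZ (n : ℕ) (μ : ℤ → ℝ) (E : Set (Matrix (Fin n) (Fin n) ℤ)) : ℝ :=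
  ∑' M : Matrix (Fin n) (Fin n) ℤ, if M ∈ E then (∏ i, ∏ j, μ (M i j)) else 0

set_option linter.unusedSectionVars false

/-- The total weight, with respect to `ω`, of the points of a finite type satisfying `E`. -/
def wsum {α : Type*} [Fintype α] (ω : α → ℝ) (E : α → Prop) : ℝ :=
  ∑ a, if E a then ω a else 0

/-- The product weight on functions `J → β`. -/
def pw {J β : Type*} [Fintype J] (ω : β → ℝ) (X : J → β) : ℝ := ∏ j, ω (X j)

section WeightedSums

variable {α β J : Type*} [Fintype α] [Fintype β] [Fintype J] [DecidableEq J]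

lemma pw_nonneg {ω : β → ℝ} (h : ∀ b, 0 ≤ ω b) (X : J → β) : 0 ≤ pw ω X :=
  Finset.prod_nonneg fun _ _ => h _

lemma sum_pw_mul (ω : β → ℝ) (f : J → β → ℝ) :
    ∑ X : J → β, pw ω X * ∏ j, f j (X j) = ∏ j, ∑ b, ω b * f j b := by
  rw [Finset.prod_univ_sum, Fintype.piFinset_univ]
  exact Finset.sum_congr rfl fun X _ => by rw [pw, Finset.prod_mul_distrib]

lemma sum_pw (ω : β → ℝ) (h : ∑ b, ω b = 1) : ∑ X : J → β, pw ω X = 1 := by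
  simpa [h] using sum_pw_mul (J := J) ω (fun _ _ => 1)

lemma wsum_nonneg {ω : α → ℝ} (h : ∀ a, 0 ≤ ω a) (E : α → Prop) : 0 ≤ wsum ω E :=
  Finset.sum_nonneg fun a _ => by split_ifs; exacts [h a, le_rfl]

lemma wsum_mono {ω : α → ℝ} (h : ∀ a, 0 ≤ ω a) {E F : α → Prop} (hEF : ∀ a, E a → F a) :
    wsum ω E ≤ wsum ω F := by
  refine Finset.sum_le_sum fun a _ => ?_
  by_cases hE : E a
  · simp [hE, hEF a hE]
  · rw [if_neg hE]; split_ifs; exacts [h a, le_rfl]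

lemma wsum_congr {ω : α → ℝ} {E F : α → Prop} (hEF : ∀ a, E a ↔ F a) :
    wsum ω E = wsum ω F := by
  have : E = F := funext fun a => propext (hEF a)
  rw [this]

lemma wsum_true (ω : α → ℝ) : wsum ω (fun _ => True) = ∑ a, ω a := by simp [wsum]

lemma wsum_add_not (ω : α → ℝ) (E : α → Prop) :
    wsum ω E + wsum ω (fun a => ¬ E a) = ∑ a, ω a := by
  rw [wsum, wsum, ← Finset.sum_add_distrib]
  exact Finset.sum_congr rfl fun a _ => by by_cases h : E a <;> simp [h]

lemma wsum_or_le {ω : α → ℝ} (h : ∀ a, 0 ≤ ω a) (E F : α → Prop) :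
    wsum ω (fun a => E a ∨ F a) ≤ wsum ω E + wsum ω F := by
  rw [wsum, wsum, wsum, ← Finset.sum_add_distrib]
  refine Finset.sum_le_sum fun a _ => ?_
  have := h a
  by_cases hE : E a <;> by_cases hF : F a <;> simp [hE, hF, this]

lemma wsum_exists_le {ω : α → ℝ} (h : ∀ a, 0 ≤ ω a) {U : Type*} (s : Finset U)
    (E : U → α → Prop) :
    wsum ω (fun a => ∃ u ∈ s, E u a) ≤ ∑ u ∈ s, wsum ω (E u) := by
  simp only [wsum]
  rw [Finset.sum_comm]
  refine Finset.sum_le_sum fun a _ => ?_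
  have hn : ∀ u ∈ s, 0 ≤ (if E u a then ω a else 0) := fun u _ => by
    split_ifs; exacts [h a, le_rfl]
  split_ifs with hE
  · obtain ⟨u, hu, hE⟩ := hE
    calc ω a = if E u a then ω a else 0 := by simp [hE]
      _ ≤ _ := Finset.single_le_sum hn hu
  · exact Finset.sum_nonneg hn

/-- Events that exclude one another have total weight at most that of their union. -/
lemma sum_wsum_le {ω : α → ℝ} (h : ∀ a, 0 ≤ ω a) {U : Type*} (s : Finset U)
    (E : U → α → Prop) (F : α → Prop) (hF : ∀ u ∈ s, ∀ a, E u a → F a)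
    (hd : ∀ a, ∀ u ∈ s, ∀ u' ∈ s, E u a → E u' a → u = u') :
    ∑ u ∈ s, wsum ω (E u) ≤ wsum ω F := by
  simp only [wsum]
  rw [Finset.sum_comm]
  refine Finset.sum_le_sum fun a _ => ?_
  by_cases hex : ∃ u ∈ s, E u a
  · obtain ⟨u, hu, hE⟩ := hex
    rw [Finset.sum_eq_single_of_mem u hu, if_pos hE, if_pos (hF u hu a hE)]
    intro u' hu' hne
    rw [if_neg]
    exact fun hE' => hne (hd a u' hu' u hu hE' hE)
  · push Not at hex
    rw [Finset.sum_eq_zero fun u hu => if_neg (hex u hu)]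
    split_ifs; exacts [h a, le_rfl]

lemma wsum_eq_sum_mul (ω : α → ℝ) (E : α → Prop) :
    wsum ω E = ∑ a, ω a * (if E a then 1 else 0) :=
  Finset.sum_congr rfl fun a _ => by simp

/-- Independence of the coordinates under a product weight. -/
lemma wsum_pw_forall (ω : β → ℝ) (E : J → β → Prop) :
    wsum (pw ω) (fun X : J → β => ∀ j, E j (X j)) = ∏ j, wsum ω (E j) := by
  simp only [wsum_eq_sum_mul]
  rw [← sum_pw_mul ω (fun j b => if E j b then 1 else 0)]
  refine Finset.sum_congr rfl fun X _ => ?_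
  congr 1
  rw [Finset.prod_ite_zero]
  simp

/-- Fubini for product weights. -/
lemma sum_pw_split (ω : β → ℝ) (p : J → Prop) [DecidablePred p] (F : (J → β) → ℝ) :
    ∑ X : J → β, pw ω X * F X =
      ∑ Y : {j // p j} → β, pw ω Y * ∑ Z : {j // ¬ p j} → β,
        pw ω Z * F ((Equiv.piEquivPiSubtypeProd p (fun _ => β)).symm (Y, Z)) := by
  rw [← (Equiv.piEquivPiSubtypeProd p (fun _ => β)).symm.sum_comp, Fintype.sum_prod_type]
  refine Finset.sum_congr rfl fun Y _ => ?_
  rw [Finset.mul_sum]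
  refine Finset.sum_congr rfl fun Z _ => ?_
  rw [← mul_assoc]
  congr 1
  rw [pw, pw, pw, ← Fintype.prod_subtype_mul_prod_subtype p]
  congr 1
  · refine Finset.prod_congr rfl fun j _ => ?_
    simp [Equiv.piEquivPiSubtypeProd, j.2]
  · refine Finset.prod_congr rfl fun j _ => ?_
    simp [Equiv.piEquivPiSubtypeProd, j.2]

/-- Conditioning on the coordinates satisfying `p`. -/
lemma wsum_and_le_mul {ω : β → ℝ} (h : ∀ b, 0 ≤ ω b) (h1 : ∑ b, ω b = 1)
    (p : J → Prop) [DecidablePred p] (E F : (J → β) → Prop)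
    (hE : ∀ X X' : J → β, (∀ j, p j → X j = X' j) → E X → E X') (t : ℝ)
    (hF : ∀ X : J → β, wsum (pw ω) (fun Z : {j // ¬ p j} → β =>
      F (fun j => if hj : p j then X j else Z ⟨j, hj⟩)) ≤ t) :
    wsum (pw ω) (fun X : J → β => E X ∧ F X) ≤ wsum (pw ω) E * t := by
  rw [wsum_eq_sum_mul, wsum_eq_sum_mul, sum_pw_split ω p, sum_pw_split ω p, Finset.sum_mul]
  refine Finset.sum_le_sum fun Y _ => ?_
  rw [mul_assoc]
  refine mul_le_mul_of_nonneg_left ?_ (pw_nonneg h Y)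
  set e := (Equiv.piEquivPiSubtypeProd p (fun _ : J => β)).symm
  have hYE : ∀ Z Z', E (e (Y, Z)) → E (e (Y, Z')) := by
    intro Z Z'
    apply hE
    intro j hj
    simp [e, Equiv.piEquivPiSubtypeProd, hj]
  by_cases hex : ∃ Z, E (e (Y, Z))
  · obtain ⟨Z₀, hZ₀⟩ := hex
    have hall : ∀ Z, E (e (Y, Z)) := fun Z => hYE Z₀ Z hZ₀
    simp only [hall, true_and, if_true, mul_one]
    rw [sum_pw ω h1, one_mul]
    refine le_trans (le_of_eq ?_) (hF (e (Y, Z₀)))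
    rw [wsum_eq_sum_mul]
    refine Finset.sum_congr rfl fun Z _ => ?_
    have : e (Y, Z) = fun j => if hj : p j then e (Y, Z₀) j else Z ⟨j, hj⟩ := by
      funext j
      by_cases hj : p j <;> simp [e, Equiv.piEquivPiSubtypeProd, hj]
    rw [← this]
  · push Not at hex
    simp [hex]

/-- Markov's inequality. -/
lemma mul_wsum_le_sum {ω : α → ℝ} (h : ∀ a, 0 ≤ ω a) {f : α → ℝ} (hf : ∀ a, 0 ≤ f a) (t : ℝ) :
    t * wsum ω (fun a => t ≤ f a) ≤ ∑ a, ω a * f a := by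
  rw [wsum, Finset.mul_sum]
  refine Finset.sum_le_sum fun a _ => ?_
  split_ifs with ht
  · rw [mul_comm]; exact mul_le_mul_of_nonneg_left ht (h a)
  · rw [mul_zero]; exact mul_nonneg (h a) (hf a)

end WeightedSums

section Characters

variable {G : Type*} [AddCommGroup G] [Finite G] {I : Type*} [Fintype I]

/-- The defect of a character along a vector. -/
def charDefect (χ : AddChar G ℂ) (v : I → G) : ℝ := ∑ i, (1 - (χ (v i)).re)

/-- `|G|` times the probability that a lazy random walk with steps `v` returns to zero. -/
def charSum (c : ℝ) (v : I → G) : ℝ :=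
  ∑ χ : AddChar G ℂ, ∏ i, (1 - c * (1 - (χ (v i)).re))

lemma one_sub_re_nonneg (χ : AddChar G ℂ) (g : G) : 0 ≤ 1 - (χ g).re := by
  have := Complex.re_le_norm (χ g)
  rw [AddChar.norm_apply] at this
  linarith

lemma one_sub_re_le_two (χ : AddChar G ℂ) (g : G) : 1 - (χ g).re ≤ 2 := by
  have := Complex.abs_re_le_norm (χ g)
  rw [AddChar.norm_apply, abs_le] at this
  linarith

lemma charDefect_nonneg (χ : AddChar G ℂ) (v : I → G) : 0 ≤ charDefect χ v :=
  Finset.sum_nonneg fun _ _ => one_sub_re_nonneg χ _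

lemma charDefect_zero (v : I → G) : charDefect 0 v = 0 := by simp [charDefect]

lemma charDefect_neg (χ : AddChar G ℂ) (v : I → G) : charDefect (-χ) v = charDefect χ v := by
  refine Finset.sum_congr rfl fun i _ => ?_
  rw [AddChar.neg_apply, AddChar.map_neg_eq_conj, Complex.conj_re]

lemma one_sub_re_mul_le {z z' : ℂ} (h : ‖z‖ = 1) (h' : ‖z'‖ = 1) :
    1 - (z * z').re ≤ 2 * (1 - z.re) + 2 * (1 - z'.re) := by
  have e1 : z.re ^ 2 + z.im ^ 2 = 1 := by
    have := Complex.sq_norm z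
    rw [h, Complex.normSq_apply] at this; linarith
  have e2 : z'.re ^ 2 + z'.im ^ 2 = 1 := by
    have := Complex.sq_norm z'
    rw [h', Complex.normSq_apply] at this; linarith
  rw [Complex.mul_re]
  nlinarith [sq_nonneg (z.im - z'.im), sq_nonneg (z.re + z'.re - 2)]

lemma charDefect_add_le (χ ψ : AddChar G ℂ) (v : I → G) :
    charDefect (χ + ψ) v ≤ 2 * charDefect χ v + 2 * charDefect ψ v := by
  simp only [charDefect]
  rw [Finset.mul_sum, Finset.mul_sum, ← Finset.sum_add_distrib]
  refine Finset.sum_le_sum fun i _ => ?_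
  rw [AddChar.add_apply]
  exact one_sub_re_mul_le (AddChar.norm_apply _ _) (AddChar.norm_apply _ _)

lemma charFactor_nonneg {c : ℝ} (hc : 0 ≤ c) (hc' : c ≤ 1 / 4) (χ : AddChar G ℂ) (g : G) :
    0 ≤ 1 - c * (1 - (χ g).re) := by
  nlinarith [one_sub_re_le_two χ g, one_sub_re_nonneg χ g]

lemma charProd_nonneg {c : ℝ} (hc : 0 ≤ c) (hc' : c ≤ 1 / 4) (χ : AddChar G ℂ) (v : I → G) :
    0 ≤ ∏ i, (1 - c * (1 - (χ (v i)).re)) :=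
  Finset.prod_nonneg fun _ _ => charFactor_nonneg hc hc' χ _

lemma charProd_le_exp {c : ℝ} (hc : 0 ≤ c) (hc' : c ≤ 1 / 4) (χ : AddChar G ℂ) (v : I → G) :
    ∏ i, (1 - c * (1 - (χ (v i)).re)) ≤ Real.exp (-(c * charDefect χ v)) := by
  rw [charDefect, Finset.mul_sum, ← Finset.sum_neg_distrib, Real.exp_sum]
  refine Finset.prod_le_prod (fun _ _ => charFactor_nonneg hc hc' χ _) fun i _ => ?_
  have := Real.add_one_le_exp (-(c * (1 - (χ (v i)).re)))
  linarith

lemma exp_neg_two_mul_le {x : ℝ} (hx : 0 ≤ x) (hx' : x ≤ 1 / 2) :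
    Real.exp (-(2 * x)) ≤ 1 - x := by
  rw [Real.exp_neg]
  have h1 : 1 + 2 * x ≤ Real.exp (2 * x) := by
    have := Real.add_one_le_exp (2 * x); linarith
  rw [inv_le_comm₀ (Real.exp_pos _) (by linarith)]
  refine le_trans ?_ h1
  rw [inv_le_iff_one_le_mul₀ (by linarith)]
  nlinarith

lemma exp_le_charProd {c : ℝ} (hc : 0 ≤ c) (hc' : c ≤ 1 / 4) (χ : AddChar G ℂ) (v : I → G) :
    Real.exp (-(2 * c * charDefect χ v)) ≤ ∏ i, (1 - c * (1 - (χ (v i)).re)) := by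
  rw [charDefect, Finset.mul_sum, ← Finset.sum_neg_distrib, Real.exp_sum]
  refine Finset.prod_le_prod (fun _ _ => (Real.exp_pos _).le) fun i _ => ?_
  have h0 := one_sub_re_nonneg χ (v i)
  have h2 := one_sub_re_le_two χ (v i)
  have := exp_neg_two_mul_le (x := c * (1 - (χ (v i)).re)) (by positivity) (by nlinarith)
  rwa [← mul_assoc] at this

lemma charSum_le_exp {c : ℝ} (hc : 0 ≤ c) (hc' : c ≤ 1 / 4) (v : I → G) :
    charSum c v ≤ ∑ χ : AddChar G ℂ, Real.exp (-(c * charDefect χ v)) :=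
  Finset.sum_le_sum fun χ _ => charProd_le_exp hc hc' χ v

lemma exp_le_charSum {c : ℝ} (hc : 0 ≤ c) (hc' : c ≤ 1 / 4) (v : I → G) :
    ∑ χ : AddChar G ℂ, Real.exp (-(2 * c * charDefect χ v)) ≤ charSum c v :=
  Finset.sum_le_sum fun χ _ => exp_le_charProd hc hc' χ v

lemma charSum_mono {c c' : ℝ} (hc : 0 ≤ c') (hcc : c' ≤ c) (hc' : c ≤ 1 / 4) (v : I → G) :
    charSum c v ≤ charSum c' v := by
  refine Finset.sum_le_sum fun χ _ => Finset.prod_le_prod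
    (fun _ _ => charFactor_nonneg (hc.trans hcc) hc' χ _) fun i _ => ?_
  have h0 := one_sub_re_nonneg χ (v i)
  nlinarith

lemma charSum_eq_one_add (c : ℝ) (v : I → G) :
    charSum c v = 1 + ∑ χ : AddChar G ℂ with χ ≠ 0, ∏ i, (1 - c * (1 - (χ (v i)).re)) := by
  rw [charSum, ← Finset.add_sum_erase _ _ (Finset.mem_univ (0 : AddChar G ℂ))]
  congr 1
  · simp
  · refine Finset.sum_congr ?_ fun _ _ => rfl
    ext; simp

lemma one_le_charSum {c : ℝ} (hc : 0 ≤ c) (hc' : c ≤ 1 / 4) (v : I → G) : 1 ≤ charSum c v := by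
  rw [charSum_eq_one_add]
  have := Finset.sum_nonneg (s := Finset.univ.filter fun χ : AddChar G ℂ => χ ≠ 0)
    fun χ _ => charProd_nonneg hc hc' χ v
  linarith

lemma card_addChar_eq : (Fintype.card (AddChar G ℂ)) = Nat.card G := by
  have := Fintype.ofFinite G
  rw [Nat.card_eq_fintype_card, ← AddChar.card_eq (α := G)]

end Characters

section RandomRows

variable {G : Type*} [AddCommGroup G] {I : Type*} [Fintype I] [DecidableEq I]
  {ι β : Type*} [Fintype ι] [Fintype β]

/-- The linear combination of `v` with integer coefficients `val (X i)`. -/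
def rdot (val : ι → ℤ) (X : I → ι) (v : I → G) : G := ∑ i, val (X i) • v i

lemma rdot_prod {G' : Type*} [AddCommGroup G'] (val : ι → ℤ) (X : I → ι) (v : I → G)
    (v' : I → G') : rdot val X (fun i => (v i, v' i)) = (rdot val X v, rdot val X v') := by
  simp only [rdot, Prod.smul_mk]
  rw [Prod.ext_iff]
  simp [Prod.fst_sum, Prod.snd_sum]

lemma sum_mul_ite_eq_charSum [Finite G] (ω : β → ℝ) (s : β → G) (b : G) :
    ((wsum ω (fun x => s x = b) : ℝ) : ℂ) =
      (Nat.card G : ℂ)⁻¹ * ∑ χ : AddChar G ℂ, χ (-b) * ∑ x, (ω x : ℂ) * χ (s x) := by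
  have := Fintype.ofFinite G
  have h : ∀ g : G, ∑ χ : AddChar G ℂ, χ g = if g = 0 then (Nat.card G : ℂ) else 0 := by
    intro g
    rw [Nat.card_eq_fintype_card, ← AddChar.sum_apply_eq_ite g]
  have hG : (Nat.card G : ℂ) ≠ 0 := by
    simp
  simp only [Finset.mul_sum]
  rw [Finset.sum_comm, wsum, Complex.ofReal_sum]
  refine Finset.sum_congr rfl fun x _ => ?_
  have : ∀ χ : AddChar G ℂ, (Nat.card G : ℂ)⁻¹ * (χ (-b) * ((ω x : ℂ) * χ (s x))) =
      (Nat.card G : ℂ)⁻¹ * ω x * χ (s x - b) := by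
    intro χ
    rw [sub_eq_add_neg, AddChar.map_add_eq_mul]
    ring
  rw [Finset.sum_congr rfl fun χ _ => this χ, ← Finset.mul_sum, h]
  by_cases hx : s x = b
  · simp only [hx, if_true, sub_self]
    field_simp
  · simp [hx, sub_eq_zero]

lemma addChar_sum (χ : AddChar G ℂ) (s : Finset I) (f : I → G) :
    χ (∑ i ∈ s, f i) = ∏ i ∈ s, χ (f i) := by
  induction s using Finset.induction_on with
  | empty => simp
  | insert a s ha ih => rw [Finset.sum_insert ha, Finset.prod_insert ha, χ.map_add_eq_mul, ih]

lemma sum_pw_char (m : ι → ℝ) (val : ι → ℤ) (v : I → G) (χ : AddChar G ℂ) :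
    ∑ X : I → ι, (pw m X : ℂ) * χ (rdot val X v) =
      ∏ i, ∑ a, (m a : ℂ) * χ (v i) ^ val a := by
  rw [Finset.prod_univ_sum, Fintype.piFinset_univ]
  refine Finset.sum_congr rfl fun X _ => ?_
  rw [rdot, addChar_sum, pw, Complex.ofReal_prod, ← Finset.prod_mul_distrib]
  exact Finset.prod_congr rfl fun i _ => by rw [AddChar.map_zsmul_eq_zpow]

/-- Steps of the lazy walk. -/
def lazyVal : Fin 3 → ℤ := ![0, 1, -1]

/-- Law of the steps of the lazy walk. -/
def lazyLaw (c : ℝ) : Fin 3 → ℝ := ![1 - c, c / 2, c / 2]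

lemma lazyLaw_nonneg {c : ℝ} (hc : 0 ≤ c) (hc' : c ≤ 1 / 4) (a : Fin 3) : 0 ≤ lazyLaw c a := by
  fin_cases a <;> simp [lazyLaw] <;> linarith

lemma sum_lazyLaw (c : ℝ) : ∑ a, lazyLaw c a = 1 := by
  simp [lazyLaw, Fin.sum_univ_three]
  ring

lemma wsum_lazy [Finite G] (c : ℝ) (v : I → G) :
    wsum (pw (lazyLaw c)) (fun Y : I → Fin 3 => rdot lazyVal Y v = 0) =
      charSum c v / Nat.card G := by
  have := sum_mul_ite_eq_charSum (pw (lazyLaw c)) (fun Y : I → Fin 3 => rdot lazyVal Y v) 0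
  apply Complex.ofReal_injective
  rw [this, div_eq_inv_mul]
  push_cast
  congr 1
  rw [charSum]
  push_cast
  refine Finset.sum_congr rfl fun χ _ => ?_
  rw [sum_pw_char, neg_zero, AddChar.map_zero_eq_one, one_mul]
  refine Finset.prod_congr rfl fun i _ => ?_
  rw [Fin.sum_univ_three]
  have l0 : lazyLaw c 0 = 1 - c := rfl
  have l1 : lazyLaw c 1 = c / 2 := rfl
  have l2 : lazyLaw c 2 = c / 2 := rfl
  have v0 : lazyVal 0 = 0 := rfl
  have v1 : lazyVal 1 = 1 := rfl
  have v2 : lazyVal 2 = -1 := rfl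
  rw [l0, l1, l2, v0, v1, v2, zpow_zero, zpow_one, zpow_neg_one]
  have h1 : (χ (v i))⁻¹ = starRingEnd ℂ (χ (v i)) := by
    rw [Complex.inv_def, Complex.normSq_eq_norm_sq, AddChar.norm_apply]
    simp
  have h2 := Complex.add_conj (χ (v i))
  rw [h1]
  push_cast at h2 ⊢
  linear_combination (c / 2 : ℂ) * h2

lemma norm_charFun_le {m : ι → ℝ} (hm : ∀ a, 0 ≤ m a) (hm1 : ∑ a, m a = 1) (val : ι → ℤ)
    {a b : ι} (hab : a ≠ b) {z : ℂ} (hz : ‖z‖ = 1) :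
    ‖∑ k, (m k : ℂ) * z ^ val k‖ ≤ 1 - m a * m b * (1 - (z ^ (val a - val b)).re) := by
  have hz0 : z ≠ 0 := by
    rintro rfl; simp at hz
  set w := z ^ (val a - val b) with hw
  have hwn : ‖w‖ = 1 := by rw [hw, norm_zpow, hz, one_zpow]
  have hb : b ∈ Finset.univ.erase a := Finset.mem_erase.2 ⟨hab.symm, Finset.mem_univ _⟩
  have e1 := Finset.add_sum_erase Finset.univ (fun k => (m k : ℂ) * z ^ val k) (Finset.mem_univ a)
  have e2 := Finset.add_sum_erase _ (fun k => (m k : ℂ) * z ^ val k) hb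
  have f1 := Finset.add_sum_erase Finset.univ m (Finset.mem_univ a)
  have f2 := Finset.add_sum_erase _ m hb
  set R := (Finset.univ.erase a).erase b
  have hR : ‖∑ k ∈ R, (m k : ℂ) * z ^ val k‖ ≤ ∑ k ∈ R, m k := by
    refine (norm_sum_le _ _).trans (Finset.sum_le_sum fun k _ => ?_)
    rw [norm_mul, norm_zpow, hz, one_zpow, mul_one, Complex.norm_real, Real.norm_of_nonneg (hm k)]
  have hRn : 0 ≤ ∑ k ∈ R, m k := Finset.sum_nonneg fun k _ => hm k
  have hab2 : ‖(m a : ℂ) * z ^ val a + m b * z ^ val b‖ = ‖(m a : ℂ) * w + m b‖ := by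
    have : (m a : ℂ) * z ^ val a + m b * z ^ val b = z ^ val b * (m a * w + m b) := by
      have : z ^ val a = z ^ val b * w := by
        rw [hw, ← zpow_add₀ hz0]; congr 1; ring
      rw [this]; ring
    rw [this, norm_mul, norm_zpow, hz, one_zpow, one_mul]
  have hre1 : w.re ≤ 1 := (Complex.re_le_norm w).trans hwn.le
  have hre2 : -1 ≤ w.re := by
    have := (abs_le.1 ((Complex.abs_re_le_norm w).trans hwn.le)).1
    exact this
  have hnw : w.re * w.re + w.im * w.im = 1 := by
    rw [← Complex.normSq_apply, Complex.normSq_eq_norm_sq, hwn, one_pow]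
  have hs1 : m a + m b ≤ 1 := by linarith
  have hma := hm a
  have hmb := hm b
  have hkey : ‖(m a : ℂ) * w + m b‖ ≤ m a + m b - m a * m b * (1 - w.re) := by
    have hma1 : m a ≤ 1 := by linarith
    have hpos : 0 ≤ m a + m b - m a * m b * (1 - w.re) := by
      have : m a * m b * (1 - w.re) ≤ m a * m b * 2 :=
        mul_le_mul_of_nonneg_left (by linarith) (by positivity)
      nlinarith
    refine le_of_sq_le_sq ?_ hpos
    rw [← Complex.normSq_eq_norm_sq, Complex.normSq_apply]
    simp only [Complex.add_re, Complex.mul_re, Complex.ofReal_re, Complex.ofReal_im, zero_mul,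
      sub_zero, Complex.add_im, Complex.mul_im, add_zero]
    have hc : 0 ≤ m a * m b * (1 - w.re) := by
      have : 0 ≤ 1 - w.re := by linarith
      positivity
    have hL : (m a * w.re + m b) * (m a * w.re + m b) + m a * w.im * (m a * w.im) =
        (m a + m b) ^ 2 - 2 * (m a * m b * (1 - w.re)) := by
      linear_combination (m a) ^ 2 * hnw
    rw [hL]
    nlinarith [mul_nonneg hc (sub_nonneg.2 hs1), sq_nonneg (m a * m b * (1 - w.re))]
  calc ‖∑ k, (m k : ℂ) * z ^ val k‖
      = ‖((m a : ℂ) * z ^ val a + m b * z ^ val b) + ∑ k ∈ R, (m k : ℂ) * z ^ val k‖ := by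
        rw [← e1, ← e2, add_assoc]
    _ ≤ ‖(m a : ℂ) * z ^ val a + m b * z ^ val b‖ + ‖∑ k ∈ R, (m k : ℂ) * z ^ val k‖ :=
        norm_add_le _ _
    _ ≤ _ := by rw [hab2]; linarith

/-- Local limit estimate for the law of a random linear combination. -/
lemma abs_wsum_rdot_sub_le [Finite G] {m : ι → ℝ} (hm : ∀ a, 0 ≤ m a) (hm1 : ∑ a, m a = 1)
    (val : ι → ℤ) {a b : ι} (hab : a ≠ b)
    (hcop : IsCoprime (val a - val b) (Nat.card G : ℤ)) (v : I → G) (g : G) :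
    |wsum (pw m) (fun X : I → ι => rdot val X v = g) - 1 / Nat.card G| ≤
      (charSum (m a * m b) v - 1) / Nat.card G := by
  have hform := sum_mul_ite_eq_charSum (pw m) (fun X : I → ι => rdot val X v) g
  set P := wsum (pw m) (fun X : I → ι => rdot val X v = g)
  set d := val a - val b with hd
  have hcard : (0 : ℝ) < Nat.card G := by exact_mod_cast Nat.card_pos
  rw [Finset.sum_congr rfl fun χ _ => by rw [sum_pw_char],
    ← Finset.add_sum_erase _ _ (Finset.mem_univ (0 : AddChar G ℂ))] at hform
  simp only [AddChar.zero_apply, one_zpow, mul_one, one_mul] at hform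
  rw [← Complex.ofReal_sum, hm1, Complex.ofReal_one, Finset.prod_const_one, mul_add, mul_one]
    at hform
  have h2 : ‖((P - 1 / Nat.card G : ℝ) : ℂ)‖ ≤ (Nat.card G : ℝ)⁻¹ *
      ∑ χ ∈ Finset.univ.erase (0 : AddChar G ℂ),
        ∏ i, (1 - m a * m b * (1 - ((d • χ) (v i)).re)) := by
    have : ((P - 1 / Nat.card G : ℝ) : ℂ) = (Nat.card G : ℂ)⁻¹ *
      ∑ χ ∈ Finset.univ.erase (0 : AddChar G ℂ), χ (-g) *
        ∏ i, ∑ k, (m k : ℂ) * χ (v i) ^ val k := by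
      push_cast
      rw [hform, one_div]
      ring
    rw [this, norm_mul, norm_inv, Complex.norm_natCast]
    refine mul_le_mul_of_nonneg_left ?_ (by positivity)
    refine (norm_sum_le _ _).trans (Finset.sum_le_sum fun χ _ => ?_)
    rw [norm_mul, AddChar.norm_apply, one_mul, norm_prod]
    refine Finset.prod_le_prod (fun _ _ => norm_nonneg _) fun i _ => ?_
    refine (norm_charFun_le hm hm1 val hab (AddChar.norm_apply χ (v i))).trans (le_of_eq ?_)
    rw [AddChar.zsmul_apply]
  rw [Complex.norm_real, Real.norm_eq_abs] at h2
  refine h2.trans (le_of_eq ?_)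
  rw [div_eq_inv_mul]
  congr 1
  rw [charSum_eq_one_add, add_sub_cancel_left]
  have hinj : ∀ χ : AddChar G ℂ, d • χ = 0 → χ = 0 := by
    intro χ hχ
    obtain ⟨s, t, hst⟩ := hcop
    have hN : (Nat.card G : ℤ) • χ = 0 := by
      rw [natCast_zsmul, ← card_addChar_eq]
      exact card_nsmul_eq_zero
    calc χ = (s * d + t * (Nat.card G : ℤ)) • χ := by rw [hst, one_zsmul]
      _ = 0 := by rw [add_zsmul, mul_zsmul, mul_zsmul, hχ, hN, zsmul_zero, zsmul_zero, add_zero]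
  have hbij : Function.Bijective (fun χ : AddChar G ℂ => d • χ) := by
    rw [Function.Bijective, and_iff_left_of_imp]
    · intro χ ψ h
      have := hinj (χ - ψ) (by rw [zsmul_sub]; exact sub_eq_zero.2 h)
      exact sub_eq_zero.1 this
    · exact fun h => (Finite.injective_iff_surjective.1 h)
  refine Finset.sum_bij' (fun χ _ => d • χ) (fun χ _ => (Equiv.ofBijective _ hbij).symm χ)
    ?_ ?_ ?_ ?_ ?_
  · intro χ hχ
    simp only [Finset.mem_erase, Finset.mem_univ, and_true, Finset.mem_filter, true_and] at hχ ⊢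
    exact fun h => hχ (hinj χ h)
  · intro χ hχ
    simp only [Finset.mem_erase, Finset.mem_univ, and_true, Finset.mem_filter, true_and] at hχ ⊢
    intro h
    apply hχ
    rw [Equiv.symm_apply_eq] at h
    simpa [zsmul_zero] using h
  · intro χ _
    exact (Equiv.ofBijective _ hbij).symm_apply_apply χ
  · intro χ _
    exact (Equiv.ofBijective _ hbij).apply_symm_apply χ
  · intro χ _; rfl

end RandomRows

section LayerCake

open MeasureTheory Set in
lemma sum_exp_neg_eq_integral {κ : Type*} (s : Finset κ) (F : κ → ℝ) (hF : ∀ x ∈ s, 0 ≤ F x) :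
    IntegrableOn (fun t => Real.exp (-t) * ((s.filter fun x => F x < t).card : ℝ)) (Ioi 0) ∧
    ∑ x ∈ s, Real.exp (-F x) =
      ∫ t in Ioi (0 : ℝ), Real.exp (-t) * ((s.filter fun x => F x < t).card : ℝ) := by
  have hrw : ∀ t : ℝ, Real.exp (-t) * ((s.filter fun x => F x < t).card : ℝ) =
      ∑ x ∈ s, (Ioi (F x)).indicator (fun t => Real.exp (-t)) t := by
    intro t
    rw [Finset.card_filter]
    push_cast
    rw [Finset.mul_sum]
    refine Finset.sum_congr rfl fun x _ => ?_
    by_cases h : F x < t <;> simp [indicator, h]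
  simp only [hrw]
  have h_int : ∀ x ∈ s, IntegrableOn ((Ioi (F x)).indicator fun t => Real.exp (-t)) (Ioi 0) :=
    fun x _ => (integrableOn_exp_neg_Ioi 0).indicator measurableSet_Ioi
  refine ⟨integrable_finsetSum _ h_int, ?_⟩
  rw [integral_finsetSum _ h_int]
  refine Finset.sum_congr rfl fun x hx => ?_
  rw [setIntegral_indicator measurableSet_Ioi, Ioi_inter_Ioi, max_eq_right (hF x hx),
    integral_exp_neg_Ioi]

open MeasureTheory Set in
/-- Comparison of exponential sums through the counting functions of the exponents. -/
lemma two_mul_sum_exp_le {κ : Type*} (s : Finset κ) (F H₁ H₂ : κ → ℝ)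
    (hF : ∀ x ∈ s, 0 ≤ F x) (h₁ : ∀ x ∈ s, 0 ≤ H₁ x) (h₂ : ∀ x ∈ s, 0 ≤ H₂ x)
    (h : ∀ t : ℝ, 0 < t → 2 * (s.filter fun x => F x < t).card ≤
      (s.filter fun x => H₁ x < t).card + (s.filter fun x => H₂ x < t).card) :
    2 * ∑ x ∈ s, Real.exp (-F x) ≤
      ∑ x ∈ s, Real.exp (-H₁ x) + ∑ x ∈ s, Real.exp (-H₂ x) := by
  obtain ⟨i0, e0⟩ := sum_exp_neg_eq_integral s F hF
  obtain ⟨i1, e1⟩ := sum_exp_neg_eq_integral s H₁ h₁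
  obtain ⟨i2, e2⟩ := sum_exp_neg_eq_integral s H₂ h₂
  rw [e0, e1, e2, ← integral_add i1 i2, ← integral_const_mul]
  refine setIntegral_mono_on (i0.const_mul 2) (i1.add i2) measurableSet_Ioi fun t ht => ?_
  have : (2 * (s.filter fun x => F x < t).card : ℝ) ≤
      (s.filter fun x => H₁ x < t).card + (s.filter fun x => H₂ x < t).card := by
    exact_mod_cast h t ht
  have := mul_le_mul_of_nonneg_left this (Real.exp_pos (-t)).le
  linarith

end LayerCake

section Growth

variable {q : ℕ} [hq : Fact q.Prime]

open scoped Pointwise in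
lemma two_mul_card_lt_le {E : ZMod q → ℝ} (h0 : E 0 = 0)
    (hadd : ∀ x y, E (x + y) ≤ 2 * E x + 2 * E y) {t : ℝ} (ht : 0 < t)
    (hlt : ∃ x, 4 * t ≤ E x) :
    2 * ((Finset.univ.erase 0).filter fun x => E x < t).card ≤
      ((Finset.univ.erase 0).filter fun x => E x < 4 * t).card := by
  have hcard : ∀ s : ℝ, 0 < s → (Finset.univ.filter fun x => E x < s).card =
      ((Finset.univ.erase 0).filter fun x => E x < s).card + 1 := by
    intro s hs
    rw [← Finset.card_erase_add_one (s := Finset.univ.filter fun x => E x < s) (a := 0)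
      (by simp [h0, hs])]
    congr 2
    ext x
    simp [and_comm]
  have hne : (Finset.univ.filter fun x => E x < t).Nonempty := ⟨0, by simp [h0, ht]⟩
  have hcd := ZMod.cauchy_davenport hq.out hne hne
  have hsub : (Finset.univ.filter fun x => E x < t) + (Finset.univ.filter fun x => E x < t) ⊆
      Finset.univ.filter fun x => E x < 4 * t := by
    intro z hz
    obtain ⟨x, hx, y, hy, rfl⟩ := Finset.mem_add.1 hz
    simp only [Finset.mem_filter, Finset.mem_univ, true_and] at hx hy ⊢
    linarith [hadd x y]
  have hle := Finset.card_le_card hsub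
  have hltq : (Finset.univ.filter fun x => E x < 4 * t).card < q := by
    obtain ⟨x, hx⟩ := hlt
    have : (Finset.univ.filter fun x => E x < 4 * t) ⊂ (Finset.univ : Finset (ZMod q)) := by
      rw [Finset.ssubset_univ_iff]
      intro h
      have := h ▸ Finset.mem_univ x
      simp only [Finset.mem_filter, Finset.mem_univ, true_and] at this
      linarith
    have := Finset.card_lt_card this
    rwa [Finset.card_univ, ZMod.card] at this
  have h1 := hcard t ht
  have h2 := hcard (4 * t) (by linarith)
  have h3 := hcd.trans hle
  rw [min_le_iff] at h3
  omega

/-- Slowing down an approximately subadditive energy on `ZMod q` by a constant factor decreases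
the exponential sum by a definite factor. -/
lemma sum_exp_energy_le {E : ZMod q → ℝ} (hE : ∀ x, 0 ≤ E x) (h0 : E 0 = 0)
    (hadd : ∀ x y, E (x + y) ≤ 2 * E x + 2 * E y) {a κ : ℝ} (ha : 0 < a)
    (hmax : ∃ x, κ ≤ E x) :
    ∑ x ∈ Finset.univ.erase 0, Real.exp (-(16 * a * E x)) ≤
      (1 + Real.exp (-(3 * a * κ))) / 2 * ∑ x ∈ Finset.univ.erase 0, Real.exp (-(a * E x)) := by
  obtain ⟨x₀, hx₀⟩ := Finite.exists_max E
  have hκ : κ ≤ E x₀ := by obtain ⟨x, hx⟩ := hmax; exact hx.trans (hx₀ x)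
  have key := two_mul_sum_exp_le (Finset.univ.erase (0 : ZMod q)) (fun x => 16 * a * E x)
    (fun x => a * E x) (fun _ => 4 * a * E x₀)
    (fun x _ => by have := hE x; positivity) (fun x _ => by have := hE x; positivity)
    (fun x _ => by have := hE x₀; positivity) (by
      intro t ht
      set s := t / (16 * a) with hs
      have hspos : 0 < s := by positivity
      have hts : t = 16 * a * s := by rw [hs]; field_simp
      have e1 : (fun x => 16 * a * E x < t) = fun x => E x < s := by
        funext x; rw [hts]; simp [ha]
      have e2 : (fun x => a * E x < t) = fun x => E x < 16 * s := by
        funext x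
        rw [hts, show 16 * a * s = a * (16 * s) by ring]; simp [ha]
      have e3 : (fun _ : ZMod q => 4 * a * E x₀ < t) = fun _ => E x₀ < 4 * s := by
        funext x
        rw [hts, show 16 * a * s = 4 * a * (4 * s) by ring]
        rw [mul_lt_mul_iff_right₀ (by positivity)]
      simp only [e1, e2, e3]
      have m1 : ((Finset.univ.erase (0 : ZMod q)).filter fun x => E x < s).card ≤
          ((Finset.univ.erase 0).filter fun x => E x < 16 * s).card :=
        Finset.card_le_card (Finset.monotone_filter_right _ fun x _ hx =>
            lt_of_lt_of_le hx (by linarith))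
      by_cases hlt : E x₀ < 4 * s
      · have e : ((Finset.univ.erase (0 : ZMod q)).filter fun _ => E x₀ < 4 * s) =
            Finset.univ.erase 0 := by simp [hlt]
        rw [e]
        have := Finset.card_filter_le (Finset.univ.erase (0 : ZMod q)) fun x => E x < s
        omega
      · have := two_mul_card_lt_le h0 hadd hspos ⟨x₀, not_lt.1 hlt⟩
        have m2 : ((Finset.univ.erase (0 : ZMod q)).filter fun x => E x < 4 * s).card ≤
          ((Finset.univ.erase 0).filter fun x => E x < 16 * s).card :=
          Finset.card_le_card (Finset.monotone_filter_right _ fun x _ hx =>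
            lt_of_lt_of_le hx (by linarith))
        omega)
  have hlast : ∑ x ∈ Finset.univ.erase (0 : ZMod q), Real.exp (-(4 * a * E x₀)) ≤
      Real.exp (-(3 * a * κ)) * ∑ x ∈ Finset.univ.erase 0, Real.exp (-(a * E x)) := by
    rw [Finset.mul_sum]
    refine Finset.sum_le_sum fun x _ => ?_
    rw [← Real.exp_add, Real.exp_le_exp]
    nlinarith [mul_le_mul_of_nonneg_left hκ ha.le, mul_le_mul_of_nonneg_left (hx₀ x) ha.le]
  linarith

end Growth

section Ratio

/-- The character of a product built from characters of the factors. -/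
def prodChar {A B : Type*} [AddCommGroup A] [AddCommGroup B] (χ : AddChar A ℂ) (ψ : AddChar B ℂ) :
    AddChar (A × B) ℂ :=
  χ.compAddMonoidHom (AddMonoidHom.fst A B) + ψ.compAddMonoidHom (AddMonoidHom.snd A B)

lemma prodChar_apply {A B : Type*} [AddCommGroup A] [AddCommGroup B] (χ : AddChar A ℂ)
    (ψ : AddChar B ℂ)
    (g : A × B) : prodChar χ ψ g = χ g.1 * ψ g.2 := rfl

/-- Characters of a product are pairs of characters. -/
def prodCharEquiv (A B : Type*) [AddCommGroup A] [AddCommGroup B] :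
    AddChar A ℂ × AddChar B ℂ ≃ AddChar (A × B) ℂ where
  toFun P := prodChar P.1 P.2
  invFun χ := (χ.compAddMonoidHom (AddMonoidHom.inl A B),
    χ.compAddMonoidHom (AddMonoidHom.inr A B))
  left_inv P := by
    ext x <;> simp [prodChar_apply]
  right_inv χ := by
    ext x
    obtain ⟨a, b⟩ := x
    simp [prodChar_apply, ← AddChar.map_add_eq_mul]

variable {q : ℕ} [hq : Fact q.Prime] {A : Type*} [AddCommGroup A] [Finite A]
  {I : Type*} [Fintype I]

/-- Characters of `ZMod q` indexed by `ZMod q`. -/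
def zchar (x : ZMod q) : AddChar (ZMod q) ℂ := AddChar.zmodAddEquiv x

lemma zchar_add (x y : ZMod q) : zchar (x + y) = zchar x + zchar y :=
  map_add AddChar.zmodAddEquiv x y

lemma zchar_zero : zchar (0 : ZMod q) = 0 := map_zero AddChar.zmodAddEquiv

lemma zchar_neg (x : ZMod q) : zchar (-x) = -zchar x := map_neg AddChar.zmodAddEquiv x

lemma zchar_apply (x y : ZMod q) : zchar x y = ZMod.stdAddChar (x * y) := rfl

/-- The vector `u` is not tied to `w` by a homomorphism between dual groups. -/
def Nondegenerate (w : I → A) (u : I → ZMod q) : Prop :=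
  ∀ h : ZMod q → AddChar A ℂ, (∀ x y, h (x + y) = h x + h y) →
    ∃ i x, h x (w i) * zchar x (u i) ≠ 1

lemma charDefect_prodChar_add_le (w : I → A) (u : I → ZMod q) (χ χ' : AddChar A ℂ)
    (x x' : ZMod q) :
    charDefect (prodChar (χ + χ') (zchar (x + x'))) (fun i => (w i, u i)) ≤
      2 * charDefect (prodChar χ (zchar x)) (fun i => (w i, u i)) +
      2 * charDefect (prodChar χ' (zchar x')) (fun i => (w i, u i)) := by
  refine le_trans (le_of_eq ?_) (charDefect_add_le _ _ _)
  congr 1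
  ext g
  rw [zchar_add, AddChar.add_apply, prodChar_apply, prodChar_apply, prodChar_apply,
    AddChar.add_apply, AddChar.add_apply]
  ring

lemma charDefect_prodChar_neg (w : I → A) (u : I → ZMod q) (χ : AddChar A ℂ) (x : ZMod q) :
    charDefect (prodChar (-χ) (zchar (-x))) (fun i => (w i, u i)) =
      charDefect (prodChar χ (zchar x)) (fun i => (w i, u i)) := by
  rw [← charDefect_neg]
  congr 1
  ext g
  rw [zchar_neg, AddChar.neg_apply, prodChar_apply, prodChar_apply, AddChar.neg_apply,
    AddChar.neg_apply, Prod.fst_neg, Prod.snd_neg, neg_neg, neg_neg]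

lemma charDefect_prodChar_zero (w : I → A) (u : I → ZMod q) (χ : AddChar A ℂ) :
    charDefect (prodChar χ (zchar 0)) (fun i => (w i, u i)) = charDefect χ w := by
  simp [charDefect, prodChar_apply, zchar_zero]

lemma sum_addChar_prod (f : AddChar (A × ZMod q) ℂ → ℝ) :
    ∑ χ, f χ = ∑ x : ZMod q, ∑ χ : AddChar A ℂ, f (prodChar χ (zchar x)) := by
  rw [← (prodCharEquiv A (ZMod q)).sum_comp, Fintype.sum_prod_type, Finset.sum_comm,
    ← (AddChar.zmodAddEquiv (n := q)).toEquiv.sum_comp]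
  rfl

lemma sum_zmod_one_sub_re {θ : AddChar (ZMod q) ℂ} {x : ZMod q} (hx : θ x ≠ 1) :
    ∑ x : ZMod q, (1 - (θ x).re) = q := by
  rw [Finset.sum_sub_distrib, ← Complex.re_sum, AddChar.sum_eq_ite, if_neg]
  · simp
  · rintro rfl
    simp at hx

/-- Under nondegeneracy, a quarter-speed comparison of the two character sums. -/
lemma charSum_pair_le {c : ℝ} (hc : 0 < c) (hc' : c ≤ 1 / 4) {w : I → A} {u : I → ZMod q}
    (hnd : Nondegenerate w u) {L : ℝ} (hL : 8 < L)
    (hw : ∀ χ : AddChar A ℂ, χ ≠ 0 → L ≤ charDefect χ w) :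
    charSum c (fun i => (w i, u i)) ≤
      1 + (1 + Real.exp (-(3 * c / 32))) / 2 * (charSum (c / 32) (fun i => (w i, u i)) - 1) +
        Nat.card A * q * Real.exp (-(c * L / 4)) := by
  set dd : AddChar A ℂ → ZMod q → ℝ :=
    fun χ x => charDefect (prodChar χ (zchar x)) (fun i => (w i, u i)) with hdd
  have hddn : ∀ χ x, 0 ≤ dd χ x := fun χ x => charDefect_nonneg _ _
  have hadd : ∀ χ χ' x x', dd (χ + χ') (x + x') ≤ 2 * dd χ x + 2 * dd χ' x' :=
    charDefect_prodChar_add_le w u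
  have hneg : ∀ χ x, dd (-χ) (-x) = dd χ x := charDefect_prodChar_neg w u
  have hzero : ∀ χ, dd χ 0 = charDefect χ w := charDefect_prodChar_zero w u
  choose h hmin using fun x : ZMod q => Finite.exists_min fun χ : AddChar A ℂ => dd χ x
  have hsep : ∀ χ x, χ ≠ h x → L / 4 ≤ dd χ x := by
    intro χ x hne
    have h1 := hw (χ + -h x) (fun e => hne (add_neg_eq_zero.1 e))
    have h2 := hadd χ (-h x) x (-x)
    rw [add_neg_cancel, hzero, hneg] at h2
    linarith [hmin x χ]
  set E : ZMod q → ℝ := fun x => dd (h x) x with hEdef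
  have hE0 : E 0 = 0 := le_antisymm (by
    have := hmin 0 0
    rwa [hzero 0, charDefect_zero] at this) (hddn _ _)
  have hEadd : ∀ x y, E (x + y) ≤ 2 * E x + 2 * E y := fun x y =>
    (hmin (x + y) (h x + h y)).trans (hadd _ _ _ _)
  have hmax : ∃ x, (1 / 2 : ℝ) ≤ E x := by
    by_contra! hcon
    have hhom : ∀ x y, h (x + y) = h x + h y := by
      intro x y
      by_contra hne
      have h1 := hsep (h x + h y) (x + y) (fun e => hne e.symm)
      have h2 := hadd (h x) (h y) x y
      have h3 := hcon x
      have h4 := hcon y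
      simp only [hEdef] at h3 h4
      linarith
    obtain ⟨i, x, hix⟩ := hnd h hhom
    let θ : AddChar (ZMod q) ℂ :=
      { toFun := fun x => h x (w i) * zchar x (u i)
        map_zero_eq_one' := by
          have : h 0 = 0 := by
            have := hhom 0 0
            rw [add_zero] at this
            exact left_eq_add.1 this
          simp [this, zchar_zero]
        map_add_eq_mul' := fun a b => by
          rw [hhom, zchar_add, AddChar.add_apply, AddChar.add_apply]; ring }
    have hθ : ∑ x : ZMod q, (1 - (θ x).re) = q := sum_zmod_one_sub_re (x := x) hix
    have hle : ∑ x : ZMod q, (1 - (θ x).re) ≤ ∑ x : ZMod q, E x := by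
      refine Finset.sum_le_sum fun y _ => ?_
      exact Finset.single_le_sum
        (f := fun i => 1 - (prodChar (h y) (zchar y) (w i, u i)).re)
        (fun i _ => one_sub_re_nonneg _ _) (Finset.mem_univ i)
    have hlt : ∑ x : ZMod q, E x ≤ ∑ x : ZMod q, (1 / 2 : ℝ) :=
      Finset.sum_le_sum fun x _ => (hcon x).le
    rw [Finset.sum_const, Finset.card_univ, ZMod.card, nsmul_eq_mul] at hlt
    have : (0 : ℝ) < q := by exact_mod_cast hq.out.pos
    linarith
  have hkey := sum_exp_energy_le (fun x => hddn (h x) x) hE0 hEadd (a := c / 16) (by positivity)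
    hmax
  have hcardA : (Fintype.card (AddChar A ℂ) : ℝ) = Nat.card A := by rw [card_addChar_eq]
  have hup : charSum c (fun i => (w i, u i)) ≤
      1 + ∑ x ∈ Finset.univ.erase (0 : ZMod q), Real.exp (-(c * E x)) +
        Nat.card A * q * Real.exp (-(c * L / 4)) := by
    refine (charSum_le_exp hc.le hc' _).trans ?_
    rw [sum_addChar_prod]
    have h1 : ∀ x : ZMod q, ∑ χ : AddChar A ℂ, Real.exp (-(c * dd χ x)) ≤
        Real.exp (-(c * E x)) + Nat.card A * Real.exp (-(c * L / 4)) := by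
      intro x
      rw [← Finset.add_sum_erase _ _ (Finset.mem_univ (h x))]
      refine add_le_add le_rfl ?_
      calc ∑ χ ∈ Finset.univ.erase (h x), Real.exp (-(c * dd χ x))
          ≤ ∑ χ ∈ Finset.univ.erase (h x), Real.exp (-(c * L / 4)) := by
            refine Finset.sum_le_sum fun χ hχ => Real.exp_le_exp.2 ?_
            have := hsep χ x (Finset.ne_of_mem_erase hχ)
            nlinarith
        _ ≤ ∑ χ : AddChar A ℂ, Real.exp (-(c * L / 4)) :=
            Finset.sum_le_sum_of_subset_of_nonneg (Finset.erase_subset _ _)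
              fun _ _ _ => (Real.exp_pos _).le
        _ = _ := by rw [Finset.sum_const, Finset.card_univ, nsmul_eq_mul, hcardA]
    refine (Finset.sum_le_sum fun x _ => h1 x).trans (le_of_eq ?_)
    rw [Finset.sum_add_distrib, Finset.sum_const, Finset.card_univ, ZMod.card, nsmul_eq_mul,
      ← Finset.add_sum_erase _ _ (Finset.mem_univ (0 : ZMod q)), hE0]
    simp
    ring
  have hlow : 1 + ∑ x ∈ Finset.univ.erase (0 : ZMod q), Real.exp (-(c / 16 * E x)) ≤
      charSum (c / 32) (fun i => (w i, u i)) := by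
    refine le_trans ?_ (exp_le_charSum (by positivity) (by linarith) _)
    rw [sum_addChar_prod]
    have h1 : ∀ x : ZMod q, Real.exp (-(c / 16 * E x)) ≤
        ∑ χ : AddChar A ℂ, Real.exp (-(2 * (c / 32) * dd χ x)) := by
      intro x
      refine le_trans (le_of_eq ?_) (Finset.single_le_sum
        (f := fun χ => Real.exp (-(2 * (c / 32) * dd χ x)))
        (fun _ _ => (Real.exp_pos _).le) (Finset.mem_univ (h x)))
      simp only [hEdef]
      congr 1; ring
    refine le_trans (le_of_eq ?_) (Finset.sum_le_sum fun x _ => h1 x)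
    rw [← Finset.add_sum_erase _ _ (Finset.mem_univ (0 : ZMod q)), hE0]
    simp
  have e16 : ∀ x, 16 * (c / 16) * E x = c * E x := fun x => by ring
  simp only [show ∀ x, dd (h x) x = E x from fun _ => rfl, e16] at hkey
  rw [show 3 * (c / 16) * (1 / 2) = 3 * c / 32 by ring] at hkey
  have : (1 + Real.exp (-(3 * c / 32))) / 2 *
      ∑ x ∈ Finset.univ.erase (0 : ZMod q), Real.exp (-(c / 16 * E x)) ≤
      (1 + Real.exp (-(3 * c / 32))) / 2 * (charSum (c / 32) (fun i => (w i, u i)) - 1) :=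
    mul_le_mul_of_nonneg_left (by linarith) (by positivity)
  linarith

lemma nondegenerate_of_coprime {w : I → A} {u : I → ZMod q} (hcop : (Nat.card A).Coprime q)
    (hu : u ≠ 0) : Nondegenerate w u := by
  intro h hh
  obtain ⟨i, hi⟩ := Function.ne_iff.1 hu
  let H : ZMod q →+ AddChar A ℂ := AddMonoidHom.mk' h hh
  have h0 : ∀ x, h x = 0 := by
    intro x
    have e1 : q • h x = 0 := by
      have : H (q • x) = q • H x := map_nsmul H q x
      rw [nsmul_eq_mul, CharP.cast_eq_zero, zero_mul, map_zero] at this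
      exact this.symm
    have e2 : Nat.card A • h x = 0 := by
      rw [← card_addChar_eq]; exact card_nsmul_eq_zero
    have d1 := addOrderOf_dvd_of_nsmul_eq_zero e1
    have d2 := addOrderOf_dvd_of_nsmul_eq_zero e2
    have := Nat.dvd_gcd d2 d1
    rw [hcop.gcd_eq_one, Nat.dvd_one] at this
    exact AddMonoid.addOrderOf_eq_one_iff.1 this
  refine ⟨i, 1, ?_⟩
  rw [h0, AddChar.zero_apply, one_mul, zchar_apply, one_mul]
  intro h1
  exact hi (ZMod.injective_stdAddChar (by rw [h1, Pi.zero_apply, AddChar.map_zero_eq_one]))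

lemma nondegenerate_of_notMem_span {w u : I → ZMod q}
    (hu : u ∉ Submodule.span (ZMod q) {w}) : Nondegenerate w u := by
  intro h hh
  by_contra! hcon
  apply hu
  obtain ⟨k, hk⟩ := (AddChar.zmodAddEquiv (n := q)).surjective (h 1)
  rw [Submodule.mem_span_singleton]
  refine ⟨-k, funext fun i => ?_⟩
  have := hcon i 1
  rw [← hk, show (AddChar.zmodAddEquiv k : AddChar (ZMod q) ℂ) = zchar k from rfl, zchar_apply,
    zchar_apply, one_mul, ← AddChar.map_add_eq_mul] at this
  have h0 : k * w i + u i = 0 :=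
    ZMod.injective_stdAddChar (by rw [this, AddChar.map_zero_eq_one])
  rw [Pi.smul_apply, smul_eq_mul, neg_mul]
  exact (eq_neg_of_add_eq_zero_right h0).symm

end Ratio

section LinearAlgebra

variable {F : Type*} [Field F]

lemma exists_small_spanning_set {V J : Type*} [AddCommGroup V] [Module F V]
    [FiniteDimensional F V] [Fintype J] (W : Submodule F V) (f : J → V) :
    ∃ S : Finset J, S.card + Module.finrank F W ≤ Module.finrank F V ∧
      ∀ j, f j ∈ W ⊔ Submodule.span F (f '' S) := by
  obtain ⟨κ, a, ha, hspan, hli⟩ := exists_linearIndependent' F (fun j => W.mkQ (f j))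
  have : Fintype κ := Fintype.ofInjective a ha
  refine ⟨Finset.univ.image a, ?_, fun j => ?_⟩
  · rw [Finset.card_image_of_injective _ ha, Finset.card_univ, ← W.finrank_quotient_add_finrank]
    exact Nat.add_le_add_right hli.fintype_card_le_finrank _
  · have hj : W.mkQ (f j) ∈ Submodule.span F (Set.range ((fun j => W.mkQ (f j)) ∘ a)) := by
      rw [hspan]; exact Submodule.subset_span ⟨j, rfl⟩
    have himg : Set.range ((fun j => W.mkQ (f j)) ∘ a) =
        W.mkQ '' (f '' (Finset.univ.image a : Finset J)) := by
      ext x; simp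
    rw [himg, ← Submodule.map_span] at hj
    obtain ⟨y, hy, hyj⟩ := hj
    have : f j - y ∈ W := by
      rw [← Submodule.ker_mkQ W, LinearMap.mem_ker, map_sub, hyj, sub_self]
    have e : f j = (f j - y) + y := by abel
    rw [e]
    exact Submodule.add_mem_sup this hy

lemma exists_row_exchange {I J : Type*} [Fintype I] [Fintype J]
    (hIJ : Fintype.card J = Fintype.card I) {m : ℕ} (Y : Fin m → I → F)
    (hY : LinearIndependent F Y) (f : J → I → F) :
    ∃ S : Finset J, S.card = Fintype.card J - m ∧
      ∀ v : I → F, (∀ i, Y i ⬝ᵥ v = 0) → (∀ j ∈ S, f j ⬝ᵥ v = 0) → ∀ j, f j ⬝ᵥ v = 0 := by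
  obtain ⟨S, hS, hf⟩ := exists_small_spanning_set (Submodule.span F (Set.range Y)) f
  rw [finrank_span_eq_card hY, Fintype.card_fin, Module.finrank_fintype_fun_eq_card] at hS
  obtain ⟨S', hSS, hcard⟩ := Finset.exists_superset_card_eq (s := S) (n := Fintype.card J - m)
    (by omega) (Nat.sub_le _ _)
  refine ⟨S', hcard, fun v hYv hSv j => ?_⟩
  let φ : (I → F) →ₗ[F] F :=
    { toFun := fun x => x ⬝ᵥ v
      map_add' := fun x y => add_dotProduct x y v
      map_smul' := fun a x => smul_dotProduct a x v }
  have hle : Submodule.span F (Set.range Y) ⊔ Submodule.span F (f '' S) ≤ LinearMap.ker φ := by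
    rw [sup_le_iff, Submodule.span_le, Submodule.span_le]
    refine ⟨?_, ?_⟩
    · rintro _ ⟨i, rfl⟩
      exact hYv i
    · rintro _ ⟨j, hj, rfl⟩
      exact hSv j (hSS hj)
  exact hle (hf j)

end LinearAlgebra

section SmallBall

variable {F : Type*} [Field F] {I : Type*} [Fintype I] [DecidableEq I]

/-- An integer valued row read in a field. -/
def rowCast (F : Type*) [Field F] {I ι : Type*} (val : ι → ℤ) (X : I → ι) : I → F :=
  fun i => (val (X i) : F)

lemma rdot_eq_dotProduct {ι : Type*} (val : ι → ℤ) (X : I → ι) (v : I → F) :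
    rdot val X v = rowCast F val X ⬝ᵥ v := by
  simp [rdot, rowCast, dotProduct]

lemma wsum_lazyVal_eq_le (h2 : (2 : F) ≠ 0) {c : ℝ} (hc : c ≤ 1 / 4) (g : F) :
    wsum (lazyLaw c) (fun a => (lazyVal a : F) = g) ≤ 1 - c := by
  have h1 : (1 : F) ≠ 0 := one_ne_zero
  have h3 : (1 : F) ≠ -1 := fun h => h2 (by linear_combination h)
  have v0 : lazyVal 0 = 0 := rfl
  have v1 : lazyVal 1 = 1 := rfl
  have v2 : lazyVal 2 = -1 := rfl
  have l0 : lazyLaw c 0 = 1 - c := rfl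
  have l1 : lazyLaw c 1 = c / 2 := rfl
  have l2 : lazyLaw c 2 = c / 2 := rfl
  rw [wsum, Fin.sum_univ_three, v0, v1, v2, l0, l1, l2]
  push_cast
  by_cases e0 : (0 : F) = g
  · subst e0
    simp [h1]
  · by_cases e1 : (1 : F) = g
    · subst e1
      simp [h1.symm, h3.symm]
      linarith
    · simp [e0, e1]
      split_ifs <;> linarith

/-- A subspace of codimension `k` captures a random row with exponentially small probability. -/
lemma wsum_mem_subspace_le_of_forall {β : Type*} [Fintype β] {ω : β → ℝ} (hω : ∀ b, 0 ≤ ω b)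
    (hω1 : ∑ b, ω b = 1) (val : β → ℤ) {t : ℝ} (ht : 0 ≤ t) (ht1 : t ≤ 1)
    (hval : ∀ g : F, wsum ω (fun b => (val b : F) = g) ≤ t) (H : Submodule F (I → F)) :
    wsum (pw ω) (fun Y : I → β => rowCast F val Y ∈ H) ≤
      t ^ (Fintype.card I - Module.finrank F H) := by
  obtain ⟨S, hS, hf⟩ := exists_small_spanning_set (⊥ : Submodule F (Module.Dual F H))
    (fun i : I => (LinearMap.proj i).comp H.subtype)
  rw [finrank_bot, add_zero, Subspace.dual_finrank_eq] at hS
  simp only [bot_sup_eq] at hf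
  have hdet : ∀ x ∈ H, ∀ y ∈ H, (∀ i ∈ S, x i = y i) → x = y := by
    intro x hx y hy hxy
    funext i
    have hle : Submodule.span F ((fun i : I => (LinearMap.proj i).comp H.subtype) '' (S : Set I)) ≤
        LinearMap.ker (Module.Dual.eval F H (⟨x, hx⟩ - ⟨y, hy⟩)) := by
      rw [Submodule.span_le]
      rintro _ ⟨j, hj, rfl⟩
      simp [hxy j hj]
    have := hle (hf i)
    simpa [sub_eq_zero] using this
  have hcard : Fintype.card {j // ¬ j ∈ S} = Fintype.card I - S.card := by
    rw [Fintype.card_subtype_compl, Fintype.card_coe]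
  have hcond := wsum_and_le_mul (J := I) hω hω1 (fun i => i ∈ S)
    (fun _ => True) (fun Y : I → β => rowCast F val Y ∈ H) (fun _ _ _ h => h)
    (t ^ (Fintype.card I - Module.finrank F H)) (by
      intro X
      by_cases hex : ∃ Z : {j // ¬ j ∈ S} → β,
          rowCast F val (fun j => if hj : j ∈ S then X j else Z ⟨j, hj⟩) ∈ H
      · obtain ⟨Z₀, hZ₀⟩ := hex
        have h1 : wsum (pw ω) (fun Z : {j // ¬ j ∈ S} → β =>
            rowCast F val (fun j => if hj : j ∈ S then X j else Z ⟨j, hj⟩) ∈ H) ≤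
            wsum (pw ω) (fun Z : {j // ¬ j ∈ S} → β =>
              ∀ j, (val (Z j) : F) = val (Z₀ j)) := by
          refine wsum_mono (pw_nonneg hω) fun Z hZ j => ?_
          have h := hdet _ hZ _ hZ₀ (fun i hi => by simp [rowCast, hi])
          have h' := congrFun h j
          simpa [rowCast, j.2] using h'
        refine h1.trans ?_
        rw [wsum_pw_forall ω (fun (j : {j // ¬ j ∈ S}) b => (val b : F) = val (Z₀ j))]
        refine (Finset.prod_le_prod (g := fun _ => t) (fun j _ => wsum_nonneg hω _)
          fun j _ => hval _).trans ?_
        rw [Finset.prod_const, Finset.card_univ, hcard]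
        exact pow_le_pow_of_le_one ht ht1 (by omega)
      · push Not at hex
        have : wsum (pw ω) (fun Z : {j // ¬ j ∈ S} → β =>
            rowCast F val (fun j => if hj : j ∈ S then X j else Z ⟨j, hj⟩) ∈ H) = 0 := by
          simp [wsum, hex]
        rw [this]
        exact pow_nonneg ht _)
  simp only [true_and] at hcond
  rwa [wsum_true, sum_pw _ hω1, one_mul] at hcond

lemma wsum_mem_subspace_le (h2 : (2 : F) ≠ 0) {c : ℝ} (hc : 0 ≤ c) (hc' : c ≤ 1 / 4)
    (H : Submodule F (I → F)) :
    wsum (pw (lazyLaw c)) (fun Y : I → Fin 3 => rowCast F lazyVal Y ∈ H) ≤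
      (1 - c) ^ (Fintype.card I - Module.finrank F H) :=
  wsum_mem_subspace_le_of_forall (lazyLaw_nonneg hc hc') (sum_lazyLaw c) lazyVal (by linarith)
    (by linarith) (wsum_lazyVal_eq_le h2 hc')
    H

/-- Independent random vectors subject to a constraint are typically linearly independent. -/
lemma half_pow_le_wsum_linearIndependent {γ V : Type*} [Fintype γ] [AddCommGroup V] [Module F V]
    {ω : γ → ℝ} (hω : ∀ b, 0 ≤ ω b) (hω1 : ∑ b, ω b = 1) (R : γ → V)
    {m : ℕ} (hm : 1 ≤ m) (E : γ → Prop) {t : ℝ}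
    (hR : ∀ H : Submodule F V, Module.finrank F H ≤ m → wsum ω (fun Y => R Y ∈ H) ≤ t)
    (hsmall : m * t ≤ wsum ω E / 2) :
    wsum ω E ^ m / 2 ≤
      wsum (pw ω) (fun Y : Fin m → γ =>
        LinearIndependent F (fun i => R (Y i)) ∧ ∀ i, E (Y i)) := by
  set ρ := wsum ω E with hρ
  have hpp : ∀ Y : Fin m → γ, 0 ≤ pw ω Y := pw_nonneg hω
  have hρ0 : 0 ≤ ρ := wsum_nonneg hω E
  have hall : wsum (pw ω) (fun Y : Fin m → γ => ∀ i, E (Y i)) = ρ ^ m := by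
    rw [wsum_pw_forall _ (fun _ => E), Finset.prod_const, Finset.card_univ, Fintype.card_fin]
  have hone : ∀ i : Fin m, wsum (pw ω) (fun Y : Fin m → γ =>
      (∀ k, k ≠ i → E (Y k)) ∧ R (Y i) ∈
        Submodule.span F ((fun k => R (Y k)) '' {k | k ≠ i})) ≤
      ρ ^ (m - 1) * t := by
    intro i
    have hE : wsum (pw ω)
        (fun Y : Fin m → γ => ∀ k, k ≠ i → E (Y k)) = ρ ^ (m - 1) := by
      rw [wsum_pw_forall _ (fun k Y => k ≠ i → E Y),
        ← Finset.mul_prod_erase _ _ (Finset.mem_univ i)]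
      have h1 : wsum ω (fun Y => i ≠ i → E Y) = 1 := by
        simp only [ne_eq, not_true_eq_false, false_imp_iff]
        rw [wsum_true, hω1]
      rw [h1, one_mul, Finset.prod_congr rfl (g := fun _ => ρ), Finset.prod_const,
        Finset.card_erase_of_mem (Finset.mem_univ _), Finset.card_univ, Fintype.card_fin]
      intro k hk
      simp [Finset.ne_of_mem_erase hk, hρ]
    rw [← hE]
    refine wsum_and_le_mul hω hω1 (fun k => k ≠ i) _ _ ?_ _ ?_
    · intro X X' hXX h k hk
      rw [← hXX k hk]; exact h k hk
    · intro X
      set H := Submodule.span F ((fun k => R (X k)) '' {k | k ≠ i}) with hH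
      have hcard : Fintype.card {k // ¬ k ≠ i} = 1 := by
        simp
      have h1 : wsum (pw ω) (fun Z : {k // ¬ k ≠ i} → γ =>
          (fun X : Fin m → γ => R (X i) ∈ Submodule.span F ((fun k => R (X k)) '' {k | k ≠ i}))
            (fun j => if hj : j ≠ i then X j else Z ⟨j, hj⟩)) ≤
          wsum (pw ω) (fun Z : {k // ¬ k ≠ i} → γ => ∀ k, R (Z k) ∈ H) := by
        refine wsum_mono (pw_nonneg hω) fun Z hZ k => ?_
        obtain ⟨k, hk⟩ := k
        have hki : k = i := not_not.1 hk
        subst hki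
        simp only [ne_eq, not_true_eq_false, dite_false] at hZ
        refine Submodule.span_mono ?_ hZ
        rintro _ ⟨l, hl, rfl⟩
        have hl' : l ≠ k := hl
        exact ⟨l, hl, by simp [hl']⟩
      refine h1.trans ?_
      rw [wsum_pw_forall ω (fun (_ : {k // ¬ k ≠ i}) Y => R Y ∈ H), Finset.prod_const,
        Finset.card_univ, hcard, pow_one]
      refine hR H ?_
      have e : ((fun k => R (X k)) '' {k | k ≠ i}) =
          ((Finset.univ.filter fun k => k ≠ i).image (fun k => R (X k)) : Finset V) := by
        ext; simp
      rw [hH, e]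
      refine (finrank_span_finset_le_card _).trans ?_
      refine (Finset.card_image_le).trans ?_
      refine (Finset.card_filter_le _ _).trans ?_
      simp
  have hsplit : wsum (pw ω) (fun Y : Fin m → γ => ∀ i, E (Y i)) ≤
      wsum (pw ω) (fun Y : Fin m → γ =>
        LinearIndependent F (fun i => R (Y i)) ∧ ∀ i, E (Y i)) +
      wsum (pw ω) (fun Y : Fin m → γ => ∃ i ∈ Finset.univ,
        ((∀ k, k ≠ i → E (Y k)) ∧ R (Y i) ∈
        Submodule.span F ((fun k => R (Y k)) '' {k | k ≠ i}))) := by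
    refine le_trans (wsum_mono hpp fun Y hY => ?_) (wsum_or_le hpp _ _)
    by_cases hli : LinearIndependent F (fun i => R (Y i))
    · exact Or.inl ⟨hli, hY⟩
    · right
      rw [linearIndependent_iff_notMem_span] at hli
      push Not at hli
      obtain ⟨i, hi⟩ := hli
      refine ⟨i, Finset.mem_univ _, fun k _ => hY k, ?_⟩
      have e : {k | k ≠ i} = (Set.univ \ {i} : Set (Fin m)) := by ext; simp
      rw [e]
      exact hi
  have hsum := (wsum_exists_le hpp Finset.univ _).trans (Finset.sum_le_sum fun i _ => hone i)
  rw [Finset.sum_const, Finset.card_univ, Fintype.card_fin, nsmul_eq_mul] at hsum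
  have hfin : m * (ρ ^ (m - 1) * t) ≤ ρ ^ m / 2 := by
    have : ρ ^ m = ρ ^ (m - 1) * ρ := by rw [← pow_succ]; congr 1; omega
    rw [this]
    have := mul_le_mul_of_nonneg_left hsmall (pow_nonneg hρ0 (m - 1))
    linarith
  linarith

end SmallBall

section Exchange

lemma wsum_forall_mem_le {β J : Type*} [Fintype β] [Fintype J] [DecidableEq J] {ω : β → ℝ}
    (hω : ∀ b, 0 ≤ ω b) (hω1 : ∑ b, ω b = 1) (A : J → β → Prop) {a : ℝ} (S : Finset J)
    (ha : ∀ j ∈ S, wsum ω (A j) ≤ a) :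
    wsum (pw ω) (fun X : J → β => ∀ j ∈ S, A j (X j)) ≤ a ^ S.card := by
  rw [wsum_pw_forall ω (fun j b => j ∈ S → A j b), ← Finset.prod_const]
  have h1 : ∏ j : J, wsum ω (fun b => j ∈ S → A j b) = ∏ j ∈ S, wsum ω (A j) := by
    rw [← Finset.prod_subset (Finset.subset_univ S)]
    · exact Finset.prod_congr rfl fun j hj => wsum_congr fun b => by simp [hj]
    · intro j _ hj
      simp only [hj, false_imp_iff]
      rw [wsum_true, hω1]
  rw [h1]
  exact Finset.prod_le_prod (fun j _ => wsum_nonneg hω _) ha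

variable {β γ U J : Type*} [Fintype β] [Fintype γ] [Fintype J] [DecidableEq J]

/-- The rows of a system which has a solution can be exchanged against auxiliary random rows for
which every candidate is a more likely solution. -/
lemma wsum_exists_solution_le {ω : β → ℝ} (hω : ∀ b, 0 ≤ ω b) (hω1 : ∑ b, ω b = 1)
    {ω' : γ → ℝ} (hω' : ∀ b, 0 ≤ ω' b) {m : ℕ} (hm : m ≤ Fintype.card J)
    (s : Finset U) (A : J → β → Prop) (C : J → U → β → Prop) (A' : γ → Prop) (C' : U → γ → Prop)
    (good : (Fin m → γ) → Prop)
    (hex : ∀ Y, good Y → ∀ X : J → β, ∀ u ∈ s, (∀ i, C' u (Y i)) → (∀ j, C j u (X j)) →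
      ∃ S : Finset J, S.card = Fintype.card J - m ∧ ∀ u' ∈ s, (∀ i, C' u' (Y i)) →
        (∀ j ∈ S, C j u' (X j)) → ∀ j, C j u' (X j))
    (x y : U → ℝ) {r a a' : ℝ}
    (hx : ∀ u ∈ s, ∀ j, wsum ω (fun b => A j b ∧ C j u b) ≤ x u)
    (hy : ∀ u ∈ s, y u ^ m / 2 ≤
      wsum (pw ω') (fun Y : Fin m → γ => good Y ∧ ∀ i, C' u (Y i) ∧ A' (Y i)))
    (hr : 0 ≤ r) (hxy : ∀ u ∈ s, x u ≤ r * y u) (hy0 : ∀ u ∈ s, 0 < y u)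
    (ha : ∀ j, wsum ω (A j) ≤ a) (ha' : wsum ω' A' = a') :
    wsum (pw ω) (fun X : J → β => (∀ j, A j (X j)) ∧ ∃ u ∈ s, ∀ j, C j u (X j)) ≤
      2 * r ^ m * ((Fintype.card J).choose m * a ^ (Fintype.card J - m) * a' ^ m) := by
  let _ : LinearOrder U := linearOrderOfSTO (WellOrderingRel (α := U))
  set n := Fintype.card J
  set Ss := (Finset.univ : Finset J).powersetCard (n - m) with hSs
  have hSmem : ∀ S : Finset J, S ∈ Ss ↔ S.card = n - m := fun S => by
    simp [hSs, Finset.mem_powersetCard]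
  have hp := pw_nonneg (J := J) hω
  have hp' := pw_nonneg (J := Fin m) hω'
  let first : (U → Prop) → U → Prop := fun P u => P u ∧ ∀ u' ∈ s, P u' → u ≤ u'
  let sol : (Fin m → γ) → Finset J → (J → β) → U → Prop := fun Y S X u =>
    (∀ i, C' u (Y i)) ∧ ∀ j ∈ S, C j u (X j)
  let prs : U → ℝ := fun u => wsum (pw ω) (fun X : J → β =>
    (∀ j, A j (X j)) ∧ first (fun u => ∀ j, C j u (X j)) u)
  let ind : (Fin m → γ) → ℝ := fun Y => if ∀ i, A' (Y i) then 1 else 0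
  have hind : ∀ Y, 0 ≤ ind Y := fun Y => by simp only [ind]; split_ifs <;> norm_num
  let Q : U → ℝ := fun u => ∑ Y : Fin m → γ, pw ω' Y * ind Y *
    ∑ S ∈ Ss, wsum (pw ω) (fun X : J → β => first (sol Y S X) u ∧ ∀ j ∈ S, A j (X j))
  have hstep : ∀ u ∈ s, prs u ≤ 2 * r ^ m * Q u := by
    intro u hu
    have hx0 : ∀ j : J, 0 ≤ x u := fun j => (wsum_nonneg hω _).trans (hx u hu j)
    have hyu := hy0 u hu
    have hxm : ∀ S ∈ Ss, ∀ Y : Fin m → γ, wsum (pw ω) (fun X : J → β =>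
        (first (sol Y S X) u ∧ ∀ j ∈ S, A j (X j)) ∧
          ∀ j, j ∉ S → (A j (X j) ∧ C j u (X j))) ≤
        wsum (pw ω) (fun X : J → β => first (sol Y S X) u ∧ ∀ j ∈ S, A j (X j)) *
          (r * y u) ^ m := by
      intro S hS Y
      rw [hSmem] at hS
      refine wsum_and_le_mul hω hω1 (fun j => j ∈ S) _ _ ?_ _ ?_
      · intro X X' hXX h
        have e : sol Y S X' = sol Y S X := by
          funext u
          simp only [sol]
          congr 1
          refine propext ⟨fun h j hj => ?_, fun h j hj => ?_⟩
          · rw [hXX j hj]; exact h j hj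
          · rw [← hXX j hj]; exact h j hj
        rw [e]
        exact ⟨h.1, fun j hj => by rw [← hXX j hj]; exact h.2 j hj⟩
      · intro X
        have h1 : wsum (pw ω) (fun Z : {j // ¬ j ∈ S} → β =>
            ∀ j, j ∉ S → (A j (if hj : j ∈ S then X j else Z ⟨j, hj⟩) ∧
              C j u (if hj : j ∈ S then X j else Z ⟨j, hj⟩))) ≤
            wsum (pw ω) (fun Z : {j // ¬ j ∈ S} → β => ∀ j, A j.1 (Z j) ∧ C j.1 u (Z j)) := by
          refine wsum_mono (pw_nonneg hω) fun Z hZ j => ?_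
          simpa [j.2] using hZ j j.2
        refine h1.trans ?_
        rw [wsum_pw_forall ω (fun (j : {j // ¬ j ∈ S}) b => A j.1 b ∧ C j.1 u b)]
        have h2 : ∏ j : {j // ¬ j ∈ S}, wsum ω (fun b => A j.1 b ∧ C j.1 u b) ≤
            ∏ j : {j // ¬ j ∈ S}, r * y u :=
          Finset.prod_le_prod (fun j _ => wsum_nonneg hω _)
            fun j _ => (hx u hu j.1).trans (hxy u hu)
        refine h2.trans ?_
        rw [Finset.prod_const, Finset.card_univ, Fintype.card_subtype_compl, Fintype.card_coe, hS,
          show Fintype.card J - (n - m) = m by omega]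
    have hone : ∀ Y : Fin m → γ, (if good Y ∧ ∀ i, C' u (Y i) ∧ A' (Y i) then pw ω' Y else 0) *
        prs u ≤ pw ω' Y * ind Y * (∑ S ∈ Ss,
          wsum (pw ω) (fun X : J → β => first (sol Y S X) u ∧ ∀ j ∈ S, A j (X j))) *
            (r * y u) ^ m := by
      intro Y
      have hnn : 0 ≤ ∑ S ∈ Ss,
          wsum (pw ω) (fun X : J → β => first (sol Y S X) u ∧ ∀ j ∈ S, A j (X j)) :=
        Finset.sum_nonneg fun S _ => wsum_nonneg hp _
      split_ifs with hg
      · have hi : ind Y = 1 := if_pos fun i => (hg.2 i).2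
        rw [hi, mul_one, mul_assoc]
        refine mul_le_mul_of_nonneg_left ?_ (hp' Y)
        rw [Finset.sum_mul]
        refine le_trans ?_ (Finset.sum_le_sum fun S hS => hxm S hS Y)
        refine le_trans (wsum_mono hp ?_) (wsum_exists_le hp Ss _)
        rintro X ⟨hA, hC, hmin⟩
        obtain ⟨S, hS, hS'⟩ := hex Y hg.1 X u hu (fun i => (hg.2 i).1) hC
        refine ⟨S, (hSmem S).2 hS, ⟨⟨⟨fun i => (hg.2 i).1, fun j _ => hC j⟩, ?_⟩,
          fun j _ => hA j⟩, fun j _ => ⟨hA j, hC j⟩⟩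
        intro u' hu' hsol
        exact hmin u' hu' (hS' u' hu' hsol.1 hsol.2)
      · rw [zero_mul]
        exact mul_nonneg (mul_nonneg (mul_nonneg (hp' Y) (hind Y)) hnn)
          (pow_nonneg (mul_nonneg hr hyu.le) m)
    have hsum := Finset.sum_le_sum (s := Finset.univ) fun Y _ => hone Y
    rw [← Finset.sum_mul, ← Finset.sum_mul] at hsum
    have hpr : 0 ≤ prs u := wsum_nonneg hp _
    have h2 : y u ^ m / 2 * prs u ≤ Q u * (r * y u) ^ m := by
      refine (mul_le_mul_of_nonneg_right (hy u hu) hpr).trans ?_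
      convert hsum using 1
      simp only [wsum]
      congr! 3
    rw [mul_pow] at h2
    have hym := pow_pos hyu m
    have h3 : y u ^ m * prs u ≤ y u ^ m * (2 * r ^ m * Q u) := by linarith
    exact le_of_mul_le_mul_left h3 hym
  have hstart : wsum (pw ω) (fun X : J → β => (∀ j, A j (X j)) ∧ ∃ u ∈ s, ∀ j, C j u (X j)) ≤
      ∑ u ∈ s, prs u := by
    refine le_trans (wsum_mono hp ?_) (wsum_exists_le hp s _)
    rintro X ⟨hA, u₀, hu₀, hC⟩
    have hne : (s.filter fun u => ∀ j, C j u (X j)).Nonempty := ⟨u₀, by simp [hu₀, hC]⟩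
    have hmem := Finset.min'_mem _ hne
    rw [Finset.mem_filter] at hmem
    exact ⟨_, hmem.1, hA, hmem.2, fun u' hu' hP =>
      Finset.min'_le _ _ (by rw [Finset.mem_filter]; exact ⟨hu', hP⟩)⟩
  have hQ : ∑ u ∈ s, Q u ≤ n.choose m * a ^ (n - m) * a' ^ m := by
    simp only [Q]
    rw [Finset.sum_comm]
    have hY : ∀ Y : Fin m → γ, ∑ u ∈ s, pw ω' Y * ind Y *
        ∑ S ∈ Ss, wsum (pw ω) (fun X : J → β => first (sol Y S X) u ∧ ∀ j ∈ S, A j (X j)) ≤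
        pw ω' Y * ind Y * (n.choose m * a ^ (n - m)) := by
      intro Y
      rw [← Finset.mul_sum, Finset.sum_comm]
      refine mul_le_mul_of_nonneg_left ?_ (mul_nonneg (hp' Y) (hind Y))
      have hS : ∀ S ∈ Ss, ∑ u ∈ s, wsum (pw ω)
          (fun X : J → β => first (sol Y S X) u ∧ ∀ j ∈ S, A j (X j)) ≤ a ^ (n - m) := by
        intro S hS
        rw [hSmem] at hS
        rw [← hS]
        refine le_trans ?_ (wsum_forall_mem_le hω hω1 A S fun j _ => ha j)
        refine sum_wsum_le hp s _ _ (fun u _ X h => h.2) ?_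
        rintro X u hu u' hu' ⟨h, _⟩ ⟨h', _⟩
        exact le_antisymm (h.2 u' hu' h'.1) (h'.2 u hu h.1)
      refine (Finset.sum_le_sum hS).trans (le_of_eq ?_)
      rw [Finset.sum_const, nsmul_eq_mul, hSs, Finset.card_powersetCard, Finset.card_univ,
        Nat.choose_symm hm]
    refine (Finset.sum_le_sum fun Y _ => hY Y).trans (le_of_eq ?_)
    rw [← Finset.sum_mul, mul_comm]
    congr 1
    have := wsum_pw_forall ω' (fun (_ : Fin m) => A')
    rw [wsum_eq_sum_mul, Finset.prod_const, Finset.card_univ, Fintype.card_fin, ha'] at this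
    rw [← this]
    refine Finset.sum_congr rfl fun Y _ => ?_
    simp only [ind]
    congr! 2
  calc _ ≤ _ := hstart
    _ ≤ ∑ u ∈ s, 2 * r ^ m * Q u := Finset.sum_le_sum hstep
    _ = 2 * r ^ m * ∑ u ∈ s, Q u := by rw [Finset.mul_sum]
    _ ≤ _ := mul_le_mul_of_nonneg_left hQ (by positivity)

end Exchange

section Pairs

variable {q : ℕ} [hq : Fact q.Prime] {A : Type*} [AddCommGroup A] [Finite A]
variable {I : Type*} [Fintype I] {c : ℝ}

lemma le_charDefect_of_charSum_le (hc : 0 < c) (hc' : c ≤ 1 / 4) {w : I → A} {h : ℝ}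
    (hw : charSum c w ≤ 1 + Real.exp (-h)) {χ : AddChar A ℂ} (hχ : χ ≠ 0) :
    h / (2 * c) ≤ charDefect χ w := by
  rw [charSum_eq_one_add] at hw
  have h1 : ∏ i, (1 - c * (1 - (χ (w i)).re)) ≤
      ∑ χ : AddChar A ℂ with χ ≠ 0, ∏ i, (1 - c * (1 - (χ (w i)).re)) :=
    Finset.single_le_sum (f := fun χ : AddChar A ℂ => ∏ i, (1 - c * (1 - (χ (w i)).re)))
      (fun χ _ => charProd_nonneg hc.le hc' χ w) (by simp [hχ])
  have h2 := exp_le_charProd hc.le hc' χ w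
  have h3 : -(2 * c * charDefect χ w) ≤ -h := Real.exp_le_exp.1 (h2.trans (h1.trans (by linarith)))
  rw [div_le_iff₀ (by linarith)]
  linarith

lemma charSum_div_le (hc : 0 < c) (hc' : c ≤ 1 / 4) {w : I → A} {h : ℝ}
    (hw : charSum c w ≤ 1 + Real.exp (-h)) :
    charSum (c / 32) w ≤ 1 + Nat.card A * Real.exp (-(h / 64)) := by
  rw [charSum_eq_one_add]
  have h1 : ∀ χ ∈ (Finset.univ.filter fun χ : AddChar A ℂ => χ ≠ 0),
      ∏ i, (1 - c / 32 * (1 - (χ (w i)).re)) ≤ Real.exp (-(h / 64)) := by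
    intro χ hχ
    refine (charProd_le_exp (by linarith) (by linarith) χ w).trans ?_
    have := le_charDefect_of_charSum_le hc hc' hw (by simpa using hχ)
    rw [div_le_iff₀ (by linarith)] at this
    rw [Real.exp_le_exp]
    linarith
  have h2 := Finset.sum_le_card_nsmul _ _ _ h1
  rw [nsmul_eq_mul] at h2
  have h3 : ((Finset.univ.filter fun χ : AddChar A ℂ => χ ≠ 0).card : ℝ) ≤ Nat.card A := by
    rw [← card_addChar_eq]
    exact_mod_cast Finset.card_le_univ _
  have := mul_le_mul_of_nonneg_right h3 (Real.exp_pos (-(h / 64))).le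
  linarith

/-- The ratio of return probabilities of a walk and its lazier version. -/
def lazyRatio (c κ : ℝ) : ℝ := 1 - (1 - (1 + Real.exp (-(3 * c / 32))) / 2) * κ / (2 * (1 + κ))

lemma lazyRatio_lt_one (hc : 0 < c) {κ : ℝ} (hκ : 0 < κ) : lazyRatio c κ < 1 := by
  have h1 : Real.exp (-(3 * c / 32)) < 1 := Real.exp_lt_one_iff.2 (by linarith)
  have : 0 < (1 - (1 + Real.exp (-(3 * c / 32))) / 2) * κ / (2 * (1 + κ)) :=
    div_pos (mul_pos (by linarith) hκ) (by linarith)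
  unfold lazyRatio
  linarith

lemma lazyRatio_pos {κ : ℝ} (hκ : 0 < κ) : 0 < lazyRatio c κ := by
  have h1 : 0 < Real.exp (-(3 * c / 32)) := Real.exp_pos _
  have : (1 - (1 + Real.exp (-(3 * c / 32))) / 2) * κ / (2 * (1 + κ)) < 1 := by
    rw [div_lt_one (by linarith)]
    nlinarith
  unfold lazyRatio
  linarith

lemma charSum_pair_le_ratio (hc : 0 < c) (hc' : c ≤ 1 / 4) {w : I → A} {u : I → ZMod q} {h κ : ℝ}
    (hw : charSum c w ≤ 1 + Real.exp (-h)) (hκ : 0 < κ) (hnd : Nondegenerate w u) (hh : 4 < h)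
    (hsmall : Nat.card A * q * Real.exp (-(h / 8)) ≤
      (1 - (1 + Real.exp (-(3 * c / 32))) / 2) * κ / 2)
    (hu : 1 + κ ≤ charSum (c / 32) (fun i => (w i, u i))) :
    charSum c (fun i => (w i, u i)) ≤
      lazyRatio c κ * charSum (c / 32) (fun i => (w i, u i)) := by
  have hL : 8 < h / (2 * c) := by
    rw [lt_div_iff₀ (by linarith)]
    linarith
  have h1 := charSum_pair_le hc hc' hnd hL fun χ hχ => le_charDefect_of_charSum_le hc hc' hw hχ
  have e : c * (h / (2 * c)) / 4 = h / 8 := by field_simp; norm_num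
  rw [e] at h1
  have hr : Real.exp (-(3 * c / 32)) < 1 := Real.exp_lt_one_iff.2 (by linarith)
  unfold lazyRatio
  set T := charSum (c / 32) (fun i => (w i, u i))
  set r := (1 + Real.exp (-(3 * c / 32))) / 2 with hr'
  have hr1 : 0 < 1 - r := by rw [hr']; linarith
  have h2 : (1 - r) * κ / 2 ≤ (1 - r) * (T - 1) - (1 - r) * κ / (2 * (1 + κ)) * T := by
    have h3 : (1 - r) * κ / (2 * (1 + κ)) * T = (1 - r) * (κ * T / (1 + κ)) / 2 := by
      field_simp
    rw [h3]
    have h4 : κ * T / (1 + κ) ≤ T - 1 := by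
      rw [div_le_iff₀ (by linarith)]
      nlinarith
    have h5 := mul_le_mul_of_nonneg_left h4 hr1.le
    have h6 : κ ≤ T - 1 := by linarith
    have h7 := mul_le_mul_of_nonneg_left h6 hr1.le
    linarith
  linarith

lemma sum_charSum_pair_le (hc : 0 < c) (hc' : c ≤ 1 / 4) [DecidableEq I] (w : I → A) :
    ∑ u : I → ZMod q, charSum c (fun i => (w i, u i)) ≤
      (q : ℝ) ^ Fintype.card I *
        (charSum c w + Nat.card A * q * (1 - c) ^ Fintype.card I) := by
  set n := Fintype.card I with hn
  have hcardq : Fintype.card (I → ZMod q) = q ^ n := by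
    rw [Fintype.card_fun, ZMod.card]
  have h0 : ∀ χ : AddChar A ℂ, ∑ u : I → ZMod q,
      ∏ i, (1 - c * (1 - (prodChar χ (zchar (0 : ZMod q)) (w i, u i)).re)) =
      (q : ℝ) ^ n * ∏ i, (1 - c * (1 - (χ (w i)).re)) := by
    intro χ
    have : ∀ u : I → ZMod q, ∀ i, prodChar χ (zchar (0 : ZMod q)) (w i, u i) = χ (w i) := by
      intro u i
      rw [prodChar_apply, zchar_apply]
      simp
    simp only [this]
    rw [Finset.sum_const, Finset.card_univ, hcardq, nsmul_eq_mul]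
    push_cast
    rfl
  have hx : ∀ x : ZMod q, x ≠ 0 → ∀ χ : AddChar A ℂ, ∑ u : I → ZMod q,
      ∏ i, (1 - c * (1 - (prodChar χ (zchar x) (w i, u i)).re)) = (q : ℝ) ^ n * (1 - c) ^ n := by
    intro x hx χ
    have h1 : ∀ i, ∑ y : ZMod q, (1 - c * (1 - (prodChar χ (zchar x) (w i, y)).re)) =
        q * (1 - c) := by
      intro i
      have h2 : ∑ y : ZMod q, prodChar χ (zchar x) (w i, y) = 0 := by
        simp only [prodChar_apply, zchar_apply]
        rw [← Finset.mul_sum]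
        have := AddChar.sum_mulShift (R' := ℂ) x (ZMod.isPrimitive_stdAddChar q)
        rw [if_neg hx] at this
        have h3 : ∑ y : ZMod q, (ZMod.stdAddChar (x * y) : ℂ) =
            ∑ y : ZMod q, (ZMod.stdAddChar (y * x) : ℂ) :=
          Finset.sum_congr rfl fun y _ => by rw [mul_comm]
        rw [h3, this]
        simp
      have h3 : ∑ y : ZMod q, (prodChar χ (zchar x) (w i, y)).re = 0 := by
        rw [← Complex.re_sum, h2, Complex.zero_re]
      have h4 : ∀ y : ZMod q, 1 - c * (1 - (prodChar χ (zchar x) (w i, y)).re) =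
          (1 - c) + c * (prodChar χ (zchar x) (w i, y)).re := fun y => by ring
      simp only [h4]
      rw [Finset.sum_add_distrib, ← Finset.mul_sum, h3, Finset.sum_const, Finset.card_univ,
        ZMod.card, nsmul_eq_mul]
      ring
    have h5 := Finset.prod_univ_sum (fun _ : I => (Finset.univ : Finset (ZMod q)))
      (fun i y => 1 - c * (1 - (prodChar χ (zchar x) (w i, y)).re))
    rw [Fintype.piFinset_univ] at h5
    rw [← h5]
    simp only [h1]
    rw [Finset.prod_const, Finset.card_univ, mul_pow]
  have hsum : ∑ u : I → ZMod q, charSum c (fun i => (w i, u i)) =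
      ∑ x : ZMod q, ∑ χ : AddChar A ℂ, ∑ u : I → ZMod q,
        ∏ i, (1 - c * (1 - (prodChar χ (zchar x) (w i, u i)).re)) := by
    simp only [charSum]
    rw [Finset.sum_comm, sum_addChar_prod]
  rw [hsum, ← Finset.add_sum_erase _ _ (Finset.mem_univ (0 : ZMod q)), mul_add]
  refine add_le_add (le_of_eq ?_) ?_
  · rw [charSum, Finset.mul_sum]
    exact Finset.sum_congr rfl fun χ _ => h0 χ
  · have h6 : ∀ x ∈ Finset.univ.erase (0 : ZMod q), ∑ χ : AddChar A ℂ, ∑ u : I → ZMod q,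
        ∏ i, (1 - c * (1 - (prodChar χ (zchar x) (w i, u i)).re)) =
        Nat.card A * ((q : ℝ) ^ n * (1 - c) ^ n) := by
      intro x hx'
      rw [Finset.sum_congr rfl fun χ _ => hx x (Finset.ne_of_mem_erase hx') χ, Finset.sum_const,
        Finset.card_univ, card_addChar_eq, nsmul_eq_mul]
    rw [Finset.sum_congr rfl h6, Finset.sum_const, nsmul_eq_mul]
    have h7 : ((Finset.univ.erase (0 : ZMod q)).card : ℝ) ≤ q := by
      have := Finset.card_le_univ (Finset.univ.erase (0 : ZMod q))
      rw [ZMod.card] at this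
      exact_mod_cast this
    have h8 : 0 ≤ (Nat.card A : ℝ) * ((q : ℝ) ^ n * (1 - c) ^ n) := by
      have : 0 ≤ 1 - c := by linarith
      positivity
    calc _ ≤ (q : ℝ) * (Nat.card A * ((q : ℝ) ^ n * (1 - c) ^ n)) :=
          mul_le_mul_of_nonneg_right h7 h8
      _ = _ := by ring

end Pairs

section Stage

variable {ι : Type*} [Fintype ι] {ν : ι → ℝ} {val : ι → ℤ} {a b : ι}
variable {I : Type*} [Fintype I] [DecidableEq I]

lemma mul_atoms_le (hν : ∀ x, 0 ≤ ν x) (hν1 : ∑ x, ν x = 1) (hab : a ≠ b) :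
    ν a * ν b ≤ 1 / 4 := by
  have h : ν a + ν b ≤ 1 := by
    rw [← hν1, ← Finset.sum_pair hab]
    exact Finset.sum_le_sum_of_subset_of_nonneg (Finset.subset_univ _) fun x _ _ => hν x
  nlinarith [sq_nonneg (ν a - ν b), hν a, hν b]

lemma wsum_rdot_le {G : Type*} [AddCommGroup G] [Finite G] (hν : ∀ x, 0 ≤ ν x)
    (hν1 : ∑ x, ν x = 1) (hab : a ≠ b) (hcop : IsCoprime (val a - val b) (Nat.card G : ℤ))
    (v : I → G) (g : G) :
    wsum (pw ν) (fun X : I → ι => rdot val X v = g) ≤ charSum (ν a * ν b) v / Nat.card G := by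
  have h := (abs_le.1 (abs_wsum_rdot_sub_le hν hν1 val hab hcop v g)).2
  rw [sub_div] at h
  linarith

lemma le_wsum_rdot {G : Type*} [AddCommGroup G] [Finite G] (hν : ∀ x, 0 ≤ ν x)
    (hν1 : ∑ x, ν x = 1) (hab : a ≠ b) (hcop : IsCoprime (val a - val b) (Nat.card G : ℤ))
    (v : I → G) (g : G) :
    (2 - charSum (ν a * ν b) v) / Nat.card G ≤ wsum (pw ν) (fun X : I → ι => rdot val X v = g) := by
  have h := (abs_le.1 (abs_wsum_rdot_sub_le hν hν1 val hab hcop v g)).1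
  have e : (2 - charSum (ν a * ν b) v) / (Nat.card G : ℝ) =
      1 / Nat.card G - (charSum (ν a * ν b) v - 1) / Nat.card G := by ring
  linarith

variable {q : ℕ} [hq : Fact q.Prime] {A : Type*} [AddCommGroup A] [Finite A]

lemma wsum_rdot_pair_le (hν : ∀ x, 0 ≤ ν x) (hν1 : ∑ x, ν x = 1) (hab : a ≠ b)
    (hA : IsCoprime (val a - val b) (Nat.card A : ℤ)) (hq' : IsCoprime (val a - val b) (q : ℤ))
    (w : I → A) (u : I → ZMod q) (g : A) (g' : ZMod q) :
    wsum (pw ν) (fun X : I → ι => rdot val X w = g ∧ rdot val X u = g') ≤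
      charSum (ν a * ν b) (fun i => (w i, u i)) / (Nat.card A * q) := by
  have hcop : IsCoprime (val a - val b) (Nat.card (A × ZMod q) : ℤ) := by
    rw [Nat.card_prod, Nat.card_zmod]
    push_cast
    exact hA.mul_right hq'
  have h := wsum_rdot_le hν hν1 hab hcop (fun i => (w i, u i)) (g, g')
  rw [Nat.card_prod, Nat.card_zmod] at h
  push_cast at h
  refine le_trans (le_of_eq (wsum_congr fun X => ?_)) h
  rw [rdot_prod, Prod.mk.injEq]

lemma wsum_exists_moderate_le (hν : ∀ x, 0 ≤ ν x) (hν1 : ∑ x, ν x = 1) (hab : a ≠ b)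
    (hA : IsCoprime (val a - val b) (Nat.card A : ℤ)) (hq' : IsCoprime (val a - val b) (q : ℤ))
    (hc : 0 < ν a * ν b) {η η' K : ℝ} (hη' : 0 < η') (hK : 0 ≤ K) (w : I → A)
    (hw : charSum (ν a * ν b) w ≤ 1 + η) (g : I → A) (lam : ZMod q) (δ : I → ZMod q) :
    wsum (pw (pw ν)) (fun M : I → I → ι => (∀ j, rdot val (M j) w = g j) ∧
      ∃ u ∈ Finset.univ.filter (fun u : I → ZMod q =>
        1 + η' ≤ charSum (ν a * ν b) (fun i => (w i, u i)) ∧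
          charSum (ν a * ν b) (fun i => (w i, u i)) ≤ K),
        ∀ j, rdot val (M j) u = lam * u j + δ j) ≤
      K ^ Fintype.card I * ((η + Nat.card A * q * (1 - ν a * ν b) ^ Fintype.card I) / η') /
        (Nat.card A : ℝ) ^ Fintype.card I := by
  have hc' := mul_atoms_le hν hν1 hab
  set c := ν a * ν b
  set n := Fintype.card I
  set s := Finset.univ.filter (fun u : I → ZMod q =>
        1 + η' ≤ charSum c (fun i => (w i, u i)) ∧ charSum c (fun i => (w i, u i)) ≤ K) with hs
  have hν' := pw_nonneg (J := I) hν
  have hν'' := pw_nonneg (J := I) hν'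
  have hApos : (0 : ℝ) < Nat.card A := by exact_mod_cast Nat.card_pos
  have hqpos : (0 : ℝ) < q := by exact_mod_cast hq.out.pos
  have hone : ∀ u ∈ s, wsum (pw (pw ν)) (fun M : I → I → ι => ∀ j, (rdot val (M j) w = g j ∧
      rdot val (M j) u = lam * u j + δ j)) ≤ (K / (Nat.card A * q)) ^ n := by
    intro u hu
    rw [wsum_pw_forall (pw ν) (fun j X => rdot val X w = g j ∧ rdot val X u = lam * u j + δ j)]
    refine (Finset.prod_le_prod (g := fun _ => K / (Nat.card A * q))
      (fun j _ => wsum_nonneg hν' _) fun j _ =>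
      (wsum_rdot_pair_le hν hν1 hab hA hq' w u _ _).trans ?_).trans
      (by rw [Finset.prod_const, Finset.card_univ])
    have := (Finset.mem_filter.1 hu).2.2
    gcongr
  have hcount : (s.card : ℝ) * η' ≤ (q : ℝ) ^ n * (η + Nat.card A * q * (1 - c) ^ n) := by
    have h1 := sum_charSum_pair_le (q := q) hc hc' w
    have h2 : (s.card : ℝ) * η' ≤ ∑ u : I → ZMod q, (charSum c (fun i => (w i, u i)) - 1) := by
      rw [← nsmul_eq_mul]
      refine (Finset.card_nsmul_le_sum s (fun u => charSum c (fun i => (w i, u i)) - 1) η'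
        fun u hu => ?_).trans ?_
      · have := (Finset.mem_filter.1 hu).2.1
        linarith
      · exact Finset.sum_le_sum_of_subset_of_nonneg (Finset.subset_univ _) fun u _ _ =>
          sub_nonneg.2 (one_le_charSum hc.le hc' _)
    rw [Finset.sum_sub_distrib, Finset.sum_const, Finset.card_univ, Fintype.card_fun, ZMod.card,
      nsmul_eq_mul, mul_one] at h2
    push_cast at h2
    have h3 : (q : ℝ) ^ n * charSum c w ≤ (q : ℝ) ^ n * (1 + η) := by gcongr
    rw [mul_add] at h1 ⊢
    have e : (Fintype.card I) = n := rfl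
    rw [e] at h2 h1
    linarith
  have hu : wsum (pw (pw ν)) (fun M : I → I → ι => (∀ j, rdot val (M j) w = g j) ∧
      ∃ u ∈ s, ∀ j, rdot val (M j) u = lam * u j + δ j) ≤
      ∑ u ∈ s, wsum (pw (pw ν)) (fun M : I → I → ι => ∀ j, (rdot val (M j) w = g j ∧
      rdot val (M j) u = lam * u j + δ j)) := by
    refine le_trans (wsum_mono hν'' ?_) (wsum_exists_le hν'' s _)
    rintro M ⟨h, u, hu, h'⟩
    exact ⟨u, hu, fun j => ⟨h j, h' j⟩⟩
  refine hu.trans ((Finset.sum_le_card_nsmul _ _ _ hone).trans ?_)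
  rw [nsmul_eq_mul, div_pow, mul_pow]
  rw [← le_div_iff₀ hη'] at hcount
  calc (s.card : ℝ) * (K ^ n / ((Nat.card A : ℝ) ^ n * (q : ℝ) ^ n)) ≤
        (q : ℝ) ^ n * (η + Nat.card A * q * (1 - c) ^ n) / η' *
          (K ^ n / ((Nat.card A : ℝ) ^ n * (q : ℝ) ^ n)) := by gcongr
      _ = _ := by field_simp

lemma wsum_exists_structured_le (hν : ∀ x, 0 ≤ ν x) (hν1 : ∑ x, ν x = 1) (hab : a ≠ b)
    (hA : IsCoprime (val a - val b) (Nat.card A : ℤ)) (hq' : IsCoprime (val a - val b) (q : ℤ))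
    (hq2 : 2 < q) (hc : 0 < ν a * ν b) {h κ : ℝ} (w : I → A)
    (hw : charSum (ν a * ν b) w ≤ 1 + Real.exp (-h)) (hκ : 0 < κ) (hh : 4 < h)
    (hsmall : Nat.card A * q * Real.exp (-(h / 8)) ≤
      (1 - (1 + Real.exp (-(3 * (ν a * ν b) / 32))) / 2) * κ / 2)
    {m : ℕ} (hm1 : 1 ≤ m) (hmn : m ≤ Fintype.card I)
    (hm : m * (1 - ν a * ν b / 32) ^ (Fintype.card I - m) ≤ 1 / (Nat.card A * q) / 2)
    (g : I → A) (lam : ZMod q) (δ : I → ZMod q) :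
    wsum (pw (pw ν)) (fun M : I → I → ι => (∀ j, rdot val (M j) w = g j) ∧
      ∃ u ∈ Finset.univ.filter (fun u : I → ZMod q => Nondegenerate w u ∧
        1 + κ ≤ charSum (ν a * ν b / 32) (fun i => (w i, u i))),
        ∀ j, rdot val (M j) u = lam * u j + δ j) ≤
      2 * lazyRatio (ν a * ν b) κ ^ m * ((Fintype.card I).choose m) *
        charSum (ν a * ν b / 32) w ^ Fintype.card I / (Nat.card A : ℝ) ^ Fintype.card I := by
  have hc' := mul_atoms_le hν hν1 hab
  set c := ν a * ν b
  set n := Fintype.card I with hn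
  have hν' := pw_nonneg (J := I) hν
  have hApos : (0 : ℝ) < Nat.card A := by exact_mod_cast Nat.card_pos
  have hqpos : (0 : ℝ) < q := by exact_mod_cast hq.out.pos
  have hc0 : 0 ≤ c / 32 := by linarith
  have hc0' : c / 32 ≤ 1 / 4 := by linarith
  have hcard : (Nat.card (A × ZMod q) : ℝ) = Nat.card A * q := by
    rw [Nat.card_prod, Nat.card_zmod]
    push_cast
    rfl
  have h2 : (2 : ZMod q) ≠ 0 := by
    intro h2
    have : ((2 : ℕ) : ZMod q) = 0 := by exact_mod_cast h2
    rw [ZMod.natCast_eq_zero_iff] at this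
    exact absurd (Nat.le_of_dvd two_pos this) (by omega)
  have hlaz := lazyLaw_nonneg hc0 hc0'
  have hlaz' := pw_nonneg (J := I) hlaz
  have hy : ∀ u : I → ZMod q, wsum (pw (lazyLaw (c / 32)))
      (fun Y : I → Fin 3 => rdot lazyVal Y u = 0 ∧ rdot lazyVal Y w = 0) =
      charSum (c / 32) (fun i => (w i, u i)) / (Nat.card A * q) := by
    intro u
    rw [← hcard, ← wsum_lazy]
    refine wsum_congr fun Y => ?_
    rw [rdot_prod, Prod.mk_eq_zero, and_comm]
  have key := wsum_exists_solution_le (J := I) hν' (sum_pw ν hν1) (m := m)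
    hlaz' hmn (Finset.univ.filter (fun u : I → ZMod q => Nondegenerate w u ∧
        1 + κ ≤ charSum (c / 32) (fun i => (w i, u i))))
    (fun j X => rdot val X w = g j) (fun j u X => rdot val X u = lam * u j + δ j)
    (fun Y : I → Fin 3 => rdot lazyVal Y w = 0) (fun u Y => rdot lazyVal Y u = 0)
    (fun Y : Fin m → I → Fin 3 =>
      LinearIndependent (ZMod q) fun i => rowCast (ZMod q) lazyVal (Y i))
    ?_ (fun u => charSum c (fun i => (w i, u i)) / (Nat.card A * q))
    (fun u => charSum (c / 32) (fun i => (w i, u i)) / (Nat.card A * q))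
    (r := lazyRatio c κ) (a := charSum (c / 32) w / Nat.card A)
    (a' := charSum (c / 32) w / Nat.card A) ?_ ?_ (lazyRatio_pos hκ).le ?_ ?_ ?_
    (wsum_lazy (c / 32) w)
  · refine key.trans (le_of_eq ?_)
    rw [div_pow, div_pow]
    have e1 : charSum (c / 32) w ^ n = charSum (c / 32) w ^ (n - m) * charSum (c / 32) w ^ m := by
      rw [← pow_add]; congr 1; omega
    have e2 : (Nat.card A : ℝ) ^ n = (Nat.card A : ℝ) ^ (n - m) * (Nat.card A : ℝ) ^ m := by
      rw [← pow_add]; congr 1; omega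
    rw [e1, e2, ← hn]
    field_simp
  · intro Y hY X u _ hYu hXu
    obtain ⟨S, hS, hS'⟩ := exists_row_exchange (J := I) rfl
      (fun i => rowCast (ZMod q) lazyVal (Y i)) hY
      (fun j => rowCast (ZMod q) val (X j) - lam • (Pi.single j 1))
    refine ⟨S, hS, fun u' _ hYu' hSu' j => ?_⟩
    have hlin : ∀ j, (rowCast (ZMod q) val (X j) - lam • (Pi.single j 1)) ⬝ᵥ (u' - u) =
        (rdot val (X j) u' - lam * u' j) - (rdot val (X j) u - lam * u j) := by
      intro j
      rw [rdot_eq_dotProduct, rdot_eq_dotProduct, dotProduct_sub, sub_dotProduct, sub_dotProduct,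
        smul_dotProduct, smul_dotProduct, single_dotProduct, single_dotProduct]
      simp
    have := hS' (u' - u) (fun i => by
      rw [dotProduct_sub, ← rdot_eq_dotProduct, ← rdot_eq_dotProduct, hYu' i, hYu i, sub_zero])
      (fun j hj => by rw [hlin, hSu' j hj, hXu j]; ring) j
    rw [hlin, hXu j] at this
    linear_combination this
  · intro u _ j
    exact wsum_rdot_pair_le hν hν1 hab hA hq' w u _ _
  · intro u _
    rw [← hy u]
    refine half_pow_le_wsum_linearIndependent hlaz' (sum_pw _ (sum_lazyLaw _))
      (fun Y : I → Fin 3 => rowCast (ZMod q) lazyVal Y) hm1 _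
      (t := (1 - c / 32) ^ (n - m)) ?_ ?_
    · intro H hH
      refine (wsum_mem_subspace_le h2 hc0 hc0' H).trans ?_
      exact pow_le_pow_of_le_one (by linarith) (by linarith) (by omega)
    · refine hm.trans ?_
      rw [hy u]
      have := one_le_charSum hc0 hc0' (fun i => (w i, u i))
      gcongr
  · intro u hu
    have hu' := (Finset.mem_filter.1 hu).2
    have := charSum_pair_le_ratio hc hc' hw hκ hu'.1 hh hsmall hu'.2
    rw [← mul_div_assoc]
    gcongr
  · intro u _
    have := one_le_charSum hc0 hc0' (fun i => (w i, u i))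
    positivity
  · intro j
    refine (wsum_rdot_le hν hν1 hab hA w (g j)).trans ?_
    have := charSum_mono hc0 (by linarith : c / 32 ≤ c) hc' w
    gcongr

end Stage

section Asymptotics

open Filter

lemma eventually_exp_neg_mul_le {a C : ℝ} (ha : 0 < a) (hC : 0 < C) :
    ∀ᶠ n : ℕ in atTop, Real.exp (-(a * n)) ≤ C := by
  have h : Tendsto (fun n : ℕ => Real.exp (-(a * n))) atTop (nhds 0) :=
    Real.tendsto_exp_neg_atTop_nhds_zero.comp
      (tendsto_natCast_atTop_atTop.const_mul_atTop ha)
  exact h.eventually_le_const hC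

lemma eventually_mul_exp_neg_mul_le {a C : ℝ} (ha : 0 < a) (hC : 0 < C) :
    ∀ᶠ n : ℕ in atTop, n * Real.exp (-(a * n)) ≤ C := by
  have h := tendsto_pow_const_mul_const_pow_of_abs_lt_one 1 (r := Real.exp (-a))
    (by rw [abs_of_pos (Real.exp_pos _)]; exact Real.exp_lt_one_iff.2 (by linarith))
  filter_upwards [h.eventually_le_const hC] with n hn
  rw [pow_one, ← Real.exp_nat_mul] at hn
  rwa [show -(a * n) = n * -a by ring]

lemma choose_mul_pow_le {t : ℝ} (ht : 0 ≤ t) {n k : ℕ} (hk : k ≤ n) :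
    n.choose k * t ^ k ≤ (1 + t) ^ n := by
  rw [add_comm, add_pow]
  have := Finset.single_le_sum (s := Finset.range (n + 1))
    (f := fun m => t ^ m * 1 ^ (n - m) * (n.choose m : ℝ)) (fun i _ => by positivity)
    (Finset.mem_range.2 (Nat.lt_succ_of_le hk))
  simp only [one_pow, mul_one] at this ⊢
  linarith

lemma exists_pow_mul_choose_le {r : ℝ} (hr : 0 < r) (hr1 : r < 1) :
    ∃ θ s : ℝ, 0 < θ ∧ 0 < s ∧ ∀ᶠ n : ℕ in atTop, ∃ m : ℕ, 1 ≤ m ∧ m ≤ n ∧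
      θ * n ≤ (n - m : ℕ) ∧ r ^ m * n.choose m ≤ Real.exp (-(s * n)) := by
  set ρ := (1 + r) / 2 with hρ
  set τ := (1 - r) / 2 with hτ
  have hρ0 : 0 < ρ := by rw [hρ]; linarith
  have hτ0 : 0 < τ := by rw [hτ]; linarith
  have hs0 : 0 < -Real.log ρ := neg_pos.2 (Real.log_neg hρ0 (by rw [hρ]; linarith))
  have hl : 0 < -Real.log τ := neg_pos.2 (Real.log_neg hτ0 (by rw [hτ]; linarith))
  set s₀ := -Real.log ρ
  set l := -Real.log τ
  set θ := min (1 / 2) (s₀ / (2 * l)) with hθ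
  have hθ0 : 0 < θ := lt_min (by norm_num) (by positivity)
  have hθ2 : θ ≤ 1 / 2 := min_le_left _ _
  have hθl : θ * l ≤ s₀ / 2 := by
    have h : θ ≤ s₀ / (2 * l) := min_le_right _ _
    rw [le_div_iff₀ (by positivity)] at h
    linarith
  refine ⟨θ / 2, s₀ / 2, by positivity, by positivity, ?_⟩
  filter_upwards [eventually_ge_atTop ⌈2 / θ⌉₊, eventually_ge_atTop 1] with n hn hn1
  have hn' : 2 / θ ≤ n := (Nat.le_ceil _).trans (by exact_mod_cast hn)
  rw [div_le_iff₀ hθ0] at hn'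
  have hn1' : (1 : ℝ) ≤ n := by exact_mod_cast hn1
  set k := ⌊θ * n⌋₊
  have hk1 : (k : ℝ) ≤ θ * n := Nat.floor_le (by positivity)
  have hk2 : θ * n < k + 1 := Nat.lt_floor_add_one _
  have hkn : (k : ℝ) ≤ n / 2 := hk1.trans (by nlinarith)
  have hkn' : k < n := by
    have : (k : ℝ) < n := by linarith
    exact_mod_cast this
  refine ⟨n - k, by omega, Nat.sub_le _ _, ?_, ?_⟩
  · rw [Nat.sub_sub_self hkn'.le]
    nlinarith
  · rw [Nat.choose_symm hkn'.le]
    have h1 := choose_mul_pow_le (t := τ / r) (by positivity) hkn'.le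
    have e1 : 1 + τ / r = ρ / r := by
      rw [hτ, hρ]; field_simp; ring
    rw [e1, div_pow τ r k, div_pow ρ r n] at h1
    have e2 : r ^ n = r ^ (n - k) * r ^ k := by rw [← pow_add]; congr 1; omega
    have h2 : r ^ (n - k) * n.choose k * τ ^ k ≤ ρ ^ n := by
      have hrn : 0 < r ^ n := by positivity
      have := mul_le_mul_of_nonneg_right h1 hrn.le
      rw [div_mul_cancel₀ _ hrn.ne', e2] at this
      refine le_trans (le_of_eq ?_) this
      field_simp
    have e3 : ρ ^ n = Real.exp (-(s₀ * n)) := by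
      rw [← Real.exp_log hρ0, ← Real.exp_nat_mul]
      congr 1
      simp only [s₀]
      ring
    have e4 : τ ^ k = Real.exp (-(l * k)) := by
      rw [← Real.exp_log hτ0, ← Real.exp_nat_mul]
      congr 1
      simp only [l]
      ring
    rw [e3, e4] at h2
    calc r ^ (n - k) * n.choose k =
          r ^ (n - k) * n.choose k * Real.exp (-(l * k)) * Real.exp (l * k) := by
          rw [mul_assoc _ (Real.exp _), ← Real.exp_add]; simp
      _ ≤ Real.exp (-(s₀ * n)) * Real.exp (l * k) := by gcongr
      _ ≤ Real.exp (-(s₀ / 2 * n)) := by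
          rw [← Real.exp_add, Real.exp_le_exp]
          have := mul_le_mul_of_nonneg_left hk1 hl.le
          have := mul_le_mul_of_nonneg_right hθl (by linarith : (0 : ℝ) ≤ n)
          nlinarith

/-- The numerical conditions under which a structured kernel vector is excluded. -/
lemma exists_stage_parameters {c κ : ℝ} (hc : 0 < c) (hc' : c ≤ 1 / 4) (hκ : 0 < κ)
    (hκc : κ ≤ c / 4) :
    ∃ ε₀ : ℝ, 0 < ε₀ ∧ ∀ ε, 0 < ε → ε ≤ ε₀ → ∀ᶠ n : ℕ in atTop, ∀ Q Q' : ℝ, 1 ≤ Q → 1 ≤ Q' →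
      Q ≤ Real.exp (ε * n) → Q' ≤ Real.exp (ε * n) →
      4 < 2 * κ * n ∧
      Q * Q' * Real.exp (-(2 * κ * n / 8)) ≤
        (1 - (1 + Real.exp (-(3 * c / 32))) / 2) * (κ / 4) / 2 ∧
      (∃ m : ℕ, 1 ≤ m ∧ m ≤ n ∧ m * (1 - c / 32) ^ (n - m) ≤ 1 / (Q * Q') / 2 ∧
        2 * lazyRatio c (κ / 4) ^ m * n.choose m *
          (1 + Q * Real.exp (-(2 * κ * n / 64))) ^ n ≤ Real.exp (-(8 * ε * n)) / 2) ∧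
      (1 + κ / 4) ^ n * ((Real.exp (-(2 * κ * n)) + Q * Q' * (1 - c) ^ n) /
        Real.exp (-(κ * n))) ≤ Real.exp (-(8 * ε * n)) / 2 := by
  obtain ⟨θ, s, hθ, hs, hm⟩ := exists_pow_mul_choose_le
    (lazyRatio_pos (c := c) (by linarith : 0 < κ / 4))
    (lazyRatio_lt_one hc (by linarith : 0 < κ / 4))
  refine ⟨min (κ / 64) (min (c * θ / 128) (s / 16)), by positivity, fun ε hε hle => ?_⟩
  have hεκ : ε ≤ κ / 64 := hle.trans (min_le_left _ _)
  have hεθ : ε ≤ c * θ / 128 := hle.trans ((min_le_right _ _).trans (min_le_left _ _))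
  have hεs : ε ≤ s / 16 := hle.trans ((min_le_right _ _).trans (min_le_right _ _))
  have hr : Real.exp (-(3 * c / 32)) < 1 := Real.exp_lt_one_iff.2 (by linarith)
  have hC : 0 < (1 - (1 + Real.exp (-(3 * c / 32))) / 2) * (κ / 4) / 2 :=
    div_pos (mul_pos (by linarith) (by linarith)) two_pos
  filter_upwards [hm, eventually_gt_atTop ⌈4 / (2 * κ)⌉₊,
    eventually_exp_neg_mul_le (a := κ / 8) (by linarith) hC,
    eventually_mul_exp_neg_mul_le (a := c * θ / 64) (by positivity) (by norm_num : (0 : ℝ) < 1 / 2),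
    eventually_mul_exp_neg_mul_le (a := κ / 64) (by positivity) (by norm_num : (0 : ℝ) < 1),
    eventually_exp_neg_mul_le (a := s / 2) (by linarith) (by norm_num : (0 : ℝ) < 1 / 16),
    eventually_exp_neg_mul_le (a := κ / 4) (by linarith) (by norm_num : (0 : ℝ) < 1 / 4)]
    with n hmn hn1 hn2 hn3 hn4 hn5 hn6 Q Q' hQ hQ' hQe hQe'
  have hn0 : (0 : ℝ) ≤ n := Nat.cast_nonneg n
  have hQQ : Q * Q' ≤ Real.exp (2 * ε * n) := by
    calc Q * Q' ≤ Real.exp (ε * n) * Real.exp (ε * n) := by gcongr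
      _ = _ := by rw [← Real.exp_add]; congr 1; ring
  have hQQ0 : 0 < Q * Q' := by positivity
  refine ⟨?_, ?_, ?_, ?_⟩
  · have : 4 / (2 * κ) < n := (Nat.le_ceil _).trans_lt (by exact_mod_cast hn1)
    rw [div_lt_iff₀ (by linarith)] at this
    linarith
  · refine le_trans ?_ hn2
    calc Q * Q' * Real.exp (-(2 * κ * n / 8)) ≤
        Real.exp (2 * ε * n) * Real.exp (-(2 * κ * n / 8)) := by gcongr
      _ ≤ _ := by
        rw [← Real.exp_add, Real.exp_le_exp]
        have := mul_le_mul_of_nonneg_right hεκ hn0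
        nlinarith
  · obtain ⟨m, hm1, hm2, hm3, hm4⟩ := hmn
    refine ⟨m, hm1, hm2, ?_, ?_⟩
    · have h1 : (1 - c / 32) ^ (n - m) ≤
          Real.exp (-(c * θ / 64 * n)) * Real.exp (-(2 * ε * n)) := by
        calc (1 - c / 32) ^ (n - m) ≤ Real.exp (-(c / 32)) ^ (n - m) := by
              have := Real.add_one_le_exp (-(c / 32))
              gcongr
              · linarith
              · linarith
          _ = Real.exp ((n - m : ℕ) * -(c / 32)) := by rw [Real.exp_nat_mul]
          _ ≤ _ := by
              rw [← Real.exp_add, Real.exp_le_exp]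
              have h2 := mul_le_mul_of_nonneg_left hm3 hc.le
              have h3 := mul_le_mul_of_nonneg_right hεθ hn0
              nlinarith
      have h2 : (m : ℝ) ≤ n := by exact_mod_cast hm2
      have h0 : 0 ≤ (1 - c / 32) ^ (n - m) := pow_nonneg (by linarith) _
      calc m * (1 - c / 32) ^ (n - m) ≤
            n * (Real.exp (-(c * θ / 64 * n)) * Real.exp (-(2 * ε * n))) := by
            gcongr
        _ = n * Real.exp (-(c * θ / 64 * n)) * Real.exp (-(2 * ε * n)) := by ring
        _ ≤ 1 / 2 * Real.exp (-(2 * ε * n)) := by gcongr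
        _ = 1 / Real.exp (2 * ε * n) / 2 := by rw [Real.exp_neg]; field_simp
        _ ≤ _ := by gcongr
    · have h1 : (1 + Q * Real.exp (-(2 * κ * n / 64))) ^ n ≤ 4 := by
        have h2 : Q * Real.exp (-(2 * κ * n / 64)) ≤ Real.exp (-(κ / 64 * n)) := by
          calc Q * Real.exp (-(2 * κ * n / 64)) ≤
              Real.exp (ε * n) * Real.exp (-(2 * κ * n / 64)) := by gcongr
            _ ≤ _ := by
              rw [← Real.exp_add, Real.exp_le_exp]
              have := mul_le_mul_of_nonneg_right hεκ hn0
              nlinarith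
        calc (1 + Q * Real.exp (-(2 * κ * n / 64))) ^ n ≤
              Real.exp (Real.exp (-(κ / 64 * n))) ^ n := by
              have := Real.add_one_le_exp (Real.exp (-(κ / 64 * n)))
              gcongr
              linarith
          _ = Real.exp (n * Real.exp (-(κ / 64 * n))) := by rw [Real.exp_nat_mul]
          _ ≤ Real.exp 1 := Real.exp_le_exp.2 hn4
          _ ≤ 4 := by have := Real.exp_one_lt_d9; linarith
      calc 2 * lazyRatio c (κ / 4) ^ m * n.choose m * (1 + Q * Real.exp (-(2 * κ * n / 64))) ^ n =
            2 * (lazyRatio c (κ / 4) ^ m * n.choose m) *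
              (1 + Q * Real.exp (-(2 * κ * n / 64))) ^ n := by ring
        _ ≤ 2 * Real.exp (-(s * n)) * 4 := by gcongr
        _ = 8 * (Real.exp (-(s / 2 * n)) * Real.exp (-(s / 2 * n))) := by
            rw [← Real.exp_add, show -(s / 2 * n) + -(s / 2 * (n : ℝ)) = -(s * n) by ring]; ring
        _ ≤ 8 * (1 / 16 * Real.exp (-(8 * ε * n))) := by
            have := mul_le_mul_of_nonneg_right hεs hn0
            have h3 : Real.exp (-(s / 2 * n)) ≤ Real.exp (-(8 * ε * n)) := by
              rw [Real.exp_le_exp]; linarith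
            gcongr
        _ = _ := by ring
  · have hK : (1 + κ / 4) ^ n ≤ Real.exp (κ / 4 * n) := by
      have := Real.add_one_le_exp (κ / 4)
      calc (1 + κ / 4) ^ n ≤ Real.exp (κ / 4) ^ n := by
            gcongr
            linarith
        _ = _ := by rw [← Real.exp_nat_mul, mul_comm]
    have hcn : (1 - c) ^ n ≤ Real.exp (-(c * n)) := by
      have := Real.add_one_le_exp (-c)
      calc (1 - c) ^ n ≤ Real.exp (-c) ^ n := by
            gcongr
            · linarith
            · linarith
        _ = _ := by rw [← Real.exp_nat_mul]; congr 1; ring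
    have hcn0 : 0 ≤ (1 - c) ^ n := pow_nonneg (by linarith) n
    have h2 : Q * Q' * (1 - c) ^ n ≤ Real.exp (-(2 * κ * n)) := by
      calc Q * Q' * (1 - c) ^ n ≤ Real.exp (2 * ε * n) * Real.exp (-(c * n)) := by gcongr
        _ ≤ _ := by
            rw [← Real.exp_add, Real.exp_le_exp]
            have := mul_le_mul_of_nonneg_right hεκ hn0
            have := mul_le_mul_of_nonneg_right hκc hn0
            nlinarith
    calc (1 + κ / 4) ^ n * ((Real.exp (-(2 * κ * n)) + Q * Q' * (1 - c) ^ n) /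
          Real.exp (-(κ * n))) ≤ Real.exp (κ / 4 * n) * ((Real.exp (-(2 * κ * n)) +
            Real.exp (-(2 * κ * n))) / Real.exp (-(κ * n))) := by gcongr
      _ = 2 * (Real.exp (-(κ / 4 * n)) * Real.exp (-(κ / 2 * n))) := by
          rw [← Real.exp_add, ← two_mul, mul_div_assoc, ← Real.exp_sub, mul_left_comm,
            ← Real.exp_add]
          congr 2
          ring
      _ ≤ 2 * (1 / 4 * Real.exp (-(8 * ε * n))) := by
          have := mul_le_mul_of_nonneg_right hεκ hn0
          have h3 : Real.exp (-(κ / 2 * n)) ≤ Real.exp (-(8 * ε * n)) := by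
            rw [Real.exp_le_exp]; nlinarith
          gcongr
      _ = _ := by ring

end Asymptotics

section StageAsymptotics

open Filter

variable {ι : Type*} [Fintype ι] {ν : ι → ℝ} {val : ι → ℤ} {a b : ι}

/-- With overwhelming probability, a random system solved by an unstructured vector `w` has no
further independent solution which is structured. -/
lemma exists_eventually_wsum_structured_le (hν : ∀ x, 0 ≤ ν x) (hν1 : ∑ x, ν x = 1) (hab : a ≠ b)
    (hc : 0 < ν a * ν b) {κ : ℝ} (hκ : 0 < κ) (hκc : κ ≤ ν a * ν b / 4) :
    ∃ ε₀ : ℝ, 0 < ε₀ ∧ ∀ ε, 0 < ε → ε ≤ ε₀ → ∀ᶠ n : ℕ in atTop,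
      ∀ (A : Type) [AddCommGroup A] [Finite A] (q : ℕ) [Fact q.Prime],
        IsCoprime (val a - val b) (Nat.card A : ℤ) → IsCoprime (val a - val b) (q : ℤ) → 2 < q →
        (Nat.card A : ℝ) ≤ Real.exp (ε * n) → (q : ℝ) ≤ Real.exp (ε * n) →
        ∀ w : Fin n → A, charSum (ν a * ν b) w ≤ 1 + Real.exp (-(2 * κ * n)) →
        ∀ (g : Fin n → A) (lam : ZMod q) (δ : Fin n → ZMod q),
        wsum (pw (pw ν)) (fun M : Fin n → Fin n → ι => (∀ j, rdot val (M j) w = g j) ∧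
          ∃ u : Fin n → ZMod q, Nondegenerate w u ∧
            1 + Real.exp (-(κ * n)) ≤ charSum (ν a * ν b) (fun i => (w i, u i)) ∧
            ∀ j, rdot val (M j) u = lam * u j + δ j) ≤
          Real.exp (-(8 * ε * n)) / (Nat.card A : ℝ) ^ n := by
  have hc' := mul_atoms_le hν hν1 hab
  set c := ν a * ν b
  obtain ⟨ε₀, hε₀, H⟩ := exists_stage_parameters hc hc' hκ hκc
  refine ⟨ε₀, hε₀, fun ε hε hle => ?_⟩
  filter_upwards [H ε hε hle] with n hn A _ _ q hq hA hq' hq2 hAe hqe w hw g lam δ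
  have hA1 : (1 : ℝ) ≤ Nat.card A := by exact_mod_cast Nat.card_pos
  obtain ⟨h1, h2, ⟨m, hm1, hm2, hm3, hm4⟩, h5⟩ :=
    hn (Nat.card A) q hA1 (by exact_mod_cast hq.out.one_lt.le) hAe hqe
  have hν'' := pw_nonneg (J := Fin n) (pw_nonneg (J := Fin n) hν)
  have k1 := wsum_exists_moderate_le hν hν1 hab hA hq' hc (Real.exp_pos (-(κ * n)))
    (by linarith : 0 ≤ 1 + κ / 4) w hw g lam δ
  have k2 := wsum_exists_structured_le hν hν1 hab hA hq' hq2 hc w hw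
    (by linarith : 0 < κ / 4) h1 h2 hm1 (by simpa using hm2) (by simpa using hm3) g lam δ
  rw [Fintype.card_fin] at k1 k2
  have k3 : charSum (c / 32) w ^ n ≤ (1 + Nat.card A * Real.exp (-(2 * κ * n / 64))) ^ n := by
    have := charSum_div_le hc hc' hw
    have := one_le_charSum (by linarith : 0 ≤ c / 32) (by linarith) w
    gcongr
  have hr := (lazyRatio_pos (c := c) (by linarith : 0 < κ / 4)).le
  calc _ ≤ _ := le_trans (wsum_mono hν'' ?_) (wsum_or_le hν'' _ _)
    _ ≤ _ := add_le_add k1 k2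
    _ ≤ Real.exp (-(8 * ε * n)) / 2 / (Nat.card A : ℝ) ^ n +
        Real.exp (-(8 * ε * n)) / 2 / (Nat.card A : ℝ) ^ n := by
        refine add_le_add ?_ ?_
        · gcongr
        · refine div_le_div_of_nonneg_right (le_trans ?_ hm4) (by positivity)
          gcongr
    _ = _ := by rw [← add_div, add_halves]
  rintro M ⟨hM, u, hnd, hu, hMu⟩
  rcases le_or_gt (1 + κ / 4) (charSum (c / 32) (fun i => (w i, u i))) with hk | hk
  · exact Or.inr ⟨hM, u, Finset.mem_filter.2 ⟨Finset.mem_univ _, hnd, hk⟩, hMu⟩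
  · have := charSum_mono (by linarith : 0 ≤ c / 32) (by linarith : c / 32 ≤ c) hc'
      (fun i => (w i, u i))
    exact Or.inl ⟨hM, u, Finset.mem_filter.2 ⟨Finset.mem_univ _, hu, this.trans hk.le⟩, hMu⟩

end StageAsymptotics

section PointMass

open Filter

variable {I : Type*} [Fintype I] [DecidableEq I]

lemma charSum_zero {G : Type*} [AddCommGroup G] [Finite G] (c : ℝ) :
    charSum c (0 : I → G) = Nat.card G := by
  simp [charSum, card_addChar_eq]

/-- Adding coordinates in a trivial group does not change the sum over characters. -/
lemma charSum_punit_prod {q : ℕ} [Fact q.Prime] (c : ℝ) (u : I → ZMod q) :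
    charSum c (fun i => ((0 : PUnit.{1}), u i)) = charSum c u := by
  rw [charSum, sum_addChar_prod, charSum, ← (AddChar.zmodAddEquiv (n := q)).toEquiv.sum_comp]
  refine Finset.sum_congr rfl fun x _ => ?_
  rw [Fintype.sum_eq_single 0]
  · simp [prodChar_apply, zchar]
  · intro χ hχ
    refine absurd (DFunLike.ext _ _ fun x => ?_ : χ = 0) hχ
    rw [Subsingleton.elim x 0, AddChar.map_zero_eq_one, AddChar.map_zero_eq_one]

lemma sum_charSum_le {q : ℕ} [Fact q.Prime] {c : ℝ} (hc : 0 < c) (hc' : c ≤ 1 / 4) :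
    ∑ u : I → ZMod q, charSum c u ≤
      (q : ℝ) ^ Fintype.card I * (1 + q * (1 - c) ^ Fintype.card I) := by
  have h := sum_charSum_pair_le (q := q) hc hc' (0 : I → PUnit.{1})
  rw [charSum_zero] at h
  simpa [charSum_punit_prod] using h

/-- Most vectors are unstructured. -/
lemma le_card_charSum_lt {q : ℕ} [Fact q.Prime] {c η : ℝ} (hc : 0 < c) (hc' : c ≤ 1 / 4)
    (hη : 0 < η) :
    (q : ℝ) ^ Fintype.card I * (1 - q * (1 - c) ^ Fintype.card I / η) ≤
      ((Finset.univ.filter fun u : I → ZMod q => charSum c u < 1 + η).card : ℝ) := by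
  have h := sum_charSum_le (I := I) (q := q) hc hc'
  have hcard : ((Finset.univ : Finset (I → ZMod q)).card : ℝ) = (q : ℝ) ^ Fintype.card I := by
    rw [Finset.card_univ, Fintype.card_fun, ZMod.card]; push_cast; rfl
  have h2 := Finset.card_filter_add_card_filter_not (s := (Finset.univ : Finset (I → ZMod q)))
    (fun u : I → ZMod q => charSum c u < 1 + η)
  have h2' : ((Finset.univ.filter fun u : I → ZMod q => charSum c u < 1 + η).card : ℝ) +
      ((Finset.univ.filter fun u : I → ZMod q => ¬ charSum c u < 1 + η).card : ℝ) =
      (q : ℝ) ^ Fintype.card I := by rw [← hcard]; exact_mod_cast h2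
  have h3 : ((Finset.univ.filter fun u : I → ZMod q => ¬ charSum c u < 1 + η).card : ℝ) * η ≤
      ∑ u : I → ZMod q, (charSum c u - 1) := by
    rw [← nsmul_eq_mul, ← Finset.sum_const]
    refine (Finset.sum_le_sum fun u hu => ?_).trans
      (Finset.sum_le_sum_of_subset_of_nonneg (Finset.subset_univ _) fun u _ _ => ?_)
    · have := not_lt.1 (Finset.mem_filter.1 hu).2
      linarith
    · have := one_le_charSum hc.le hc' u
      linarith
  rw [Finset.sum_sub_distrib, Finset.sum_const, nsmul_eq_mul, mul_one, hcard] at h3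
  have h4 : ((Finset.univ.filter fun u : I → ZMod q => ¬ charSum c u < 1 + η).card : ℝ) ≤
      (q : ℝ) ^ Fintype.card I * (q * (1 - c) ^ Fintype.card I) / η := by
    rw [le_div_iff₀ hη]
    linarith
  have e : (q : ℝ) ^ Fintype.card I * (1 - q * (1 - c) ^ Fintype.card I / η) =
      (q : ℝ) ^ Fintype.card I - (q : ℝ) ^ Fintype.card I * (q * (1 - c) ^ Fintype.card I) / η := by
    ring
  linarith

variable {ι : Type*} [Fintype ι] {ν : ι → ℝ} {val : ι → ℤ} {a b : ι}

/-- With overwhelming probability, no structured vector is an eigenvector. -/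
lemma exists_eventually_wsum_structured_eigenvector_le (hν : ∀ x, 0 ≤ ν x) (hν1 : ∑ x, ν x = 1)
    (hab : a ≠ b) (hc : 0 < ν a * ν b) {κ : ℝ} (hκ : 0 < κ) (hκc : κ ≤ ν a * ν b / 4) :
    ∃ ε₀ : ℝ, 0 < ε₀ ∧ ∀ ε, 0 < ε → ε ≤ ε₀ → ∀ᶠ n : ℕ in atTop,
      ∀ (q : ℕ) [Fact q.Prime], IsCoprime (val a - val b) (q : ℤ) → 2 < q →
        (q : ℝ) ≤ Real.exp (ε * n) → ∀ lam : ZMod q,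
        wsum (pw (pw ν)) (fun M : Fin n → Fin n → ι =>
          ∃ u : Fin n → ZMod q, u ≠ 0 ∧ 1 + Real.exp (-(κ * n)) ≤ charSum (ν a * ν b) u ∧
            ∀ j, rdot val (M j) u = lam * u j) ≤ Real.exp (-(8 * ε * n)) := by
  obtain ⟨ε₀, hε₀, H⟩ := exists_eventually_wsum_structured_le (val := val) hν hν1 hab hc hκ hκc
  refine ⟨ε₀, hε₀, fun ε hε hle => ?_⟩
  filter_upwards [H ε hε hle] with n hn q _ hq hq2 hqe lam
  have h := hn PUnit q (by simp [isCoprime_one_right]) hq hq2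
    (by simp; positivity) hqe 0 (by rw [charSum_zero]; simp; positivity) 0 lam 0
  simp only [Nat.card_unique, Nat.cast_one, one_pow, div_one] at h
  refine (wsum_mono (pw_nonneg (pw_nonneg hν)) ?_).trans h
  rintro M ⟨u, hu, hT, hM⟩
  refine ⟨by simp, u,
    nondegenerate_of_coprime (by simp) hu, ?_, by simpa using hM⟩
  refine hT.trans (le_of_eq ?_)
  rw [← charSum_punit_prod]

end PointMass

section Counting

variable {α : Type*} [Fintype α] {U : Type*}

lemma sum_mul_card_filter (ω : α → ℝ) (s : Finset U) (E : U → α → Prop) :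
    ∑ a, ω a * ((s.filter fun u => E u a).card : ℝ) = ∑ u ∈ s, wsum ω (E u) := by
  simp only [wsum_eq_sum_mul]
  rw [Finset.sum_comm]
  refine Finset.sum_congr rfl fun a _ => ?_
  rw [← Finset.mul_sum, Finset.sum_boole]

/-- Markov's inequality for the number of events that occur. -/
lemma mul_wsum_le_card_le {ω : α → ℝ} (h : ∀ a, 0 ≤ ω a) (s : Finset U) (E : U → α → Prop)
    (k : ℝ) :
    k * wsum ω (fun a => k ≤ ((s.filter fun u => E u a).card : ℝ)) ≤ ∑ u ∈ s, wsum ω (E u) := by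
  rw [← sum_mul_card_filter]
  exact mul_wsum_le_sum h (fun a => Nat.cast_nonneg _) k

lemma sum_wsum_le_mul {ω : α → ℝ} (h : ∀ a, 0 ≤ ω a) (s : Finset U) (E : U → α → Prop)
    (F : α → Prop) (hF : ∀ u ∈ s, ∀ a, E u a → F a) {k : ℝ}
    (hk : ∀ a, F a → ((s.filter fun u => E u a).card : ℝ) ≤ k) :
    ∑ u ∈ s, wsum ω (E u) ≤ k * wsum ω F := by
  rw [← sum_mul_card_filter, wsum_eq_sum_mul, Finset.mul_sum]
  refine Finset.sum_le_sum fun a _ => ?_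
  by_cases ha : F a
  · rw [if_pos ha, mul_one, mul_comm k]
    exact mul_le_mul_of_nonneg_left (hk a ha) (h a)
  · rw [if_neg ha, Finset.filter_false_of_mem fun u hu hE => ha (hF u hu a hE)]
    simp

end Counting

section Systems

variable {I : Type*} [Fintype I] [DecidableEq I]
  {ι : Type*} [Fintype ι] {ν : ι → ℝ} {val : ι → ℤ} {a b : ι}

/-- The probability that a random matrix solves two systems at once. -/
lemma wsum_system_pair_le {A : Type*} [AddCommGroup A] [Finite A] {q : ℕ} [Fact q.Prime]
    (hν : ∀ x, 0 ≤ ν x) (hν1 : ∑ x, ν x = 1) (hab : a ≠ b)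
    (hA : IsCoprime (val a - val b) (Nat.card A : ℤ)) (hq' : IsCoprime (val a - val b) (q : ℤ))
    {w : I → A} {u : I → ZMod q} {K : ℝ} (hK : charSum (ν a * ν b) (fun i => (w i, u i)) ≤ K)
    (g : I → A) (g' : I → ZMod q) :
    wsum (pw (pw ν)) (fun M : I → I → ι =>
      (∀ j, rdot val (M j) w = g j) ∧ ∀ j, rdot val (M j) u = g' j) ≤
      K ^ Fintype.card I / ((Nat.card A : ℝ) ^ Fintype.card I * (q : ℝ) ^ Fintype.card I) := by
  simp only [← forall_and]
  rw [wsum_pw_forall (pw ν) (fun j (X : I → ι) => rdot val X w = g j ∧ rdot val X u = g' j),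
    ← mul_pow, ← div_pow, ← Finset.card_univ, ← Finset.prod_const]
  refine Finset.prod_le_prod (fun j _ => wsum_nonneg (pw_nonneg hν) _) fun j _ => ?_
  refine (wsum_rdot_pair_le hν hν1 hab hA hq' w u _ _).trans ?_
  gcongr

lemma le_wsum_system {A : Type*} [AddCommGroup A] [Finite A]
    (hν : ∀ x, 0 ≤ ν x) (hν1 : ∑ x, ν x = 1) (hab : a ≠ b)
    (hA : IsCoprime (val a - val b) (Nat.card A : ℤ)) {w : I → A} {η : ℝ} (hη : η ≤ 1)
    (hw : charSum (ν a * ν b) w ≤ 1 + η) (g : I → A) :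
    (1 - η) ^ Fintype.card I / (Nat.card A : ℝ) ^ Fintype.card I ≤
      wsum (pw (pw ν)) (fun M : I → I → ι => ∀ j, rdot val (M j) w = g j) := by
  rw [wsum_pw_forall (pw ν) (fun j (X : I → ι) => rdot val X w = g j), ← div_pow,
    ← Finset.card_univ, ← Finset.prod_const]
  refine Finset.prod_le_prod (fun j _ => div_nonneg (by linarith) (Nat.cast_nonneg _))
    fun j _ => ?_
  refine le_trans ?_ (le_wsum_rdot hν hν1 hab hA w _)
  refine div_le_div_of_nonneg_right (by linarith) (Nat.cast_nonneg _)

/-- `w` is an eigenvector such that no independent vector is sent to `0` or `w` by the matrix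
shifted by the eigenvalue. -/
def IsolatedEigenvector {F : Type*} [Field F] (val : ι → ℤ) (M : I → I → ι) (lam : F)
    (w : I → F) : Prop :=
  w ≠ 0 ∧ (∀ j, rdot val (M j) w = lam * w j) ∧ ∀ u ∉ Submodule.span F {w},
    ∀ s : F, s = 0 ∨ s = 1 → ¬ ∀ j, rdot val (M j) u = lam * u j + s * w j

/-- `w` is an eigenvector which the shifted matrix reaches, up to the factor `s`, from `u`. -/
def IsCompanion {F : Type*} [Field F] (val : ι → ℤ) (M : I → I → ι) (lam : F)
    (w : I → F) (s : F) (u : I → F) : Prop :=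
  (∀ j, rdot val (M j) w = lam * w j) ∧ ∀ j, rdot val (M j) u = lam * u j + s * w j

lemma IsolatedEigenvector.mem_span {F : Type*} [Field F] {M : I → I → ι} {lam : F} {w u : I → F}
    (h : IsolatedEigenvector val M lam w) (hu : ∀ j, rdot val (M j) u = lam * u j) :
    u ∈ Submodule.span F {w} := by
  by_contra hcon
  exact h.2.2 u hcon 0 (by simp) (by simpa using hu)

lemma card_mem_span_singleton_le {q : ℕ} [Fact q.Prime] (w : I → ZMod q)
    (s : Finset (I → ZMod q)) (hs : ∀ u ∈ s, u ∈ Submodule.span (ZMod q) {w}) : s.card ≤ q := by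
  calc s.card ≤ ((Finset.univ : Finset (ZMod q)).image fun k => k • w).card := by
        refine Finset.card_le_card fun u hu => ?_
        obtain ⟨k, hk⟩ := Submodule.mem_span_singleton.1 (hs u hu)
        exact Finset.mem_image.2 ⟨k, Finset.mem_univ _, hk⟩
    _ ≤ _ := Finset.card_image_le
    _ = q := by rw [Finset.card_univ, ZMod.card]

lemma rdot_add_smul {F : Type*} [Field F] (X : I → ι) (u w : I → F) (k : F) :
    rdot val X (u + k • w) = rdot val X u + k * rdot val X w := by
  simp only [rdot_eq_dotProduct, dotProduct_add, dotProduct_smul, smul_eq_mul]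

/-- An eigenvector which is not isolated has a structured companion or many unstructured ones. -/
lemma isolated_or_structured_or_many {q : ℕ} [Fact q.Prime] {M : I → I → ι} {lam : ZMod q}
    {w : I → ZMod q} (hw0 : w ≠ 0) (hw : ∀ j, rdot val (M j) w = lam * w j) (c η' : ℝ) :
    IsolatedEigenvector val M lam w ∨ ∃ s ∈ ({0, 1} : Finset (ZMod q)),
      ((∀ j, rdot val (M j) w = lam * w j) ∧ ∃ u, Nondegenerate w u ∧
        1 + η' ≤ charSum c (fun i => (w i, u i)) ∧
        ∀ j, rdot val (M j) u = lam * u j + s * w j) ∨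
      (q : ℝ) ≤ (((Finset.univ.filter fun u : I → ZMod q =>
        charSum c (fun i => (w i, u i)) < 1 + η').filter fun u =>
          IsCompanion val M lam w s u).card : ℝ) := by
  by_cases hiso : IsolatedEigenvector val M lam w
  · exact Or.inl hiso
  right
  have : ∃ u ∉ Submodule.span (ZMod q) {w}, ∃ s ∈ ({0, 1} : Finset (ZMod q)),
      ∀ j, rdot val (M j) u = lam * u j + s * w j := by
    by_contra! hcon
    exact hiso ⟨hw0, hw, fun u hu s hs hM => by
      obtain ⟨j, hj⟩ := hcon u hu s (by simpa using hs)
      exact hj (hM j)⟩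
  obtain ⟨u, hu, s, hs, hM⟩ := this
  refine ⟨s, hs, ?_⟩
  have hsol : ∀ k : ZMod q, ∀ j, rdot val (M j) (u + k • w) =
      lam * (u + k • w) j + s * w j := by
    intro k j
    rw [rdot_add_smul, hM j, hw j]
    simp only [Pi.add_apply, Pi.smul_apply, smul_eq_mul]
    ring
  have hspan : ∀ k : ZMod q, u + k • w ∉ Submodule.span (ZMod q) {w} := by
    intro k hk
    apply hu
    have := Submodule.sub_mem _ hk
      (Submodule.smul_mem _ k (Submodule.mem_span_singleton_self (R := ZMod q) w))
    rwa [add_sub_cancel_right] at this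
  by_cases hstr : ∃ k : ZMod q, 1 + η' ≤ charSum c (fun i => (w i, (u + k • w) i))
  · obtain ⟨k, hk⟩ := hstr
    exact Or.inl ⟨hw, u + k • w, nondegenerate_of_notMem_span (hspan k), hk, hsol k⟩
  · push Not at hstr
    right
    have hinj : Function.Injective fun k : ZMod q => u + k • w := fun k k' h =>
      smul_left_injective _ hw0 (add_left_cancel h)
    rw [Nat.cast_le]
    calc q = ((Finset.univ : Finset (ZMod q)).image fun k => u + k • w).card := by
          rw [Finset.card_image_of_injective _ hinj, Finset.card_univ, ZMod.card]
      _ ≤ _ := by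
          refine Finset.card_le_card fun v hv => ?_
          obtain ⟨k, -, rfl⟩ := Finset.mem_image.1 hv
          exact Finset.mem_filter.2 ⟨Finset.mem_filter.2 ⟨Finset.mem_univ _, hstr k⟩, hw, hsol k⟩

/-- Lower bound for the probability that an isolated eigenvector exists. -/
lemma le_mul_wsum_isolated {q : ℕ} [Fact q.Prime] (hν : ∀ x, 0 ≤ ν x) (hν1 : ∑ x, ν x = 1)
    (hab : a ≠ b) (hq' : IsCoprime (val a - val b) (q : ℤ)) (hc : 0 < ν a * ν b)
    {η η' t : ℝ} (hη : 0 < η) (hη1 : η ≤ 1) (hη' : 0 < η') (hq2 : 2 < q) (lam : ZMod q)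
    (ht0 : 0 ≤ t) (ht : ∀ w : I → ZMod q, charSum (ν a * ν b) w ≤ 1 + η → ∀ s : ZMod q,
      wsum (pw (pw ν)) (fun M : I → I → ι => (∀ j, rdot val (M j) w = lam * w j) ∧
          ∃ u, Nondegenerate w u ∧ 1 + η' ≤ charSum (ν a * ν b) (fun i => (w i, u i)) ∧
            ∀ j, rdot val (M j) u = lam * u j + s * w j) ≤ t / (q : ℝ) ^ Fintype.card I) :
    (1 - η) ^ Fintype.card I * (1 - q * (1 - ν a * ν b) ^ Fintype.card I / η) -
        2 * (t + (1 + η') ^ Fintype.card I / q) ≤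
      q * wsum (pw (pw ν)) (fun M : I → I → ι => ∃ w, IsolatedEigenvector val M lam w) := by
  have hc' := mul_atoms_le hν hν1 hab
  set c := ν a * ν b with hcdef
  set n := Fintype.card I with hn
  have hq0 : (0 : ℝ) < q := by exact_mod_cast (by omega : 0 < q)
  have hω := pw_nonneg (J := I) (pw_nonneg (J := I) hν)
  set S := Finset.univ.filter fun u : I → ZMod q => charSum c u < 1 + η with hS
  have hqA : IsCoprime (val a - val b) (Nat.card (ZMod q) : ℤ) := by rwa [Nat.card_zmod]
  have hS0 : ∀ w ∈ S, w ≠ 0 := by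
    rintro w hw rfl
    have := (Finset.mem_filter.1 hw).2
    rw [charSum_zero, Nat.card_zmod] at this
    have h3 : (3 : ℝ) ≤ q := by exact_mod_cast hq2
    linarith
  have hpn : (0 : ℝ) < (q : ℝ) ^ n := by positivity
  have hcardle : ∀ s : Finset (I → ZMod q), (s.card : ℝ) ≤ (q : ℝ) ^ n := fun s => by
    have := Finset.card_le_univ s
    rw [Fintype.card_fun, ZMod.card] at this
    exact_mod_cast this
  -- unstructured companions
  have hmany : ∀ w s, wsum (pw (pw ν)) (fun M : I → I → ι =>
      (q : ℝ) ≤ (((Finset.univ.filter fun u : I → ZMod q =>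
        charSum c (fun i => (w i, u i)) < 1 + η').filter fun u =>
          IsCompanion val M lam w s u).card : ℝ)) ≤
        (1 + η') ^ n / q / (q : ℝ) ^ n := by
    intro w s
    have h1 := mul_wsum_le_card_le hω (Finset.univ.filter fun u : I → ZMod q =>
        charSum c (fun i => (w i, u i)) < 1 + η')
      (fun u (M : I → I → ι) => IsCompanion val M lam w s u) (q : ℝ)
    have h2 := h1.trans (Finset.sum_le_card_nsmul _ _
      ((1 + η') ^ n / ((q : ℝ) ^ n * (q : ℝ) ^ n)) fun u hu => by
        have := wsum_system_pair_le hν hν1 hab hqA hq' (Finset.mem_filter.1 hu).2.le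
          (fun j => lam * w j) (fun j => lam * u j + s * w j)
        rwa [Nat.card_zmod] at this)
    rw [nsmul_eq_mul] at h2
    rw [div_div, mul_comm (q : ℝ), ← div_div, le_div_iff₀ hq0, mul_comm]
    refine h2.trans ?_
    calc _ ≤ (q : ℝ) ^ n * ((1 + η') ^ n / ((q : ℝ) ^ n * (q : ℝ) ^ n)) := by
          refine mul_le_mul_of_nonneg_right ?_ (by positivity)
          exact hcardle _
      _ = _ := by field_simp
  -- the probability that a given vector is an isolated eigenvector
  have hw : ∀ w ∈ S, (1 - η) ^ n / (q : ℝ) ^ n - 2 * (t + (1 + η') ^ n / q) / (q : ℝ) ^ n ≤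
      wsum (pw (pw ν)) (fun M : I → I → ι => IsolatedEigenvector val M lam w) := by
    intro w hw
    have hT : charSum c w ≤ 1 + η := (Finset.mem_filter.1 hw).2.le
    have h1 := le_wsum_system hν hν1 hab hqA hη1 hT (fun j => lam * w j)
    rw [Nat.card_zmod] at h1
    have h2 := h1.trans (wsum_mono hω fun M hM =>
      isolated_or_structured_or_many (hS0 w hw) hM c η')
    have h3 := h2.trans (wsum_or_le hω _ _)
    have h4 := wsum_exists_le hω ({0, 1} : Finset (ZMod q)) (fun s (M : I → I → ι) =>
      ((∀ j, rdot val (M j) w = lam * w j) ∧ ∃ u, Nondegenerate w u ∧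
        1 + η' ≤ charSum c (fun i => (w i, u i)) ∧
        ∀ j, rdot val (M j) u = lam * u j + s * w j) ∨
      (q : ℝ) ≤ (((Finset.univ.filter fun u : I → ZMod q =>
        charSum c (fun i => (w i, u i)) < 1 + η').filter fun u =>
          IsCompanion val M lam w s u).card : ℝ))
    have h5 := h4.trans (Finset.sum_le_sum fun s _ => (wsum_or_le hω _ _).trans
      (add_le_add (ht w hT s) (hmany w s)))
    rw [Finset.sum_const, Finset.card_pair (zero_ne_one), two_nsmul] at h5
    have e : 2 * (t + (1 + η') ^ n / q) / (q : ℝ) ^ n =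
      (t / q ^ n + (1 + η') ^ n / q / q ^ n) + (t / q ^ n + (1 + η') ^ n / q / q ^ n) := by
      ring
    linarith
  have h6 := Finset.card_nsmul_le_sum S _ _ hw
  have h7 := sum_wsum_le_mul hω S (fun w (M : I → I → ι) => IsolatedEigenvector val M lam w)
    (fun M => ∃ w, IsolatedEigenvector val M lam w) (fun w _ M h => ⟨w, h⟩) (k := (q : ℝ)) (by
      rintro M ⟨w, hw⟩
      exact_mod_cast card_mem_span_singleton_le w _ fun u hu =>
        hw.mem_span ((Finset.mem_filter.1 hu).2 : IsolatedEigenvector val M lam u).2.1)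
  refine le_trans ?_ (h6.trans h7)
  have h8 := le_card_charSum_lt (I := I) (q := q) hc hc' hη
  rw [nsmul_eq_mul, mul_sub (S.card : ℝ)]
  have ht0' : 0 ≤ t + (1 + η') ^ n / q := by
    positivity
  refine sub_le_sub ?_ ?_
  · calc _ = (q : ℝ) ^ n * (1 - q * (1 - c) ^ n / η) * ((1 - η) ^ n / (q : ℝ) ^ n) := by
          field_simp
      _ ≤ _ := by
          have : 0 ≤ (1 - η) ^ n := pow_nonneg (by linarith) _
          gcongr
  · calc _ ≤ (q : ℝ) ^ n * (2 * (t + (1 + η') ^ n / q) / (q : ℝ) ^ n) := by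
          gcongr
          exact hcardle _
      _ = _ := by field_simp

end Systems

section JointEigenvalues

variable {I : Type*} [Fintype I] [DecidableEq I]
  {ι : Type*} [Fintype ι] {ν : ι → ℝ} {val : ι → ℤ} {a b : ι}

/-- `w` is an eigenvector or zero. -/
def IsEigen {F : Type*} [Field F] (val : ι → ℤ) (M : I → I → ι) (lam : F) (w : I → F) : Prop :=
  ∀ j, rdot val (M j) w = lam * w j

lemma IsEigen.smul {F : Type*} [Field F] {M : I → I → ι} {lam : F} {w : I → F}
    (h : IsEigen val M lam w) (k : F) : IsEigen val M lam (k • w) := by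
  intro j
  have := h j
  rw [rdot_eq_dotProduct] at this ⊢
  rw [dotProduct_smul, this, Pi.smul_apply, smul_eq_mul, smul_eq_mul]
  ring

/-- Upper bound for the probability of having prescribed eigenvalues modulo two primes. -/
lemma wsum_joint_eigenvalue_le {p q : ℕ} [Fact p.Prime] [Fact q.Prime] (hpq : p ≠ q)
    (hν : ∀ x, 0 ≤ ν x) (hν1 : ∑ x, ν x = 1) (hab : a ≠ b)
    (hp' : IsCoprime (val a - val b) (p : ℤ)) (hq' : IsCoprime (val a - val b) (q : ℤ))
    {η η' t : ℝ} (ht0 : 0 ≤ t) (hη' : 0 < η') (lam : ZMod p) (lam' : ZMod q)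
    (hs : wsum (pw (pw ν)) (fun M : I → I → ι => ∃ w : I → ZMod p, w ≠ 0 ∧
      1 + η ≤ charSum (ν a * ν b) w ∧ ∀ j, rdot val (M j) w = lam * w j) ≤ t)
    (ht : ∀ w : I → ZMod p, charSum (ν a * ν b) w ≤ 1 + η →
      wsum (pw (pw ν)) (fun M : I → I → ι => (∀ j, rdot val (M j) w = lam * w j) ∧
          ∃ u : I → ZMod q, Nondegenerate w u ∧
            1 + η' ≤ charSum (ν a * ν b) (fun i => (w i, u i)) ∧
            ∀ j, rdot val (M j) u = lam' * u j) ≤ t / (p : ℝ) ^ Fintype.card I) :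
    wsum (pw (pw ν)) (fun M : I → I → ι => (∃ w : I → ZMod p, w ≠ 0 ∧ IsEigen val M lam w) ∧
      ∃ u : I → ZMod q, u ≠ 0 ∧ IsEigen val M lam' u) ≤
      2 * t + (1 + η') ^ Fintype.card I / ((p - 1) * (q - 1)) := by
  set c := ν a * ν b with hcdef
  set n := Fintype.card I with hn
  have hp1 : (1 : ℝ) < p := by exact_mod_cast (Fact.out : p.Prime).one_lt
  have hq1 : (1 : ℝ) < q := by exact_mod_cast (Fact.out : q.Prime).one_lt
  have hω := pw_nonneg (J := I) (pw_nonneg (J := I) hν)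
  have hpA : IsCoprime (val a - val b) (Nat.card (ZMod p) : ℤ) := by rwa [Nat.card_zmod]
  have hcardle : ∀ s : Finset (I → ZMod p), (s.card : ℝ) ≤ (p : ℝ) ^ n := fun s => by
    have := Finset.card_le_univ s
    rw [Fintype.card_fun, ZMod.card] at this
    exact_mod_cast this
  set S := Finset.univ.filter fun w : I → ZMod p => charSum c w < 1 + η with hS
  set P := Finset.univ.filter fun x : (I → ZMod p) × (I → ZMod q) =>
    charSum c (fun i => (x.1 i, x.2 i)) < 1 + η' with hP
  have hcop : (Nat.card (ZMod p)).Coprime q := by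
    rw [Nat.card_zmod]
    exact (Nat.coprime_primes Fact.out Fact.out).2 hpq
  -- pairs of unstructured vectors
  have h1 := mul_wsum_le_card_le hω P (fun x (M : I → I → ι) =>
    IsEigen val M lam x.1 ∧ IsEigen val M lam' x.2) (((p : ℝ) - 1) * (q - 1))
  have h2 : ∑ x ∈ P, wsum (pw (pw ν)) (fun M : I → I → ι =>
      IsEigen val M lam x.1 ∧ IsEigen val M lam' x.2) ≤ (1 + η') ^ n := by
    refine (Finset.sum_le_card_nsmul _ _ ((1 + η') ^ n / ((p : ℝ) ^ n * (q : ℝ) ^ n))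
      fun x hx => ?_).trans ?_
    · have := wsum_system_pair_le hν hν1 hab hpA hq' (Finset.mem_filter.1 hx).2.le
        (fun j => lam * x.1 j) (fun j => lam' * x.2 j)
      rwa [Nat.card_zmod] at this
    · rw [nsmul_eq_mul]
      have h3 : (P.card : ℝ) ≤ (p : ℝ) ^ n * (q : ℝ) ^ n := by
        have := Finset.card_le_univ P
        rw [Fintype.card_prod, Fintype.card_fun, Fintype.card_fun, ZMod.card, ZMod.card] at this
        exact_mod_cast this
      calc _ ≤ ((p : ℝ) ^ n * (q : ℝ) ^ n) * ((1 + η') ^ n / ((p : ℝ) ^ n * (q : ℝ) ^ n)) :=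
            mul_le_mul_of_nonneg_right h3 (by positivity)
        _ = _ := by field_simp
  have hpq0 : (0 : ℝ) < (p - 1) * (q - 1) := mul_pos (by linarith) (by linarith)
  have h4 := (le_div_iff₀' hpq0).2 (h1.trans h2)
  -- unstructured vectors with a structured companion
  have h5 := wsum_exists_le hω S (fun w (M : I → I → ι) =>
    (∀ j, rdot val (M j) w = lam * w j) ∧ ∃ u : I → ZMod q, Nondegenerate w u ∧
      1 + η' ≤ charSum c (fun i => (w i, u i)) ∧ ∀ j, rdot val (M j) u = lam' * u j)
  have h6 := h5.trans (Finset.sum_le_card_nsmul _ _ (t / (p : ℝ) ^ n)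
    fun w hw => ht w (Finset.mem_filter.1 hw).2.le)
  rw [nsmul_eq_mul] at h6
  have h7 : (S.card : ℝ) * (t / (p : ℝ) ^ n) ≤ t := by
    calc _ ≤ (p : ℝ) ^ n * (t / (p : ℝ) ^ n) := mul_le_mul_of_nonneg_right (hcardle S)
          (by positivity)
      _ = t := by field_simp
  have h8 := (wsum_or_le hω _ _).trans (add_le_add (h6.trans h7) h4)
  have h9 := (wsum_or_le hω _ _).trans (add_le_add hs h8)
  refine (wsum_mono hω ?_).trans (h9.trans (le_of_eq (by ring)))
  rintro M ⟨⟨w, hw0, hw⟩, u, hu0, hu⟩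
  by_cases hA : ∃ w : I → ZMod p, w ≠ 0 ∧ 1 + η ≤ charSum c w ∧
      ∀ j, rdot val (M j) w = lam * w j
  · exact Or.inl hA
  push Not at hA
  right
  have hgood : ∀ w : I → ZMod p, w ≠ 0 → IsEigen val M lam w → w ∈ S := by
    intro w hw0 hw
    refine Finset.mem_filter.2 ⟨Finset.mem_univ _, ?_⟩
    by_contra hcon
    obtain ⟨j, hj⟩ := hA w hw0 (not_lt.1 hcon)
    exact hj (hw j)
  by_cases hB : ∃ x : (I → ZMod p) × (I → ZMod q), x.1 ≠ 0 ∧ x.2 ≠ 0 ∧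
      IsEigen val M lam x.1 ∧ IsEigen val M lam' x.2 ∧ x ∉ P
  · obtain ⟨x, hx1, hx2, hx3, hx4, hx5⟩ := hB
    refine Or.inl ⟨x.1, hgood _ hx1 hx3, hx3, x.2, nondegenerate_of_coprime hcop hx2, ?_, hx4⟩
    by_contra hcon
    exact hx5 (Finset.mem_filter.2 ⟨Finset.mem_univ _, not_le.1 hcon⟩)
  · push Not at hB
    right
    have hle : ((Finset.univ.erase (0 : ZMod p) ×ˢ Finset.univ.erase (0 : ZMod q)).card) ≤
        (P.filter fun x => IsEigen val M lam x.1 ∧ IsEigen val M lam' x.2).card := by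
      refine Finset.card_le_card_of_injOn (fun k => (k.1 • w, k.2 • u)) ?_ ?_
      · rintro ⟨k, k'⟩ hk
        rw [Finset.mem_coe, Finset.mem_product] at hk
        have hk1 : k • w ≠ 0 := smul_ne_zero (Finset.ne_of_mem_erase hk.1) hw0
        have hk2 : k' • u ≠ 0 := smul_ne_zero (Finset.ne_of_mem_erase hk.2) hu0
        exact Finset.mem_coe.2 (Finset.mem_filter.2 ⟨hB (k • w, k' • u) hk1 hk2 (hw.smul k)
          (hu.smul k'), hw.smul k, hu.smul k'⟩)
      · rintro ⟨k, k'⟩ - ⟨l, l'⟩ - h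
        have h' := Prod.ext_iff.1 h
        exact Prod.ext (smul_left_injective _ hw0 h'.1) (smul_left_injective _ hu0 h'.2)
    rw [Finset.card_product, Finset.card_erase_of_mem (Finset.mem_univ _),
      Finset.card_erase_of_mem (Finset.mem_univ _), Finset.card_univ, Finset.card_univ,
      ZMod.card, ZMod.card] at hle
    have : (((p - 1) * (q - 1) : ℕ) : ℝ) = (p - 1) * (q - 1) := by
      push_cast [Nat.cast_sub (Fact.out : p.Prime).one_lt.le,
        Nat.cast_sub (Fact.out : q.Prime).one_lt.le]
      ring
    rw [← this]
    refine Nat.cast_le.2 (hle.trans (le_of_eq ?_))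
    congr!

end JointEigenvalues

section SimpleRoots

open Polynomial

lemma exists_root_minpoly_map_isRoot {K : Type*} [Field K] (φ : ℤ →+* K) (lam : K) :
    ∀ (n : ℕ) (f : ℤ[X]), f.natDegree = n → f.Monic → (f.map φ).IsRoot lam →
      ∃ z : ℂ, IsIntegral ℤ z ∧ minpoly ℤ z ∣ f ∧ ((minpoly ℤ z).map φ).IsRoot lam := by
  intro n
  induction n using Nat.strong_induction_on with
  | _ n ih =>
    intro f hn hf hlam
    have hfC : (f.map (Int.castRingHom ℂ)).degree ≠ 0 := by
      rw [hf.degree_map]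
      intro h0
      rw [hf.natDegree_eq_zero.1 (natDegree_eq_of_degree_eq_some h0)] at hlam
      simp at hlam
    obtain ⟨z, hz⟩ := Complex.exists_root (f := f.map (Int.castRingHom ℂ))
      (lt_of_le_of_ne (by
        rw [hf.degree_map]
        exact zero_le_degree_iff.2 hf.ne_zero) hfC.symm)
    have hz' : aeval z f = 0 := by
      rw [IsRoot, eval_map] at hz
      exact hz
    have h_int : IsIntegral ℤ z := ⟨f, hf, hz'⟩
    obtain ⟨h, rfl⟩ := minpoly.isIntegrallyClosed_dvd h_int hz'
    have hm := minpoly.monic h_int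
    have hh : h.Monic := hm.of_mul_monic_left hf
    rw [Polynomial.map_mul, IsRoot, eval_mul, mul_eq_zero] at hlam
    rcases hlam with hlam | hlam
    · exact ⟨z, h_int, dvd_mul_right _ _, hlam⟩
    · have hlt : h.natDegree < n := by
        rw [← hn, hm.natDegree_mul hh]
        have := minpoly.natDegree_pos h_int
        omega
      obtain ⟨y, hy, hdvd, hroot⟩ := ih _ hlt h rfl hh hlam
      exact ⟨y, hy, hdvd.mul_left _, hroot⟩

/-- A simple root of the reduction of a monic integer polynomial lifts to a simple complex root. -/
lemma exists_simple_complex_root {K : Type*} [Field K] (φ : ℤ →+* K) {lam : K} {f : ℤ[X]}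
    (hf : f.Monic) (h : (f.map φ).rootMultiplicity lam = 1) :
    ∃ z : ℂ, (f.map (Int.castRingHom ℂ)).rootMultiplicity z = 1 := by
  have hroot : (f.map φ).IsRoot lam :=
    (rootMultiplicity_pos (hf.map φ).ne_zero).1 (by omega)
  obtain ⟨z, h_int, ⟨g, rfl⟩, hm⟩ := exists_root_minpoly_map_isRoot φ lam _ f rfl hf hroot
  have hmm := minpoly.monic h_int
  have hg : g.Monic := hmm.of_mul_monic_left hf
  rw [Polynomial.map_mul, rootMultiplicity_mul (mul_ne_zero (hmm.map φ).ne_zero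
    (hg.map φ).ne_zero)] at h
  have h1 := (rootMultiplicity_pos (hmm.map φ).ne_zero).2 hm
  have h2 : ¬ (g.map φ).IsRoot lam := fun hcon => by
    have := (rootMultiplicity_pos (hg.map φ).ne_zero).2 hcon
    omega
  refine ⟨z, ?_⟩
  rw [Polynomial.map_mul, rootMultiplicity_mul (mul_ne_zero (hmm.map _).ne_zero
    (hg.map _).ne_zero)]
  have h3 : rootMultiplicity z (g.map (Int.castRingHom ℂ)) = 0 := by
    rw [rootMultiplicity_eq_zero_iff]
    intro hcon
    exfalso
    rw [IsRoot, eval_map] at hcon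
    obtain ⟨k, rfl⟩ := minpoly.isIntegrallyClosed_dvd h_int hcon
    apply h2
    rw [Polynomial.map_mul]
    exact hm.dvd (dvd_mul_right _ _)
  rw [h3, add_zero]
  have h4 : (minpoly ℤ z).map (Int.castRingHom ℂ) = (minpoly ℚ z).map (algebraMap ℚ ℂ) := by
    rw [minpoly.isIntegrallyClosed_eq_field_fractions' ℚ h_int, Polynomial.map_map]
    congr 1
  have h5 : ((minpoly ℤ z).map (Int.castRingHom ℂ)).Separable := by
    rw [h4]
    exact (minpoly.irreducible h_int.tower_top).separable.map
  have h6 := rootMultiplicity_le_one_of_separable h5 z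
  have h7 : 0 < rootMultiplicity z ((minpoly ℤ z).map (Int.castRingHom ℂ)) := by
    refine (rootMultiplicity_pos (hmm.map _).ne_zero).2 ?_
    rw [IsRoot, eval_map]
    exact minpoly.aeval ℤ z
  omega

/-- An eigenvector such that no independent vector is sent to a multiple of it by the shifted
endomorphism spans the generalized eigenspace. -/
lemma rootMultiplicity_charpoly_eq_one {K V : Type*} [Field K] [AddCommGroup V] [Module K V]
    [FiniteDimensional K V] (φ : Module.End K V) (lam : K) {w : V} (hw : w ≠ 0)
    (hφ : φ w = lam • w)
    (h : ∀ u ∉ Submodule.span K {w}, ∀ s : K, s = 0 ∨ s = 1 → φ u ≠ lam • u + s • w) :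
    φ.charpoly.rootMultiplicity lam = 1 := by
  have key : ∀ (k : ℕ) (v : V), ((φ - lam • (1 : Module.End K V)) ^ k) v = 0 →
      v ∈ Submodule.span K {w} := by
    intro k
    induction k with
    | zero => intro v hv; simp at hv; simp [hv]
    | succ k ih =>
      intro v hv
      rw [pow_succ, Module.End.mul_apply] at hv
      obtain ⟨s, hs⟩ := Submodule.mem_span_singleton.1 (ih _ hv)
      have hs' : φ v = lam • v + s • w := by
        rw [hs]; simp
      by_contra hcon
      by_cases hs0 : s = 0
      · exact h v hcon 0 (Or.inl rfl) (by rw [hs', hs0])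
      · refine h (s⁻¹ • v) (fun hmem => hcon ?_) 1 (Or.inr rfl) ?_
        · have := Submodule.smul_mem _ s hmem
          rwa [smul_inv_smul₀ hs0] at this
        · rw [map_smul, hs', smul_add, inv_smul_smul₀ hs0, one_smul, smul_comm]
  have hspan : φ.maxGenEigenspace lam = Submodule.span K {w} := by
    refine le_antisymm (fun v hv => ?_) ?_
    · obtain ⟨k, hk⟩ := Module.End.mem_maxGenEigenspace _ _ _ |>.1 hv
      exact key k v hk
    · rw [Submodule.span_singleton_le_iff_mem, Module.End.mem_maxGenEigenspace]
      exact ⟨1, by simp [hφ]⟩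
  rw [← LinearMap.finrank_maxGenEigenspace_eq, hspan, finrank_span_singleton hw]

end SimpleRoots

section IntegerMatrices

variable {I : Type*} [Fintype I] [DecidableEq I] {ι : Type*} {val : ι → ℤ}

/-- The integer matrix with entries `val (M i j)`. -/
def intMatrix (val : ι → ℤ) (M : I → I → ι) : Matrix I I ℤ := Matrix.of fun i j => val (M i j)

lemma rdot_eq_mulVec {F : Type*} [Field F] (M : I → I → ι) (u : I → F) (j : I) :
    rdot val (M j) u = ((intMatrix val M).map (Int.castRingHom F)).toLin' u j := by
  rw [rdot_eq_dotProduct]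
  rfl

lemma IsolatedEigenvector.rootMultiplicity_eq_one {F : Type*} [Field F] {M : I → I → ι} {lam : F}
    {w : I → F} (h : IsolatedEigenvector val M lam w) :
    ((intMatrix val M).charpoly.map (Int.castRingHom F)).rootMultiplicity lam = 1 := by
  rw [← Matrix.charpoly_map, ← Matrix.charpoly_toLin']
  obtain ⟨h0, h1, h2⟩ := h
  simp only [rdot_eq_mulVec] at h1 h2
  refine rootMultiplicity_charpoly_eq_one _ _ h0 (funext h1) fun u hu s hs he => ?_
  exact h2 u hu s hs (congrFun he)

lemma exists_isEigen_of_rootMultiplicity {F : Type*} [Field F] {M : I → I → ι} {lam : F}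
    (h : ((intMatrix val M).charpoly.map (Int.castRingHom F)).rootMultiplicity lam = 1) :
    ∃ w : I → F, w ≠ 0 ∧ IsEigen val M lam w := by
  rw [← Matrix.charpoly_map, ← Matrix.charpoly_toLin'] at h
  have hr : (Matrix.toLin' ((intMatrix val M).map (Int.castRingHom F))).charpoly.IsRoot lam :=
    (Polynomial.rootMultiplicity_pos (LinearMap.charpoly_monic _).ne_zero).1 (by omega)
  obtain ⟨w, hw⟩ := ((Module.End.hasEigenvalue_iff_isRoot_charpoly _ _).2 hr).exists_hasEigenvector
  refine ⟨w, hw.2, fun j => ?_⟩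
  rw [rdot_eq_mulVec, hw.apply_eq_smul]
  rfl

end IntegerMatrices

section PrimeSupply

open Filter

/-- The primes in the interval `(√x, x]`. -/
def primeWindow (x : ℝ) : Finset ℕ :=
  (Finset.Icc 1 ⌊x⌋₊).filter fun p => p.Prime ∧ √x < p

lemma prime_of_mem_primeWindow {x : ℝ} {p : ℕ} (hp : p ∈ primeWindow x) : p.Prime :=
  (Finset.mem_filter.1 hp).2.1

lemma sqrt_lt_of_mem_primeWindow {x : ℝ} {p : ℕ} (hp : p ∈ primeWindow x) : √x < p :=
  (Finset.mem_filter.1 hp).2.2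

lemma le_of_mem_primeWindow {x : ℝ} (hx : 0 ≤ x) {p : ℕ} (hp : p ∈ primeWindow x) : (p : ℝ) ≤ x :=
  (Nat.cast_le.2 (Finset.mem_Icc.1 (Finset.mem_filter.1 hp).1).2).trans (Nat.floor_le hx)

lemma eventually_sqrt_le_card_primeWindow :
    ∀ᶠ x : ℝ in atTop, √x ≤ (primeWindow x).card := by
  have hlog := (isLittleO_log_rpow_atTop (r := 1 / 4) (by norm_num)).bound (c := 1) one_pos
  filter_upwards [hlog, eventually_ge_atTop 10000] with x hx hx4
  have hx0 : 0 ≤ x := by linarith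
  have hl0 : 0 < Real.log x := Real.log_pos (by linarith)
  rw [one_mul, Real.norm_of_nonneg hl0.le, Real.norm_of_nonneg (Real.rpow_nonneg hx0 _)] at hx
  set s := x ^ (1 / 4 : ℝ) with hs
  have hs0 : 0 ≤ s := Real.rpow_nonneg hx0 _
  have hs4 : s ^ 4 = x := by
    rw [hs, ← Real.rpow_natCast, ← Real.rpow_mul hx0]
    norm_num
  have hs10 : 10 ≤ s := by
    by_contra! hcon
    have : s ^ 4 < 10 ^ 4 := pow_lt_pow_left₀ hcon hs0 (by norm_num)
    rw [hs4] at this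
    norm_num at this
    linarith
  have hsq : √x = s ^ 2 := by
    rw [← hs4, show s ^ 4 = (s ^ 2) ^ 2 by ring, Real.sqrt_sq (by positivity)]
  have hl2 : Real.log (x + 2) ≤ 2 * s := by
    calc Real.log (x + 2) ≤ Real.log (x ^ 2) := Real.log_le_log (by linarith) (by nlinarith)
      _ = 2 * Real.log x := by rw [Real.log_pow]; norm_num
      _ ≤ 2 * s := by linarith
  have h2 := Real.log_two_gt_d9
  have hpi := Chebyshev.pi_ge' (x := x) (by linarith)
  have h3 : 2 * √x ≤ ((x - 1) * Real.log 2 - Real.log (x + 2)) / Real.log x := by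
    rw [le_div_iff₀ hl0, hsq]
    calc 2 * s ^ 2 * Real.log x ≤ 2 * s ^ 2 * s := by gcongr
      _ ≤ (s ^ 4 - 1) * (1 / 2) - 2 * s := by
          have : 10 * s ^ 3 ≤ s ^ 4 := by
            rw [pow_succ s 3, mul_comm]; gcongr
          have : 100 * s ≤ s ^ 3 := by
            rw [show s ^ 3 = s ^ 2 * s by ring]
            have : (100 : ℝ) ≤ s ^ 2 := by nlinarith
            gcongr
          nlinarith
      _ ≤ _ := by
          rw [hs4]
          have : (x - 1) * (1 / 2) ≤ (x - 1) * Real.log 2 := by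
            gcongr
            · linarith
            · linarith
          linarith
  have h4 := h3.trans hpi
  have h5 : Nat.primeCounting ⌊x⌋₊ ≤ (primeWindow x).card + ⌊√x⌋₊ := by
    rw [Nat.primeCounting, Nat.primeCounting', Nat.count_eq_card_filter_range]
    calc _ ≤ (primeWindow x ∪ Finset.Icc 1 ⌊√x⌋₊).card := by
          refine Finset.card_le_card fun p hp => ?_
          obtain ⟨hp1, hp2⟩ := Finset.mem_filter.1 hp
          have hp3 := Finset.mem_range.1 hp1
          rw [Finset.mem_union]
          by_cases h : √x < p
          · exact Or.inl (Finset.mem_filter.2 ⟨Finset.mem_Icc.2 ⟨hp2.one_lt.le, by omega⟩, hp2, h⟩)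
          · exact Or.inr (Finset.mem_Icc.2 ⟨hp2.one_lt.le, Nat.le_floor (not_lt.1 h)⟩)
      _ ≤ _ := (Finset.card_union_le _ _).trans (by simp)
  have h6 : (Nat.primeCounting ⌊x⌋₊ : ℝ) ≤ (primeWindow x).card + √x := by
    calc (Nat.primeCounting ⌊x⌋₊ : ℝ) ≤ (primeWindow x).card + (⌊√x⌋₊ : ℝ) := by exact_mod_cast h5
      _ ≤ _ := by
        gcongr
        exact Nat.floor_le (Real.sqrt_nonneg x)
  linarith

end PrimeSupply

section FinalNumerics

open Filter

lemma one_add_pow_le {x : ℝ} (hx : 0 ≤ x) {n : ℕ} (h : n * x ≤ 1) :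
    (1 + x) ^ n ≤ 1 + 2 * (n * x) := by
  have h0 : 0 ≤ n * x := by positivity
  have h1 : (1 + x) ^ n ≤ Real.exp (n * x) := by
    rw [Real.exp_nat_mul]
    have := Real.add_one_le_exp x
    gcongr
    linarith
  have h2 := (abs_le.1 (Real.abs_exp_sub_one_sub_id_le (x := n * x) (by rwa [abs_of_nonneg h0]))).2
  nlinarith

variable {c ε : ℝ} {n p q : ℕ}

lemma inv_le_exp_of_exp_le (h : Real.exp (ε * n / 2) ≤ p) :
    1 / (p : ℝ) ≤ Real.exp (-(ε * n / 2)) := by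
  rw [Real.exp_neg, ← one_div]
  exact one_div_le_one_div_of_le (Real.exp_pos _) h

lemma one_sub_le_isolated_bound (hc : c ≤ 1 / 4) (hε : 0 < ε) (hεc : ε ≤ c / 8)
    (hn : 1 ≤ n) (hsmall : 28 * (n * Real.exp (-(ε * n / 2))) ≤ 1)
    (hp : Real.exp (ε * n / 2) ≤ p) (hp' : p ≤ Real.exp (ε * n)) :
    1 - 28 * (n * Real.exp (-(ε * n / 2))) ≤
      (1 - Real.exp (-(2 * (c / 8) * n))) ^ n *
        (1 - p * (1 - c) ^ n / Real.exp (-(2 * (c / 8) * n))) -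
        2 * (Real.exp (-(8 * ε * n)) + (1 + Real.exp (-(c / 8 * n))) ^ n / p) := by
  have hn1 : (1 : ℝ) ≤ n := by exact_mod_cast hn
  have hεn : 0 ≤ ε * n := by positivity
  have hcn : ε * n ≤ c / 8 * n := by gcongr
  set y := Real.exp (-(ε * n / 2)) with hy
  have hy0 : 0 < y := Real.exp_pos _
  have hy1 : y ≤ n * y := by nlinarith
  have e1 : Real.exp (-(2 * (c / 8) * n)) ≤ y := Real.exp_le_exp.2 (by linarith)
  have e2 : Real.exp (-(8 * ε * n)) ≤ y := Real.exp_le_exp.2 (by linarith)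
  have e3 : Real.exp (-(c / 8 * n)) ≤ y := Real.exp_le_exp.2 (by linarith)
  have e4 : p * (1 - c) ^ n / Real.exp (-(2 * (c / 8) * n)) ≤ y := by
    have : (1 - c) ^ n ≤ Real.exp (-(c * n)) := by
      rw [show -(c * n) = n * (-c) by ring, Real.exp_nat_mul]
      have := Real.add_one_le_exp (-c)
      exact pow_le_pow_left₀ (by linarith) (by linarith) n
    rw [div_le_iff₀ (Real.exp_pos _)]
    calc p * (1 - c) ^ n ≤ Real.exp (ε * n) * Real.exp (-(c * n)) :=
          mul_le_mul hp' this (pow_nonneg (by linarith) _) (Real.exp_pos _).le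
      _ ≤ _ := by
          rw [← Real.exp_add, hy, ← Real.exp_add]
          exact Real.exp_le_exp.2 (by nlinarith)
  have e5 := inv_le_exp_of_exp_le hp
  have h1 : 1 - n * y ≤ (1 - Real.exp (-(2 * (c / 8) * n))) ^ n := by
    have h := one_add_mul_le_pow (a := -Real.exp (-(2 * (c / 8) * n)))
      (by linarith) n
    rw [← sub_eq_add_neg] at h
    nlinarith
  have h2 : (1 + Real.exp (-(c / 8 * n))) ^ n / p ≤ 3 * y := by
    rw [div_eq_mul_one_div]
    have h3 : n * Real.exp (-(c / 8 * n)) ≤ n * y := by gcongr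
    have h4 := one_add_pow_le (n := n) (Real.exp_pos (-(c / 8 * n))).le (by linarith)
    exact mul_le_mul (by linarith) e5 (by positivity) (by norm_num)
  have h3 : (1 - n * y) * (1 - y) ≤ (1 - Real.exp (-(2 * (c / 8) * n))) ^ n *
        (1 - p * (1 - c) ^ n / Real.exp (-(2 * (c / 8) * n))) :=
    mul_le_mul h1 (by linarith) (by linarith) (pow_nonneg (by linarith) _)
  nlinarith

lemma joint_bound_le_one_add (hε : 0 < ε) (hεc : ε ≤ c / 8)
    (hn : 1 ≤ n) (hsmall : 28 * (n * Real.exp (-(ε * n / 2))) ≤ 1) (hp2 : 2 ≤ p) (hq2 : 2 ≤ q)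
    (hp : Real.exp (ε * n / 2) ≤ p) (hp' : p ≤ Real.exp (ε * n))
    (hq : Real.exp (ε * n / 2) ≤ q) (hq' : q ≤ Real.exp (ε * n)) :
    p * q * (2 * Real.exp (-(8 * ε * n)) +
      (1 + Real.exp (-(c / 8 * n))) ^ n / ((p - 1) * (q - 1))) ≤
      1 + 28 * (n * Real.exp (-(ε * n / 2))) := by
  have hn1 : (1 : ℝ) ≤ n := by exact_mod_cast hn
  have hεn : 0 ≤ ε * n := by positivity
  have hcn : ε * n ≤ c / 8 * n := by gcongr
  set y := Real.exp (-(ε * n / 2)) with hy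
  have hy0 : 0 < y := Real.exp_pos _
  have hy1 : y ≤ n * y := by nlinarith
  have e3 : Real.exp (-(c / 8 * n)) ≤ y := Real.exp_le_exp.2 (by linarith)
  have ratio : ∀ r : ℕ, 2 ≤ r → Real.exp (ε * n / 2) ≤ r → (r : ℝ) / (r - 1) ≤ 1 + 2 * y := by
    intro r hr hre
    have hr2 : (2 : ℝ) ≤ r := by exact_mod_cast hr
    have e5 := inv_le_exp_of_exp_le hre
    rw [div_le_iff₀ (by linarith), ← hy] at e5
    rw [div_le_iff₀ (by linarith)]
    nlinarith
  have h1 := ratio p hp2 hp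
  have h2 := ratio q hq2 hq
  have hp2' : (2 : ℝ) ≤ p := by exact_mod_cast hp2
  have hq2' : (2 : ℝ) ≤ q := by exact_mod_cast hq2
  have h3 : p * q * Real.exp (-(8 * ε * n)) ≤ y := by
    calc _ ≤ Real.exp (ε * n) * Real.exp (ε * n) * Real.exp (-(8 * ε * n)) := by gcongr
      _ ≤ _ := by
          rw [← Real.exp_add, ← Real.exp_add]
          exact Real.exp_le_exp.2 (by linarith)
  have h4 : (1 + Real.exp (-(c / 8 * n))) ^ n ≤ 1 + 2 * (n * y) := by
    have h3 : n * Real.exp (-(c / 8 * n)) ≤ n * y := by gcongr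
    have h4 := one_add_pow_le (n := n) (Real.exp_pos (-(c / 8 * n))).le (by linarith)
    linarith
  have h5 : (p : ℝ) / (p - 1) * (q / (q - 1)) * (1 + Real.exp (-(c / 8 * n))) ^ n ≤
      (1 + 2 * (n * y)) * (1 + 2 * (n * y)) * (1 + 2 * (n * y)) := by
    have : (0 : ℝ) ≤ q / (q - 1) := div_nonneg (by linarith) (by linarith)
    have : (0 : ℝ) ≤ p / (p - 1) := div_nonneg (by linarith) (by linarith)
    gcongr
    · linarith
    · linarith
  have h6 : p * q * ((1 + Real.exp (-(c / 8 * n))) ^ n / (((p : ℝ) - 1) * (q - 1))) =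
      (p : ℝ) / (p - 1) * (q / (q - 1)) * (1 + Real.exp (-(c / 8 * n))) ^ n := by
    field_simp
  rw [mul_add, h6]
  have h7 : 0 ≤ n * y := by positivity
  have h8 : n * y ≤ 1 := by linarith
  nlinarith [mul_nonneg h7 (sub_nonneg.2 h8), mul_nonneg (mul_nonneg h7 h7) (sub_nonneg.2 h8)]

end FinalNumerics

section SecondMoment

/-- If the variables `N p` have mean at least `1 - e` and are nearly uncorrelated, they are unlikely
to vanish simultaneously. -/
lemma sq_card_mul_wsum_forall_eq_zero_le {α U : Type*} [Fintype α] {ω : α → ℝ}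
    (h : ∀ a, 0 ≤ ω a) (h1 : ∑ a, ω a = 1) (P : Finset U) (N : U → α → ℝ) {e L : ℝ} (he : 0 ≤ e)
    (hN : ∀ p ∈ P, 1 - e ≤ ∑ a, ω a * N p a)
    (hNN : ∀ p ∈ P, ∀ q ∈ P, p ≠ q → ∑ a, ω a * (N p a * N q a) ≤ 1 + e)
    (hL : ∀ p ∈ P, ∀ a, (N p a - 1) ^ 2 ≤ L) :
    (P.card : ℝ) ^ 2 * wsum ω (fun a => ∀ p ∈ P, N p a = 0) ≤ 3 * e * P.card ^ 2 + L * P.card := by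
  have key : ∀ p ∈ P, ∀ q ∈ P, ∑ a, ω a * ((N p a - 1) * (N q a - 1)) ≤
      3 * e + if p = q then L else 0 := by
    intro p hp q hq
    by_cases hpq : p = q
    · subst hpq
      rw [if_pos rfl]
      calc _ ≤ ∑ a, ω a * L := by
            refine Finset.sum_le_sum fun a _ => mul_le_mul_of_nonneg_left ?_ (h a)
            rw [← sq]
            exact hL p hp a
        _ = L := by rw [← Finset.sum_mul, h1, one_mul]
        _ ≤ _ := by linarith
    · rw [if_neg hpq]
      have : ∑ a, ω a * ((N p a - 1) * (N q a - 1)) = ∑ a, ω a * (N p a * N q a) -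
          ∑ a, ω a * N p a - ∑ a, ω a * N q a + ∑ a, ω a := by
        rw [← Finset.sum_sub_distrib, ← Finset.sum_sub_distrib, ← Finset.sum_add_distrib]
        exact Finset.sum_congr rfl fun a _ => by ring
      rw [this, h1]
      linarith [hN p hp, hN q hq, hNN p hp q hq hpq]
  have hsq : ∀ a, (∑ p ∈ P, (N p a - 1)) ^ 2 = ∑ p ∈ P, ∑ q ∈ P, (N p a - 1) * (N q a - 1) :=
    fun a => by rw [sq, Finset.sum_mul_sum]
  calc (P.card : ℝ) ^ 2 * wsum ω (fun a => ∀ p ∈ P, N p a = 0)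
      ≤ (P.card : ℝ) ^ 2 *
          wsum ω (fun a => (P.card : ℝ) ^ 2 ≤ (∑ p ∈ P, (N p a - 1)) ^ 2) := by
        refine mul_le_mul_of_nonneg_left (wsum_mono h fun a ha => ?_) (by positivity)
        rw [Finset.sum_congr rfl fun p hp => by rw [ha p hp]]
        simp
    _ ≤ ∑ a, ω a * (∑ p ∈ P, (N p a - 1)) ^ 2 := mul_wsum_le_sum h (fun a => sq_nonneg _) _
    _ = ∑ p ∈ P, ∑ q ∈ P, ∑ a, ω a * ((N p a - 1) * (N q a - 1)) := by
        simp only [hsq, Finset.mul_sum]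
        rw [Finset.sum_comm]
        exact Finset.sum_congr rfl fun p _ => Finset.sum_comm
    _ ≤ ∑ p ∈ P, ∑ q ∈ P, (3 * e + if p = q then L else 0) :=
        Finset.sum_le_sum fun p hp => Finset.sum_le_sum fun q hq => key p hp q hq
    _ = 3 * e * P.card ^ 2 + L * P.card := by
        simp only [Finset.sum_add_distrib, Finset.sum_ite_eq, Finset.sum_const, nsmul_eq_mul]
        rw [Finset.sum_ite_mem, Finset.inter_self, Finset.sum_const, nsmul_eq_mul]
        ring

end SecondMoment

section SimpleRootCount

variable {I : Type*} [Fintype I] [DecidableEq I] {ι : Type*} {val : ι → ℤ}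

/-- `k` is a simple root modulo `p` of the characteristic polynomial. -/
def IsSimpleRootMod (val : ι → ℤ) (M : I → I → ι) (p k : ℕ) : Prop :=
  ((intMatrix val M).charpoly.map (Int.castRingHom (ZMod p))).rootMultiplicity (k : ZMod p) = 1

/-- The number of simple roots modulo `p` of the characteristic polynomial. -/
def simpleRootCount (val : ι → ℤ) (M : I → I → ι) (p : ℕ) : ℝ :=
  ∑ k ∈ Finset.range p, if IsSimpleRootMod val M p k then 1 else 0

lemma simpleRootCount_nonneg (M : I → I → ι) (p : ℕ) : 0 ≤ simpleRootCount val M p :=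
  Finset.sum_nonneg fun k _ => by split_ifs <;> norm_num

lemma simpleRootCount_le (M : I → I → ι) (p : ℕ) [Fact p.Prime] :
    simpleRootCount val M p ≤ Fintype.card I := by
  set f := (intMatrix val M).charpoly.map (Int.castRingHom (ZMod p)) with hf
  have hf0 : f ≠ 0 := ((Matrix.charpoly_monic _).map _).ne_zero
  rw [simpleRootCount, Finset.sum_boole]
  have h1 : ((Finset.range p).filter (IsSimpleRootMod val M p)).card ≤ f.roots.toFinset.card := by
    refine Finset.card_le_card_of_injOn (fun k => (k : ZMod p)) (fun k hk => ?_) ?_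
    · have hk := (Finset.mem_filter.1 hk).2
      rw [IsSimpleRootMod] at hk
      refine Multiset.mem_toFinset.2 ((Polynomial.mem_roots hf0).2 ?_)
      exact (Polynomial.rootMultiplicity_pos hf0).1 (by rw [hk]; exact one_pos)
    · intro k hk l hl hkl
      have hk := Finset.mem_range.1 (Finset.mem_filter.1 hk).1
      have hl := Finset.mem_range.1 (Finset.mem_filter.1 hl).1
      have := (ZMod.natCast_eq_natCast_iff' k l p).1 hkl
      rwa [Nat.mod_eq_of_lt hk, Nat.mod_eq_of_lt hl] at this
  have h2 : f.roots.toFinset.card ≤ Fintype.card I :=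
    (Multiset.toFinset_card_le _).trans ((Polynomial.card_roots' f).trans
      (Polynomial.natDegree_map_le.trans (Matrix.charpoly_natDegree_eq_dim _).le))
  exact_mod_cast h1.trans h2

lemma exists_simple_complex_root_of_simpleRootCount {M : I → I → ι} {p : ℕ} [Fact p.Prime]
    (h : simpleRootCount val M p ≠ 0) :
    ∃ z : ℂ, ((intMatrix val M).charpoly.map (Int.castRingHom ℂ)).rootMultiplicity z = 1 := by
  obtain ⟨k, -, hk⟩ := Finset.exists_ne_zero_of_sum_ne_zero h
  have hk : IsSimpleRootMod val M p k := by
    by_contra hcon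
    exact hk (if_neg hcon)
  exact exists_simple_complex_root _ (Matrix.charpoly_monic _) hk

variable [Fintype ι] (ω : (I → I → ι) → ℝ)

lemma sum_mul_simpleRootCount (p : ℕ) :
    ∑ M, ω M * simpleRootCount val M p =
      ∑ k ∈ Finset.range p, wsum ω (fun M => IsSimpleRootMod val M p k) := by
  simp only [simpleRootCount, Finset.mul_sum, wsum_eq_sum_mul]
  rw [Finset.sum_comm]

lemma sum_mul_simpleRootCount_mul (p q : ℕ) :
    ∑ M, ω M * (simpleRootCount val M p * simpleRootCount val M q) =
      ∑ k ∈ Finset.range p, ∑ l ∈ Finset.range q,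
        wsum ω (fun M => IsSimpleRootMod val M p k ∧ IsSimpleRootMod val M q l) := by
  simp only [simpleRootCount, Finset.sum_mul_sum, wsum_eq_sum_mul]
  simp only [Finset.mul_sum]
  rw [Finset.sum_comm]
  refine Finset.sum_congr rfl fun k _ => ?_
  rw [Finset.sum_comm]
  refine Finset.sum_congr rfl fun l _ => Finset.sum_congr rfl fun M _ => ?_
  by_cases h1 : IsSimpleRootMod val M p k <;> by_cases h2 : IsSimpleRootMod val M q l <;>
    simp [h1, h2]

end SimpleRootCount

section Main

open Filter

variable {ι : Type*} [Fintype ι] {ν : ι → ℝ} {val : ι → ℤ} {a b : ι}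

lemma exists_eventually_moment_bounds (hν : ∀ x, 0 ≤ ν x) (hν1 : ∑ x, ν x = 1) (hab : a ≠ b)
    (hc : 0 < ν a * ν b) :
    ∃ ε : ℝ, 0 < ε ∧ ∀ᶠ n : ℕ in atTop,
      (∀ (p : ℕ) [Fact p.Prime], IsCoprime (val a - val b) (p : ℤ) → 2 < p →
        Real.exp (ε * n / 2) ≤ p → (p : ℝ) ≤ Real.exp (ε * n) →
        1 - 28 * (n * Real.exp (-(ε * n / 2))) ≤
          ∑ M : Fin n → Fin n → ι, pw (pw ν) M * simpleRootCount val M p) ∧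
      (∀ (p q : ℕ) [Fact p.Prime] [Fact q.Prime], p ≠ q →
        IsCoprime (val a - val b) (p : ℤ) → 2 < p →
        Real.exp (ε * n / 2) ≤ p → (p : ℝ) ≤ Real.exp (ε * n) →
        IsCoprime (val a - val b) (q : ℤ) → 2 < q →
        Real.exp (ε * n / 2) ≤ q → (q : ℝ) ≤ Real.exp (ε * n) →
        ∑ M : Fin n → Fin n → ι, pw (pw ν) M * (simpleRootCount val M p * simpleRootCount val M q)
          ≤ 1 + 28 * (n * Real.exp (-(ε * n / 2)))) := by
  obtain ⟨ε₁, hε₁, H₁⟩ := exists_eventually_wsum_structured_le (val := val) hν hν1 hab hc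
    (κ := ν a * ν b / 8) (by linarith) (by linarith)
  obtain ⟨ε₂, hε₂, H₂⟩ := exists_eventually_wsum_structured_eigenvector_le (val := val) hν hν1 hab
    hc (κ := 2 * (ν a * ν b / 8)) (by linarith) (by linarith)
  have hc4 := mul_atoms_le hν hν1 hab
  set c := ν a * ν b with hcdef
  set ε := min (min ε₁ ε₂) (c / 8) with hεdef
  have hε : 0 < ε := lt_min (lt_min hε₁ hε₂) (by linarith)
  have hεc : ε ≤ c / 8 := min_le_right _ _
  have hεε₁ : ε ≤ ε₁ := (min_le_left _ _).trans (min_le_left _ _)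
  have hεε₂ : ε ≤ ε₂ := (min_le_left _ _).trans (min_le_right _ _)
  refine ⟨ε, hε, ?_⟩
  filter_upwards [H₁ ε hε hεε₁, H₂ ε hε hεε₂, eventually_ge_atTop 1,
    eventually_mul_exp_neg_mul_le (a := ε / 2) (C := 1 / 28) (by linarith) (by norm_num)]
    with n h₁ h₂ hn hsm
  have hsmall : 28 * (n * Real.exp (-(ε * n / 2))) ≤ 1 := by
    rw [show ε * n / 2 = ε / 2 * n by ring]
    linarith
  have hω := pw_nonneg (J := Fin n) (pw_nonneg (J := Fin n) hν)
  constructor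
  · intro p _ hdp hp2 hp hp'
    have hp0 : (0 : ℝ) < p := by exact_mod_cast (by omega : 0 < p)
    rw [sum_mul_simpleRootCount]
    have hk : ∀ k ∈ Finset.range p, (1 - 28 * (n * Real.exp (-(ε * n / 2)))) / p ≤
        wsum (pw (pw ν)) (fun M : Fin n → Fin n → ι => IsSimpleRootMod val M p k) := by
      intro k _
      rw [div_le_iff₀' hp0]
      refine (one_sub_le_isolated_bound hc4 hε hεc hn hsmall hp hp').trans ?_
      have := le_mul_wsum_isolated (I := Fin n) (val := val) hν hν1 hab hdp hc
        (η := Real.exp (-(2 * (c / 8) * n))) (η' := Real.exp (-(c / 8 * n)))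
        (t := Real.exp (-(8 * ε * n))) (Real.exp_pos _)
        (Real.exp_le_one_iff.2 (by nlinarith [(n.cast_nonneg : (0 : ℝ) ≤ n)]))
        (Real.exp_pos _) hp2 (k : ZMod p) (Real.exp_pos _).le (by
          intro w hw s
          have := h₁ (ZMod p) p (by rwa [Nat.card_zmod]) hdp hp2 (by rwa [Nat.card_zmod]) hp' w hw
            (fun j => k * w j) k (fun j => s * w j)
          rw [Nat.card_zmod] at this
          rwa [Fintype.card_fin])
      rw [Fintype.card_fin] at this
      refine this.trans (mul_le_mul_of_nonneg_left (wsum_mono hω fun M hM => ?_) hp0.le)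
      obtain ⟨w, hw⟩ := hM
      exact hw.rootMultiplicity_eq_one
    calc 1 - 28 * (n * Real.exp (-(ε * n / 2)))
        = ∑ k ∈ Finset.range p, (1 - 28 * (n * Real.exp (-(ε * n / 2)))) / p := by
          rw [Finset.sum_const, Finset.card_range, nsmul_eq_mul, mul_div_cancel₀ _ hp0.ne']
      _ ≤ _ := Finset.sum_le_sum hk
  · intro p q _ _ hpq hdp hp2 hp hp' hdq hq2 hq hq'
    rw [sum_mul_simpleRootCount_mul]
    have hkl : ∀ k ∈ Finset.range p, ∀ l ∈ Finset.range q,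
        wsum (pw (pw ν)) (fun M : Fin n → Fin n → ι =>
          IsSimpleRootMod val M p k ∧ IsSimpleRootMod val M q l) ≤
        2 * Real.exp (-(8 * ε * n)) +
          (1 + Real.exp (-(c / 8 * n))) ^ n / (((p : ℝ) - 1) * (q - 1)) := by
      intro k _ l _
      have := wsum_joint_eigenvalue_le (I := Fin n) (val := val) hpq hν hν1 hab hdp hdq
        (η := Real.exp (-(2 * (c / 8) * n))) (η' := Real.exp (-(c / 8 * n)))
        (t := Real.exp (-(8 * ε * n))) (Real.exp_pos _).le (Real.exp_pos _) (k : ZMod p)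
        (l : ZMod q) (h₂ p hdp hp2 hp' k) (by
          intro w hw
          have := h₁ (ZMod p) q (by rwa [Nat.card_zmod]) hdq hq2 (by rwa [Nat.card_zmod]) hq' w hw
            (fun j => k * w j) l 0
          rw [Nat.card_zmod] at this
          rw [Fintype.card_fin]
          simpa only [Pi.zero_apply, add_zero] using this)
      rw [Fintype.card_fin] at this
      exact (wsum_mono hω fun M hM => ⟨exists_isEigen_of_rootMultiplicity hM.1,
        exists_isEigen_of_rootMultiplicity hM.2⟩).trans this
    refine le_trans ?_ (joint_bound_le_one_add hε hεc hn hsmall hp2.le hq2.le hp hp' hq hq')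
    refine (Finset.sum_le_sum fun k hk => Finset.sum_le_sum (hkl k hk)).trans (le_of_eq ?_)
    simp only [Finset.sum_const, Finset.card_range, nsmul_eq_mul]
    ring

lemma isCoprime_of_prime_gt {d : ℤ} (hd : d ≠ 0) {p : ℕ} (hp : p.Prime) (h : |(d : ℝ)| < p) :
    IsCoprime d (p : ℤ) := by
  rw [Int.isCoprime_iff_gcd_eq_one]
  have : d.natAbs < p := by
    have h1 : ((d.natAbs : ℕ) : ℝ) < p := by rwa [Nat.cast_natAbs, Int.cast_abs]
    exact_mod_cast h1
  exact (Nat.coprime_of_lt_prime (Int.natAbs_ne_zero.2 hd) this hp).symm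

lemma exists_eventually_wsum_no_simple_root_le (hν : ∀ x, 0 ≤ ν x) (hν1 : ∑ x, ν x = 1)
    (hab : val a ≠ val b) (hc : 0 < ν a * ν b) :
    ∃ c : ℝ, 0 < c ∧ ∀ᶠ n : ℕ in atTop,
      wsum (pw (pw ν)) (fun M : Fin n → Fin n → ι => ¬ ∃ z : ℂ,
        ((intMatrix val M).charpoly.map (Int.castRingHom ℂ)).rootMultiplicity z = 1) ≤
      Real.exp (-(c * n)) := by
  obtain ⟨ε, hε, H⟩ := exists_eventually_moment_bounds (val := val) hν hν1
    (fun h => hab (congrArg val h)) hc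
  refine ⟨ε / 8, by linarith, ?_⟩
  have htop : Tendsto (fun n : ℕ => Real.exp (ε * n)) atTop atTop :=
    Real.tendsto_exp_atTop.comp (tendsto_natCast_atTop_atTop.const_mul_atTop hε)
  have htop2 : Tendsto (fun n : ℕ => Real.exp (ε / 2 * n)) atTop atTop :=
    Real.tendsto_exp_atTop.comp (tendsto_natCast_atTop_atTop.const_mul_atTop (by linarith))
  filter_upwards [H, eventually_ge_atTop 1, htop.eventually eventually_sqrt_le_card_primeWindow,
    htop2.eventually_ge_atTop (|((val a - val b : ℤ) : ℝ)| + 3),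
    eventually_mul_exp_neg_mul_le (a := ε / 8) (C := 1 / 100) (by linarith) (by norm_num)]
    with n h hn hcard hbig hz
  rw [← Real.exp_half] at hcard
  rw [show ε / 2 * n = ε * n / 2 by ring] at hbig
  set P := primeWindow (Real.exp (ε * n)) with hP
  set z := Real.exp (-(ε / 8 * n)) with hzdef
  have hz0 : 0 < z := Real.exp_pos _
  have hz1 : z ≤ 1 := Real.exp_le_one_iff.2 (by
    have : 0 ≤ ε / 8 * n := by positivity
    linarith)
  have hn1 : (1 : ℝ) ≤ n := by exact_mod_cast hn
  have hyz : Real.exp (-(ε * n / 2)) = z ^ 4 := by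
    rw [hzdef, ← Real.exp_nat_mul]
    congr 1
    push_cast
    ring
  rw [hyz] at h
  have hprime : ∀ p ∈ P, p.Prime ∧ IsCoprime (val a - val b) (p : ℤ) ∧ 2 < p ∧
      Real.exp (ε * n / 2) ≤ p ∧ (p : ℝ) ≤ Real.exp (ε * n) := by
    intro p hp
    have h1 := sqrt_lt_of_mem_primeWindow hp
    rw [← Real.exp_half] at h1
    have hpp := prime_of_mem_primeWindow hp
    refine ⟨hpp, isCoprime_of_prime_gt (sub_ne_zero.2 hab) hpp (by linarith), ?_, h1.le,
      le_of_mem_primeWindow (Real.exp_pos _).le hp⟩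
    have : (2 : ℝ) < p := by linarith [abs_nonneg ((val a - val b : ℤ) : ℝ)]
    exact_mod_cast this
  have hω := pw_nonneg (J := Fin n) (pw_nonneg (J := Fin n) hν)
  have hsq := sq_card_mul_wsum_forall_eq_zero_le hω (sum_pw _ (sum_pw _ hν1)) P
    (fun p M => simpleRootCount val M p) (e := 28 * (n * z ^ 4)) (L := (n : ℝ) ^ 2) (by positivity)
    (fun p hp => by
      obtain ⟨hp1, hp2, hp3, hp4, hp5⟩ := hprime p hp
      have := Fact.mk hp1
      exact h.1 p hp2 hp3 hp4 hp5)
    (fun p hp q hq hpq => by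
      obtain ⟨hp1, hp2, hp3, hp4, hp5⟩ := hprime p hp
      obtain ⟨hq1, hq2, hq3, hq4, hq5⟩ := hprime q hq
      have := Fact.mk hp1
      have := Fact.mk hq1
      exact h.2 p q hpq hp2 hp3 hp4 hp5 hq2 hq3 hq4 hq5)
    (fun p hp M => by
      have := Fact.mk (hprime p hp).1
      have h1 := simpleRootCount_nonneg (val := val) M p
      have h2 := simpleRootCount_le (val := val) M p
      rw [Fintype.card_fin] at h2
      exact sq_le_sq' (by linarith) (by linarith))
  set W := wsum (pw (pw ν)) (fun M : Fin n → Fin n → ι => ∀ p ∈ P, simpleRootCount val M p = 0)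
    with hW
  have hle : wsum (pw (pw ν)) (fun M : Fin n → Fin n → ι => ¬ ∃ z : ℂ,
      ((intMatrix val M).charpoly.map (Int.castRingHom ℂ)).rootMultiplicity z = 1) ≤ W := by
    refine wsum_mono hω fun M hM p hp => ?_
    by_contra hne
    have := Fact.mk (hprime p hp).1
    exact hM (exists_simple_complex_root_of_simpleRootCount hne)
  refine hle.trans ?_
  have hP0 : (0 : ℝ) < P.card := (Real.exp_pos _).trans_le hcard
  have hinv : 1 / (P.card : ℝ) ≤ z ^ 4 := by
    rw [← hyz]
    exact inv_le_exp_of_exp_le hcard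
  have h3 : W ≤ 84 * (n * z ^ 4) + n ^ 2 * (1 / P.card) := by
    rw [mul_one_div, ← sub_le_iff_le_add', le_div_iff₀ hP0]
    refine le_of_mul_le_mul_right ?_ hP0
    linarith
  have h4 : n ^ 2 * (1 / P.card) ≤ n ^ 2 * z ^ 4 := by gcongr
  have hnz : 0 ≤ n * z := by positivity
  have h5 : 84 * (n * z ^ 4) + n ^ 2 * z ^ 4 = z * (84 * (n * z) * z ^ 2 + (n * z) ^ 2 * z) := by
    ring
  have h6 : 84 * (n * z) * z ^ 2 + (n * z) ^ 2 * z ≤ 1 := by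
    calc _ ≤ 84 * (1 / 100) * 1 ^ 2 + (1 / 100) ^ 2 * (1 : ℝ) := by gcongr
      _ ≤ 1 := by norm_num
  nlinarith

end Main

lemma matrixProbZ_eq_wsum (n : ℕ) (μ : ℤ → ℝ) [Fintype (Function.support μ)]
    (E : Set (Matrix (Fin n) (Fin n) ℤ)) :
    matrixProbZ n μ E = wsum (pw (pw fun x : Function.support μ => μ x))
      (fun M => intMatrix Subtype.val M ∈ E) := by
  have hinj : Function.Injective (fun M : Fin n → Fin n → Function.support μ =>
      intMatrix Subtype.val M) := fun M M' h => funext fun i => funext fun j =>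
    Subtype.ext (congrFun (congrFun h i) j)
  rw [matrixProbZ, ← hinj.tsum_eq, tsum_fintype]
  · rfl
  · intro M hM
    have hprod : ∏ i, ∏ j, μ (M i j) ≠ 0 := fun h0 => hM (by simp [h0])
    exact ⟨fun i j => ⟨M i j, fun h0 => hprod (Finset.prod_eq_zero (Finset.mem_univ i)
      (Finset.prod_eq_zero (Finset.mem_univ j) h0))⟩, rfl⟩

theorem stmt9 (μ : ℤ → ℝ) (hpos : ∀ x, 0 ≤ μ x)
    (hfin : (Function.support μ).Finite)
    (hsum : ∑' x : ℤ, μ x = 1)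
    (hnt : 1 < (Function.support μ).ncard) :
    ∃ c C : ℝ, 0 < c ∧ 0 < C ∧ ∀ n : ℕ, 1 ≤ n →
      1 - C * Real.exp (-(c * n)) ≤
        matrixProbZ n μ {M : Matrix (Fin n) (Fin n) ℤ |
          ∃ z : ℂ, ((Matrix.charpoly M).map (Int.castRingHom ℂ)).rootMultiplicity z = 1} := by
  have : Fintype (Function.support μ) := hfin.fintype
  have hν1 : ∑ x : Function.support μ, μ x = 1 := by
    rw [← hsum, ← tsum_subtype_support μ, tsum_fintype]
  obtain ⟨a, ha, b, hb, hab⟩ := (Set.one_lt_ncard hfin).1 hnt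
  obtain ⟨c, hc, H⟩ := exists_eventually_wsum_no_simple_root_le
    (ν := fun x : Function.support μ => μ x) (val := Subtype.val) (a := ⟨a, ha⟩) (b := ⟨b, hb⟩)
    (fun x => hpos x) hν1 hab
    (mul_pos ((hpos a).lt_of_ne' ha) ((hpos b).lt_of_ne' hb))
  obtain ⟨n₀, hn₀⟩ := Filter.eventually_atTop.1 H
  have hω := fun n : ℕ => pw_nonneg (J := Fin n) (pw_nonneg (J := Fin n)
    (ω := fun x : Function.support μ => μ x) fun x => hpos x)
  refine ⟨c, Real.exp (c * n₀), hc, Real.exp_pos _, fun n _ => ?_⟩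
  rw [matrixProbZ_eq_wsum]
  rcases lt_or_ge n n₀ with hn | hn
  · refine le_trans ?_ (wsum_nonneg (hω n) _)
    rw [← Real.exp_add, sub_nonpos, Real.one_le_exp_iff]
    have : (n : ℝ) ≤ n₀ := by exact_mod_cast hn.le
    nlinarith
  · have h1 := wsum_add_not (pw (pw fun x : Function.support μ => μ x))
      (fun M : Fin n → Fin n → Function.support μ => intMatrix Subtype.val M ∈
        {M : Matrix (Fin n) (Fin n) ℤ |
          ∃ z : ℂ, ((Matrix.charpoly M).map (Int.castRingHom ℂ)).rootMultiplicity z = 1})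
    rw [sum_pw _ (sum_pw _ hν1)] at h1
    have h2 := hn₀ n hn
    have h3 : Real.exp (-(c * n)) ≤ Real.exp (c * n₀) * Real.exp (-(c * n)) :=
      le_mul_of_one_le_left (Real.exp_pos _).le (Real.one_le_exp (by positivity))
    simp only [Set.mem_ofPred_eq] at h1 ⊢
    linarith
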